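/- Let k ≥ 1 and n ≥ k+4 and let Z ∈ Mat_{n×(k+4)}(ℝ) be positive. For every totally nonnegative rank-k matrix C₀ ∈ Mat_{k×n}(ℝ) and every ε > 0 there exist a chord diagram D ∈ CD_{n,k}, a domino matrix C of D satisfying the sign rules, and an invertible matrix M ∈ GL_k(ℝ), such that every entry of M·(CZ) − C₀Z has absolute value less than ε. (Equivalently: the union over all D ∈ CD_{n,k} of the images Z̃(S_D) of the BCFW cells is a dense subset of the amplituhedron A_{n,k,4}(Z).) -/

import Mathlib

open scoped Classical

noncomputable section

/-- A rectangular `n × r` matrix (with `r ≤ n`) is *positive* if all of its maximal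
`r × r` minors (rows selected in increasing order) have positive determinant. -/
def IsPositiveMatrix {n r : ℕ} (Z : Matrix (Fin n) (Fin r) ℝ) : Prop :=
  ∀ f : Fin r → Fin n, StrictMono f → 0 < (Z.submatrix f id).det

/-- A `k × n` matrix is *totally nonnegative* if all of its `k × k` minors
(columns selected in increasing order) have nonnegative determinant. -/
def IsTotallyNonnegRect {k n : ℕ} (C : Matrix (Fin k) (Fin n) ℝ) : Prop :=
  ∀ g : Fin k → Fin n, StrictMono g → 0 ≤ (C.submatrix id g).det

/-- The row of `Z` whose (1-based) marker is `p`, i.e. the row with index `p - 1`. -/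
def markerRow {n r : ℕ} (Z : Matrix (Fin n) (Fin r) ℝ) (p : ℕ) : Fin r → ℝ :=
  if h : p - 1 < n then Z ⟨p - 1, h⟩ else 0

/-- The twistor coordinate `⟨Y a₁ a₂ a₃ a₄⟩`: the determinant of the `(k+4) × (k+4)` matrix
whose rows are the `k` rows of `Y` followed by the rows of `Z` with (1-based) markers
`a 0, a 1, a 2, a 3`. -/
def twistor {n k : ℕ} (Z : Matrix (Fin n) (Fin (k + 4)) ℝ)
    (Y : Matrix (Fin k) (Fin (k + 4)) ℝ) (a : Fin 4 → ℕ) : ℝ :=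
  ((Matrix.fromRows Y (Matrix.of fun t => markerRow Z (a t))).submatrix
    (⇑finSumFinEquiv.symm) id).det

/-- The row space of a matrix: the span of its rows. -/
def rowSpace {k n : ℕ} (A : Matrix (Fin k) (Fin n) ℝ) : Submodule ℝ (Fin n → ℝ) :=
  Submodule.span ℝ (Set.range fun r => A r)

/-- The minor of `A` on the set of rows `S` (taken in increasing order), using all columns;
defined to be `0` if `S` does not have the right cardinality. -/
def rowMinor {N r : ℕ} (A : Matrix (Fin N) (Fin r) ℝ) (S : Finset (Fin N)) : ℝ :=
  if h : S.card = r then (A.submatrix (fun t => (S.orderIsoOfFin h t).1) id).det else 0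

/-- The minor of `C` on the set of columns `J` (taken in increasing order), using all rows;
defined to be `0` if `J` does not have the right cardinality. -/
def colMinor {k N : ℕ} (C : Matrix (Fin k) (Fin N) ℝ) (J : Finset (Fin N)) : ℝ :=
  if h : J.card = k then (C.submatrix id (fun t => (J.orderIsoOfFin h t).1)).det else 0


/-- A chord diagram with `n` markers (labelled `1, …, n`) and `k` chords
`c_l = (tail l, tail l + 1, head l, head l + 1)`. -/
structure ChordDiagram (n k : ℕ) where
  tail : Fin k → ℕ
  head : Fin k → ℕ
  one_le_tail : ∀ l, 1 ≤ tail l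
  tail_add_two_le_head : ∀ l, tail l + 2 ≤ head l
  head_add_two_le : ∀ l, head l + 2 ≤ n
  tail_strictMono : StrictMono tail
  noncrossing : ∀ l m : Fin k, l < m → ¬(tail m < head l ∧ head l < head m)

namespace ChordDiagram

variable {n k : ℕ} (D : ChordDiagram n k)

/-- `c_m` is a descendant of `c_l`. -/
def Descendant (l m : Fin k) : Prop := D.tail l < D.tail m ∧ D.head m ≤ D.head l

/-- The number of descendants of `c_l`. -/
def below (l : Fin k) : ℕ := (Finset.univ.filter fun m => D.Descendant l m).card

/-- `c_l` is a top chord: it has no ancestor. -/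
def IsTop (l : Fin k) : Prop := ∀ m, ¬ D.Descendant m l

/-- `c_m` is the parent of `c_l`: the ancestor of `c_l` with the largest start. -/
def IsParent (m l : Fin k) : Prop :=
  D.Descendant m l ∧ ∀ m', D.Descendant m' l → D.tail m' ≤ D.tail m

/-- The number of chords starting after the start of `c_l` (equals `k - l` for the
`l`-th chord in the 1-based start-increasing ordering). -/
def behind (l : Fin k) : ℕ := (Finset.univ.filter fun m => D.tail l < D.tail m).card

/-- The number of descendants of `c_m` (the parent of `c_l`) that come before `c_l`
(equals `l - m - 1` in the 1-based start-increasing ordering). -/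
def beyond (l m : Fin k) : ℕ :=
  (Finset.univ.filter fun h => D.Descendant m h ∧ D.tail h < D.tail l).card

/-- The domino matrix of `D` with variables `α, β, γ, δ, ε` : the column with (0-based)
index `a` corresponds to the (1-based) marker `a + 1`. -/
def dominoMatrix (α β γ δ ε : Fin k → ℝ) : Matrix (Fin k) (Fin n) ℝ :=
  Matrix.of fun l a =>
    (if (a : ℕ) + 1 = D.tail l then α l else 0) +
    (if (a : ℕ) + 1 = D.tail l + 1 then β l else 0) +
    (if (a : ℕ) + 1 = D.head l then γ l else 0) +
    (if (a : ℕ) + 1 = D.head l + 1 then δ l else 0) +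
    (if D.IsTop l ∧ (a : ℕ) + 1 = n then ε l else 0) +
    (∑ m : Fin k, if D.IsParent m l then
        (if (a : ℕ) + 1 = D.tail m then ε l * α m else 0) +
        (if (a : ℕ) + 1 = D.tail m + 1 then ε l * β m else 0)
      else 0)

/-- The sign rules for the domino variables of `D`. -/
def SignRules (α β γ δ ε : Fin k → ℝ) : Prop :=
  (∀ l, 0 < α l) ∧ (∀ l, 0 < β l) ∧
  (∀ l, 0 < (-1 : ℝ) ^ D.below l * γ l) ∧
  (∀ l, 0 < (-1 : ℝ) ^ D.below l * δ l) ∧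
  (∀ l, D.IsTop l → 0 < (-1 : ℝ) ^ D.behind l * ε l) ∧
  (∀ l m, D.IsParent m l → 0 < (-1 : ℝ) ^ D.beyond l m * ε l) ∧
  (∀ l m, D.IsParent m l → D.head l = D.head m → δ l / γ l < δ m / γ m) ∧
  (∀ l m, D.head m = D.tail l → δ m / γ m < β l / α l)

end ChordDiagram


namespace ChordDiagram

section Glue

variable {i m l r : ℕ}

/-- The index of a left chord in a glued diagram. -/
def idxL (r : ℕ) (a : Fin l) : Fin (l + (r + 1)) := Fin.castAdd (r + 1) a

/-- The index of the separating chord in a glued diagram. -/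
def idxC (l r : ℕ) : Fin (l + (r + 1)) := Fin.natAdd l 0

/-- The index of a right chord in a glued diagram. -/
def idxR (l : ℕ) (b : Fin r) : Fin (l + (r + 1)) := Fin.natAdd l b.succ

@[simp] lemma idxL_val (a : Fin l) : (idxL r a : ℕ) = a := rfl
@[simp] lemma idxC_val : (idxC l r : ℕ) = l := rfl
@[simp] lemma idxR_val (b : Fin r) : (idxR l b : ℕ) = l + (b + 1) := rfl

/-- The family on the chords of a glued diagram with given values on the left chords, the
separating chord and the right chords. -/
def glueFun {X : Type*} (f : Fin l → X) (x : X) (g : Fin r → X) : Fin (l + (r + 1)) → X :=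
  Fin.append f (Fin.cons x g)

section
variable {X : Type*} (f : Fin l → X) (x : X) (g : Fin r → X)

@[simp] lemma glueFun_idxL (a : Fin l) : glueFun f x g (idxL r a) = f a := by
  simp [glueFun, idxL]

@[simp] lemma glueFun_idxC : glueFun f x g (idxC l r) = x := by
  simp [glueFun, idxC]

@[simp] lemma glueFun_idxR (b : Fin r) : glueFun f x g (idxR l b) = g b := by
  simp [glueFun, idxR]

end

lemma forall_glue {P : Fin (l + (r + 1)) → Prop} :
    (∀ t, P t) ↔ (∀ a, P (idxL r a)) ∧ P (idxC l r) ∧ ∀ b, P (idxR l b) := by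
  constructor
  · intro h
    exact ⟨fun a => h _, h _, fun b => h _⟩
  · rintro ⟨h1, h2, h3⟩ t
    refine Fin.addCases (fun a => h1 a) (fun b => ?_) t
    refine Fin.cases h2 (fun b => h3 b) b

lemma sum_glue {M : Type*} [AddCommMonoid M] (f : Fin (l + (r + 1)) → M) :
    ∑ t, f t = (∑ a, f (idxL r a)) + (f (idxC l r) + ∑ b, f (idxR l b)) := by
  rw [Fin.sum_univ_add, Fin.sum_univ_succ]
  rfl

lemma card_glue (P : Fin (l + (r + 1)) → Prop) [DecidablePred P] :
    (Finset.univ.filter P).card = (Finset.univ.filter fun a => P (idxL r a)).card +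
      ((if P (idxC l r) then 1 else 0) + (Finset.univ.filter fun b => P (idxR l b)).card) := by
  simp only [Finset.card_filter]
  exact sum_glue _

/-- The diagram obtained from a left diagram, a chord `(i, i+1, i+m, i+m+1)` and a right
diagram placed below it. -/
def glue (hi : 1 ≤ i) (hm : 2 ≤ m) (L : ChordDiagram (i + 2) l) (R : ChordDiagram (m + 2) r) :
    ChordDiagram (i + m + 2) (l + (r + 1)) where
  tail := glueFun L.tail i (fun b => R.tail b + i)
  head := glueFun L.head (i + m) (fun b => R.head b + i)
  one_le_tail := by
    rw [forall_glue]
    simp only [glueFun_idxL, glueFun_idxC, glueFun_idxR]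
    exact ⟨L.one_le_tail, hi, fun b => by omega⟩
  tail_add_two_le_head := by
    rw [forall_glue]
    simp only [glueFun_idxL, glueFun_idxC, glueFun_idxR]
    exact ⟨L.tail_add_two_le_head, by omega, fun b => by
      have := R.tail_add_two_le_head b; omega⟩
  head_add_two_le := by
    rw [forall_glue]
    simp only [glueFun_idxL, glueFun_idxC, glueFun_idxR]
    exact ⟨fun a => by have := L.head_add_two_le a; omega, by omega, fun b => by
      have := R.head_add_two_le b; omega⟩
  tail_strictMono := by
    have hL : ∀ a, L.tail a + 2 ≤ i := fun a => by
      have := L.tail_add_two_le_head a; have := L.head_add_two_le a; omega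
    have hR := R.one_le_tail
    refine forall_glue.2 ⟨fun a => ?_, ?_, fun b => ?_⟩ <;>
      refine forall_glue.2 ⟨fun a' => ?_, ?_, fun b' => ?_⟩ <;>
      simp only [glueFun_idxL, glueFun_idxC, glueFun_idxR, Fin.lt_def, idxL_val, idxC_val,
        idxR_val] <;> intro h
    · exact L.tail_strictMono h
    · have := hL a; omega
    · have := hL a; omega
    · omega
    · omega
    · have := hR b'; omega
    · omega
    · omega
    · have := R.tail_strictMono (a := b) (b := b') (Fin.lt_def.2 (by omega))
      omega
  noncrossing := by
    have hL : ∀ a, L.head a ≤ i := fun a => by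
      have := L.head_add_two_le a; omega
    have hR := R.one_le_tail
    have hR' : ∀ b, R.head b ≤ m := fun a => by
      have := R.head_add_two_le a; omega
    have h2 : ∀ a, 1 ≤ L.head a := fun a => by
      have := L.tail_add_two_le_head a; omega
    refine forall_glue.2 ⟨fun a => ?_, ?_, fun b => ?_⟩ <;>
      refine forall_glue.2 ⟨fun a' => ?_, ?_, fun b' => ?_⟩ <;>
      simp only [glueFun_idxL, glueFun_idxC, glueFun_idxR, Fin.lt_def, idxL_val, idxC_val,
        idxR_val] <;> intro h
    · exact L.noncrossing _ _ h
    · have := hL a; omega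
    · have := hL a; omega
    · have := hL a'; omega
    · omega
    · have := hR' b'; omega
    · have := hL a'; omega
    · omega
    · have := R.noncrossing b b' (Fin.lt_def.2 (by omega))
      omega

variable (hi : 1 ≤ i) (hm : 2 ≤ m) (L : ChordDiagram (i + 2) l) (R : ChordDiagram (m + 2) r)

@[simp] lemma glue_tail_L (a : Fin l) : (glue hi hm L R).tail (idxL r a) = L.tail a :=
  glueFun_idxL ..
@[simp] lemma glue_tail_C : (glue hi hm L R).tail (idxC l r) = i := glueFun_idxC ..
@[simp] lemma glue_tail_R (b : Fin r) : (glue hi hm L R).tail (idxR l b) = R.tail b + i :=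
  glueFun_idxR ..
@[simp] lemma glue_head_L (a : Fin l) : (glue hi hm L R).head (idxL r a) = L.head a :=
  glueFun_idxL ..
@[simp] lemma glue_head_C : (glue hi hm L R).head (idxC l r) = i + m := glueFun_idxC ..
@[simp] lemma glue_head_R (b : Fin r) : (glue hi hm L R).head (idxR l b) = R.head b + i :=
  glueFun_idxR ..

lemma head_le (D : ChordDiagram (i + 2) l) (a : Fin l) : D.head a ≤ i := by
  have := D.head_add_two_le a; omega

lemma tail_add_two_le (D : ChordDiagram (i + 2) l) (a : Fin l) : D.tail a + 2 ≤ i := by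
  have := D.head_add_two_le a; have := D.tail_add_two_le_head a; omega

@[simp] lemma glue_desc_LL (a a' : Fin l) :
    (glue hi hm L R).Descendant (idxL r a) (idxL r a') ↔ L.Descendant a a' := by
  simp [Descendant]
@[simp] lemma glue_desc_LC (a : Fin l) :
    ¬ (glue hi hm L R).Descendant (idxL r a) (idxC l r) := by
  have := L.head_le a
  simp [Descendant]; omega
@[simp] lemma glue_desc_LR (a : Fin l) (b : Fin r) :
    ¬ (glue hi hm L R).Descendant (idxL r a) (idxR l b) := by
  have := L.head_le a
  have := R.tail_add_two_le_head b
  simp [Descendant]; omega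
@[simp] lemma glue_desc_CL (a : Fin l) :
    ¬ (glue hi hm L R).Descendant (idxC l r) (idxL r a) := by
  have := L.tail_add_two_le a
  simp [Descendant]; omega
@[simp] lemma glue_desc_CC :
    ¬ (glue hi hm L R).Descendant (idxC l r) (idxC l r) := by
  simp [Descendant]
@[simp] lemma glue_desc_CR (b : Fin r) :
    (glue hi hm L R).Descendant (idxC l r) (idxR l b) := by
  have := R.one_le_tail b
  have := R.head_le b
  simp [Descendant]; omega
@[simp] lemma glue_desc_RL (a : Fin l) (b : Fin r) :
    ¬ (glue hi hm L R).Descendant (idxR l b) (idxL r a) := by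
  have := L.tail_add_two_le a
  simp [Descendant]; omega
@[simp] lemma glue_desc_RC (b : Fin r) :
    ¬ (glue hi hm L R).Descendant (idxR l b) (idxC l r) := by
  simp [Descendant]
@[simp] lemma glue_desc_RR (b b' : Fin r) :
    (glue hi hm L R).Descendant (idxR l b) (idxR l b') ↔ R.Descendant b b' := by
  simp [Descendant]

@[simp] lemma glue_top_L (a : Fin l) : (glue hi hm L R).IsTop (idxL r a) ↔ L.IsTop a := by
  simp [IsTop, forall_glue]
@[simp] lemma glue_top_C : (glue hi hm L R).IsTop (idxC l r) := by
  simp [IsTop, forall_glue]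
@[simp] lemma glue_top_R (b : Fin r) : ¬ (glue hi hm L R).IsTop (idxR l b) := by
  simp [IsTop, forall_glue]

@[simp] lemma glue_parent_LL (a a' : Fin l) :
    (glue hi hm L R).IsParent (idxL r a) (idxL r a') ↔ L.IsParent a a' := by
  simp [IsParent, forall_glue]
@[simp] lemma glue_parent_XC (t : Fin (l + (r + 1))) :
    ¬ (glue hi hm L R).IsParent t (idxC l r) := fun h =>
  glue_top_C hi hm L R t h.1
@[simp] lemma glue_parent_LR (a : Fin l) (b : Fin r) :
    ¬ (glue hi hm L R).IsParent (idxL r a) (idxR l b) := by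
  simp [IsParent]
@[simp] lemma glue_parent_CL (a : Fin l) :
    ¬ (glue hi hm L R).IsParent (idxC l r) (idxL r a) := by
  simp [IsParent]
@[simp] lemma glue_parent_CR (b : Fin r) :
    (glue hi hm L R).IsParent (idxC l r) (idxR l b) ↔ R.IsTop b := by
  simp only [IsParent, forall_glue, glue_desc_CR, glue_desc_RR, glue_tail_C, glue_tail_R, IsTop]
  simp
  refine forall_congr' fun b' => ?_
  have := R.one_le_tail b'
  constructor
  · intro h h'; have := h h'; omega
  · intro h h'; exact absurd h' h
@[simp] lemma glue_parent_RL (a : Fin l) (b : Fin r) :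
    ¬ (glue hi hm L R).IsParent (idxR l b) (idxL r a) := by
  simp [IsParent]
@[simp] lemma glue_parent_RR (b b' : Fin r) :
    (glue hi hm L R).IsParent (idxR l b) (idxR l b') ↔ R.IsParent b b' := by
  simp [IsParent, forall_glue]

@[simp] lemma glue_below_L (a : Fin l) : (glue hi hm L R).below (idxL r a) = L.below a := by
  simp [below, card_glue]
@[simp] lemma glue_below_C : (glue hi hm L R).below (idxC l r) = r := by
  simp [below, card_glue]
@[simp] lemma glue_below_R (b : Fin r) : (glue hi hm L R).below (idxR l b) = R.below b := by
  simp [below, card_glue]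

@[simp] lemma glue_behind_L (a : Fin l) :
    (glue hi hm L R).behind (idxL r a) = L.behind a + (1 + r) := by
  have h := L.tail_add_two_le a
  have h2 : ∀ b, L.tail a < R.tail b + i := fun b => by omega
  have h3 : L.tail a < i := by omega
  simp [behind, card_glue, h2, h3]
@[simp] lemma glue_behind_C : (glue hi hm L R).behind (idxC l r) = r := by
  have h : ∀ a, ¬ i < L.tail a := fun a => by have := L.tail_add_two_le a; omega
  have h2 : ∀ b, 0 < R.tail b := fun b => R.one_le_tail b
  simp [behind, card_glue, h, h2]
@[simp] lemma glue_beyond_LL (a a' : Fin l) :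
    (glue hi hm L R).beyond (idxL r a) (idxL r a') = L.beyond a a' := by
  simp [beyond, card_glue]
@[simp] lemma glue_beyond_RR (b b' : Fin r) :
    (glue hi hm L R).beyond (idxR l b) (idxR l b') = R.beyond b b' := by
  simp [beyond, card_glue]
lemma glue_beyond_RC (b : Fin r) :
    (glue hi hm L R).beyond (idxR l b) (idxC l r) + R.behind b + 1 = r := by
  have h1 : (glue hi hm L R).beyond (idxR l b) (idxC l r) =
      (Finset.univ.filter fun b' : Fin r => b' < b).card := by
    simp [beyond, card_glue, R.tail_strictMono.lt_iff_lt]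
  have h2 : R.behind b = (Finset.univ.filter fun b' : Fin r => b < b').card := by
    simp [behind, R.tail_strictMono.lt_iff_lt]
  rw [h1, h2]
  have h3 : (Finset.univ.filter fun b' : Fin r => b' < b).card = b := by
    rw [← Fin.card_Iio]; congr 1; ext; simp
  have h4 : (Finset.univ.filter fun b' : Fin r => b < b').card = r - 1 - b := by
    rw [← Fin.card_Ioi]; congr 1; ext; simp
  omega

end Glue

end ChordDiagram

/-- The variables of a domino matrix with `k` rows. -/
structure DominoVars (k : ℕ) where
  α : Fin k → ℝ
  β : Fin k → ℝ
  γ : Fin k → ℝ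
  δ : Fin k → ℝ
  ε : Fin k → ℝ

namespace ChordDiagram

section Row

variable {n k : ℕ} {M : Type*} [AddCommGroup M] [Module ℝ M]

/-- The combination of the vectors `z 1, …, z n` whose coefficients are the entries of a row of
the domino matrix. -/
def row (D : ChordDiagram n k) (v : DominoVars k) (z : ℕ → M) (c : Fin k) : M :=
  v.α c • z (D.tail c) + v.β c • z (D.tail c + 1) + v.γ c • z (D.head c) +
    v.δ c • z (D.head c + 1) + (if D.IsTop c then v.ε c • z n else 0) +
    ∑ p, if D.IsParent p c then
      v.ε c • (v.α p • z (D.tail p) + v.β p • z (D.tail p + 1)) else 0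

lemma map_row {N : Type*} [AddCommGroup N] [Module ℝ N] (f : M →ₗ[ℝ] N) (D : ChordDiagram n k)
    (v : DominoVars k) (z : ℕ → M) (c : Fin k) :
    f (D.row v z c) = D.row v (fun p => f (z p)) c := by
  simp only [row, map_add, map_smul, map_sum]
  congr 1
  · congr 1
    split_ifs <;> simp
  · refine Finset.sum_congr rfl fun p _ => ?_
    split_ifs <;> simp

lemma row_congr (D : ChordDiagram n k) (v : DominoVars k) {z z' : ℕ → M}
    (h : ∀ p, 1 ≤ p → p ≤ n → z p = z' p) (c : Fin k) : D.row v z c = D.row v z' c := by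
  have h1 : ∀ p, z (D.tail p) = z' (D.tail p) := fun p => by
    have := D.one_le_tail p; have := D.tail_add_two_le_head p; have := D.head_add_two_le p
    exact h _ (by omega) (by omega)
  have h2 : ∀ p, z (D.tail p + 1) = z' (D.tail p + 1) := fun p => by
    have := D.one_le_tail p; have := D.tail_add_two_le_head p; have := D.head_add_two_le p
    exact h _ (by omega) (by omega)
  have h3 : z (D.head c) = z' (D.head c) := by
    have := D.one_le_tail c; have := D.tail_add_two_le_head c; have := D.head_add_two_le c
    exact h _ (by omega) (by omega)
  have h4 : z (D.head c + 1) = z' (D.head c + 1) := by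
    have := D.one_le_tail c; have := D.tail_add_two_le_head c; have := D.head_add_two_le c
    exact h _ (by omega) (by omega)
  have h5 : z n = z' n := by
    have := D.one_le_tail c; have := D.tail_add_two_le_head c; have := D.head_add_two_le c
    exact h _ (by omega) (by omega)
  simp only [row, h1, h2, h3, h4, h5]

/-- Add a marker before the last one. -/
def addMarker (D : ChordDiagram n k) : ChordDiagram (n + 1) k where
  tail := D.tail
  head := D.head
  one_le_tail := D.one_le_tail
  tail_add_two_le_head := D.tail_add_two_le_head
  head_add_two_le l := (D.head_add_two_le l).trans (Nat.le_succ n)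
  tail_strictMono := D.tail_strictMono
  noncrossing := D.noncrossing

lemma addMarker_row (D : ChordDiagram n k) (v : DominoVars k) (z : ℕ → M) (c : Fin k) :
    D.addMarker.row v z c = D.row v (fun p => if p < n then z p else z (n + 1)) c := by
  have h1 : ∀ p, D.tail p + 1 < n := fun p => by
    have := D.tail_add_two_le_head p; have := D.head_add_two_le p; omega
  have h2 : ∀ p, D.tail p < n := fun p => by have := h1 p; omega
  have h3 : ∀ p, D.head p + 1 < n := fun p => by have := D.head_add_two_le p; omega
  have h4 : ∀ p, D.head p < n := fun p => by have := h3 p; omega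
  simp only [row, h1, h2, h3, h4, if_true, lt_irrefl, if_false]
  rfl

lemma addMarker_signRules (D : ChordDiagram n k) (v : DominoVars k)
    (h : D.SignRules v.α v.β v.γ v.δ v.ε) : D.addMarker.SignRules v.α v.β v.γ v.δ v.ε := h

end Row

section Glue

variable {i m l r : ℕ} {M : Type*} [AddCommGroup M] [Module ℝ M]

/-- The variables of a glued diagram; the separating chord has variables
`a, b, s g, s d, s e` with `s = (-1) ^ r`. -/
def glueVars (L : ChordDiagram (i + 2) l) (R : ChordDiagram (m + 2) r) (vL : DominoVars l)
    (vR : DominoVars r) (a b g d e : ℝ) : DominoVars (l + (r + 1)) where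
  α := glueFun vL.α a vR.α
  β := glueFun vL.β b vR.β
  γ := glueFun (fun x => if L.head x = i then vL.γ x + vL.δ x * a else vL.γ x) ((-1) ^ r * g)
    (fun y => if R.head y = m then vR.γ y + vR.δ y * g else vR.γ y)
  δ := glueFun (fun x => if L.head x = i then vL.δ x * b else vL.δ x) ((-1) ^ r * d)
    (fun y => if R.head y = m then vR.δ y * d else vR.δ y)
  ε := glueFun (fun x => if L.IsTop x then -(-1) ^ r * vL.ε x else vL.ε x) ((-1) ^ r * e)
    (fun y => if R.IsTop y then -(-1) ^ r * vR.ε y else vR.ε y)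

/-- The configuration of the left part of a glued diagram. -/
def leftPart (i m r : ℕ) (a b : ℝ) (z : ℕ → M) (p : ℕ) : M :=
  if p ≤ i then z p else if p = i + 1 then a • z i + b • z (i + 1)
  else (-(-1) ^ r : ℝ) • z (i + m + 2)

/-- The configuration of the right part of a glued diagram. -/
def rightPart (i m r : ℕ) (a b g d : ℝ) (z : ℕ → M) (p : ℕ) : M :=
  if p ≤ m then z (p + i) else if p = m + 1 then g • z (i + m) + d • z (i + m + 1)
  else (-(-1) ^ r : ℝ) • (a • z i + b • z (i + 1))

variable (hi : 1 ≤ i) (hm : 2 ≤ m) (L : ChordDiagram (i + 2) l) (R : ChordDiagram (m + 2) r)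
  (vL : DominoVars l) (vR : DominoVars r) (a b g d e : ℝ)

lemma glue_row_C (z : ℕ → M) :
    (glue hi hm L R).row (glueVars L R vL vR a b g d e) z (idxC l r) =
      (a • z i + b • z (i + 1)) + ((-1) ^ r : ℝ) • (g • z (i + m) + d • z (i + m + 1)) +
        ((-1) ^ r * e : ℝ) • z (i + m + 2) := by
  simp [row, glueVars, smul_smul]
  abel

lemma glue_row_L (z : ℕ → M) (c : Fin l) :
    (glue hi hm L R).row (glueVars L R vL vR a b g d e) z (idxL r c) =
      L.row vL (leftPart i m r a b z) c := by
  have h1 : ∀ p, L.tail p + 1 ≤ i := fun p => by have := L.tail_add_two_le p; omega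
  have h2 : ∀ p, L.tail p ≤ i := fun p => by have := L.tail_add_two_le p; omega
  have h3 := L.head_le c
  have h4 : vL.γ c • leftPart i m r a b z (L.head c) +
      vL.δ c • leftPart i m r a b z (L.head c + 1) =
      (glueVars L R vL vR a b g d e).γ (idxL r c) • z (L.head c) +
      (glueVars L R vL vR a b g d e).δ (idxL r c) • z (L.head c + 1) := by
    by_cases h : L.head c = i
    · simp [glueVars, leftPart, h, smul_smul, add_smul]
      abel
    · have h5 : L.head c + 1 ≤ i := by omega
      simp [glueVars, leftPart, h, h3, h5]
  simp only [row, sum_glue, glue_parent_LL, glue_parent_CL, glue_parent_RL, if_false,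
    Finset.sum_const_zero, add_zero, glue_tail_L, glue_head_L, glue_top_L]
  rw [add_assoc (_ + _) (_ • z (L.head c)), ← h4]
  simp only [leftPart, h1, h2, if_true]
  by_cases ht : L.IsTop c
  · have hp : ∀ p, ¬ L.IsParent p c := fun p hp => ht p hp.1
    simp [glueVars, ht, hp, smul_smul]
    module
  · simp [glueVars, ht]
    abel

lemma glue_row_R (z : ℕ → M) (c : Fin r) :
    (glue hi hm L R).row (glueVars L R vL vR a b g d e) z (idxR l c) =
      R.row vR (rightPart i m r a b g d z) c := by
  have h1 : ∀ p, R.tail p + 1 ≤ m := fun p => by have := R.tail_add_two_le p; omega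
  have h2 : ∀ p, R.tail p ≤ m := fun p => by have := R.tail_add_two_le p; omega
  have h3 := R.head_le c
  have h4 : vR.γ c • rightPart i m r a b g d z (R.head c) +
      vR.δ c • rightPart i m r a b g d z (R.head c + 1) =
      (glueVars L R vL vR a b g d e).γ (idxR l c) • z (R.head c + i) +
      (glueVars L R vL vR a b g d e).δ (idxR l c) • z (R.head c + i + 1) := by
    by_cases h : R.head c = m
    · simp [glueVars, rightPart, h, smul_smul, add_smul, add_comm i m]
      abel
    · have h5 : R.head c + 1 ≤ m := by omega
      simp [glueVars, rightPart, h, h3, h5, add_right_comm]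
  simp only [row, sum_glue, glue_parent_LR, glue_parent_CR, glue_parent_RR, if_false,
    Finset.sum_const_zero, zero_add, glue_tail_R, glue_tail_C, glue_head_R, glue_top_R]
  rw [add_assoc (_ + _) (_ • z (R.head c + i)), ← h4]
  simp only [rightPart, h1, h2, if_true]
  by_cases ht : R.IsTop c
  · have hp : ∀ p, ¬ R.IsParent p c := fun p hp => ht p hp.1
    simp [glueVars, ht, hp, smul_smul, add_right_comm]
    module
  · simp [glueVars, ht, add_right_comm]
    abel

lemma div_lt_div_transform {γ δ γ' δ' a b σ : ℝ} (ha : 0 < a) (hb : 0 < b) (h1 : 0 < σ * γ)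
    (h2 : 0 < σ * δ) {σ' : ℝ} (h1' : 0 < σ' * γ') (h2' : 0 < σ' * δ') (h : δ / γ < δ' / γ') :
    δ * b / (γ + δ * a) < δ' * b / (γ' + δ' * a) := by
  have e1 : δ * b / (γ + δ * a) = (σ * δ) * b / (σ * γ + σ * δ * a) := by
    have hσ : σ ≠ 0 := by rintro rfl; simp at h1
    rw [← mul_div_mul_left _ _ hσ]; ring_nf
  have e2 : δ' * b / (γ' + δ' * a) = (σ' * δ') * b / (σ' * γ' + σ' * δ' * a) := by
    have hσ : σ' ≠ 0 := by rintro rfl; simp at h1'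
    rw [← mul_div_mul_left _ _ hσ]; ring_nf
  have e3 : δ / γ = (σ * δ) / (σ * γ) := by
    have hσ : σ ≠ 0 := by rintro rfl; simp at h1
    rw [← mul_div_mul_left _ _ hσ]
  have e4 : δ' / γ' = (σ' * δ') / (σ' * γ') := by
    have hσ : σ' ≠ 0 := by rintro rfl; simp at h1'
    rw [← mul_div_mul_left _ _ hσ]
  rw [e3, e4, div_lt_div_iff₀ h1 h1'] at h
  rw [e1, e2, div_lt_div_iff₀ (by positivity) (by positivity)]
  nlinarith [mul_lt_mul_of_pos_left h hb]

lemma div_transform_lt {γ δ a b σ : ℝ} (ha : 0 < a) (hb : 0 < b) (h1 : 0 < σ * γ)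
    (h2 : 0 < σ * δ) : δ * b / (γ + δ * a) < b / a := by
  have e1 : δ * b / (γ + δ * a) = (σ * δ) * b / (σ * γ + σ * δ * a) := by
    have hσ : σ ≠ 0 := by rintro rfl; simp at h1
    rw [← mul_div_mul_left _ _ hσ]; ring_nf
  rw [e1, div_lt_div_iff₀ (by positivity) ha]
  nlinarith [mul_pos h1 hb]

lemma glue_signRules (ha : 0 < a) (hb : 0 < b) (hg : 0 < g) (hd : 0 < d) (he : 0 < e)
    (hL : L.SignRules vL.α vL.β vL.γ vL.δ vL.ε) (hR : R.SignRules vR.α vR.β vR.γ vR.δ vR.ε) :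
    (glue hi hm L R).SignRules (glueVars L R vL vR a b g d e).α (glueVars L R vL vR a b g d e).β
      (glueVars L R vL vR a b g d e).γ (glueVars L R vL vR a b g d e).δ
      (glueVars L R vL vR a b g d e).ε := by
  obtain ⟨L1, L2, L3, L4, L5, L6, L7, L8⟩ := hL
  obtain ⟨R1, R2, R3, R4, R5, R6, R7, R8⟩ := hR
  have hs : ((-1 : ℝ) ^ r) * (-1) ^ r = 1 := by rw [← mul_pow]; simp
  refine ⟨?_, ?_, ?_, ?_, ?_, ?_, ?_, ?_⟩
  · simp [forall_glue, glueVars, *]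
  · simp [forall_glue, glueVars, *]
  · simp only [forall_glue, glueVars, glueFun_idxL, glueFun_idxC, glueFun_idxR, glue_below_L,
      glue_below_C, glue_below_R]
    refine ⟨fun x => ?_, by rw [← mul_assoc, hs]; linarith, fun x => ?_⟩
    · have h1 := L3 x
      have h2 := mul_pos (L4 x) ha
      split_ifs <;> nlinarith
    · have h1 := R3 x
      have h2 := mul_pos (R4 x) hg
      split_ifs <;> nlinarith
  · simp only [forall_glue, glueVars, glueFun_idxL, glueFun_idxC, glueFun_idxR, glue_below_L,
      glue_below_C, glue_below_R]
    refine ⟨fun x => ?_, by rw [← mul_assoc, hs]; linarith, fun x => ?_⟩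
    · have h1 := L4 x
      have h2 := mul_pos (L4 x) hb
      split_ifs <;> nlinarith
    · have h1 := R4 x
      have h2 := mul_pos (R4 x) hd
      split_ifs <;> nlinarith
  · simp only [forall_glue, glueVars, glueFun_idxL, glueFun_idxC, glueFun_idxR, glue_top_L,
      glue_top_C, glue_top_R, glue_behind_L, glue_behind_C, false_imp_iff, implies_true, and_true,
      true_imp_iff]
    refine ⟨fun x hx => ?_, by rw [← mul_assoc, hs]; linarith⟩
    have h1 := L5 x hx
    rw [if_pos hx, pow_add, pow_add]
    calc 0 < (-1) ^ L.behind x * vL.ε x * ((-1 : ℝ) ^ r * (-1) ^ r) := by rw [hs]; linarith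
      _ = _ := by ring
  · simp only [forall_glue, glueVars, glueFun_idxL, glueFun_idxC, glueFun_idxR, glue_parent_LL,
      glue_parent_XC, glue_parent_CL, glue_parent_CR, glue_parent_LR, glue_parent_RL,
      glue_parent_RR, glue_beyond_LL, glue_beyond_RR,
      false_imp_iff, implies_true, and_true, true_and]
    refine ⟨fun x y hy => ?_, fun x => ⟨fun hx => ?_, fun y hy => ?_⟩⟩
    · have hx : ¬ L.IsTop x := fun h => h y hy.1
      rw [if_neg hx]; exact L6 x y hy
    · have h1 := R5 x hx
      rw [if_pos hx]
      have h2 := glue_beyond_RC hi hm L R x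
      set q := (glue hi hm L R).beyond (idxR l x) (idxC l r)
      have h3 : (-1 : ℝ) ^ q * (-1) ^ q = 1 := by rw [← mul_pow]; simp
      calc 0 < (-1) ^ R.behind x * vR.ε x * ((-1 : ℝ) ^ q * (-1) ^ q) := by rw [h3]; linarith
        _ = _ := by
          have h4 : (-1 : ℝ) ^ r = (-1) ^ (q + R.behind x + 1) := by rw [h2]
          rw [h4]; ring
    · have hx : ¬ R.IsTop x := fun h => h y hy.1
      rw [if_neg hx]; exact R6 x y hy
  · simp only [forall_glue, glueVars, glueFun_idxL, glueFun_idxC, glueFun_idxR, glue_parent_LL,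
      glue_parent_XC, glue_parent_CL, glue_parent_CR, glue_parent_LR, glue_parent_RL,
      glue_parent_RR, glue_head_L, glue_head_C, glue_head_R,
      false_imp_iff, implies_true, and_true, true_and]
    refine ⟨fun x y hy hh => ?_, fun x => ⟨fun hx hh => ?_, fun y hy hh => ?_⟩⟩
    · rw [← hh]
      by_cases h : L.head x = i
      · simp only [h, if_true]
        exact div_lt_div_transform ha hb (L3 x) (L4 x) (L3 y) (L4 y) (L7 x y hy hh)
      · simp only [h, if_false]
        exact L7 x y hy hh
    · have h : R.head x = m := by omega
      simp only [h, if_true]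
      rw [mul_div_mul_left _ _ (by positivity)]
      exact div_transform_lt hg hd (R3 x) (R4 x)
    · have hh' : R.head x = R.head y := by omega
      rw [← hh']
      by_cases h : R.head x = m
      · simp only [h, if_true]
        exact div_lt_div_transform hg hd (R3 x) (R4 x) (R3 y) (R4 y) (R7 x y hy hh')
      · simp only [h, if_false]
        exact R7 x y hy hh'
  · simp only [forall_glue, glueVars, glueFun_idxL, glueFun_idxC, glueFun_idxR,
      glue_head_L, glue_head_C, glue_head_R, glue_tail_L, glue_tail_C, glue_tail_R]
    refine ⟨fun x => ⟨fun y hh => ?_, fun hh => ?_, fun y hh => ?_⟩,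
      ⟨fun y hh => ?_, fun hh => ?_, fun y hh => ?_⟩,
      fun x => ⟨fun y hh => ?_, fun hh => ?_, fun y hh => ?_⟩⟩
    · have := L.tail_add_two_le x
      have h : L.head y ≠ i := by omega
      simp only [h, if_false]
      exact L8 x y hh
    · have := L.tail_add_two_le x; omega
    · have := L.tail_add_two_le x; omega
    · simp only [hh, if_true]
      exact div_transform_lt ha hb (L3 y) (L4 y)
    · omega
    · have := R.tail_add_two_le_head y; omega
    · have := L.head_le y; have := R.one_le_tail x; omega
    · have := R.tail_add_two_le x; omega
    · have := R.tail_add_two_le x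
      have h : R.head y ≠ m := by omega
      simp only [h, if_false]
      exact R8 x y (by omega)

end Glue

end ChordDiagram

section SignPaths

/-- The cost of passing from one sign to another. -/
def chi (s t : Bool) : ℕ := if s = t then 0 else 1

/-- The sign `s` (`true` for plus, `false` for minus) is compatible with `x`. -/
def Fill (s : Bool) (x : ℝ) : Prop := (s = true → 0 ≤ x) ∧ (s = false → x ≤ 0)

lemma chi_self (s : Bool) : chi s s = 0 := by simp [chi]

lemma chi_triangle (s t u : Bool) : chi s u ≤ chi s t + chi t u := by
  cases s <;> cases t <;> cases u <;> simp [chi]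

lemma fill_zero (s : Bool) : Fill s 0 := by simp [Fill]

lemma fill_mul {s : Bool} {x c : ℝ} (hc : 0 ≤ c) (h : Fill s x) : Fill s (x * c) :=
  ⟨fun hs => mul_nonneg (h.1 hs) hc, fun hs => mul_nonpos_of_nonpos_of_nonneg (h.2 hs) hc⟩

lemma fill_not {s : Bool} {x : ℝ} : Fill (!s) (-x) ↔ Fill s x := by
  cases s <;> simp [Fill]

lemma fill_twist {s : Bool} {x : ℝ} (r : ℕ) (h : Fill s x) :
    Fill (xor r.bodd s) ((-1) ^ r * x) := by
  induction r with
  | zero => simpa using h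
  | succ r ih =>
    have : (-1 : ℝ) ^ (r + 1) * x = -((-1) ^ r * x) := by ring
    rw [this, Nat.bodd_succ, Bool.not_xor, fill_not]
    exact ih

lemma chi_twist (b s t : Bool) : chi (xor b s) (xor b t) = chi s t := by
  cases b <;> cases s <;> cases t <;> simp [chi]

/-- The entries `x a, …, x (a + L - 1)` can be given compatible signs such that the path through
these signs starting from `s` and ending in `t` has cost at most `m`. -/
def SignPath (x : ℕ → ℝ) (a : ℕ) : ℕ → Bool → Bool → ℕ → Prop
  | 0, s, t, m => chi s t ≤ m
  | L + 1, s, t, m => ∃ u, Fill u (x (a + L)) ∧ ∃ m', m' + chi u t ≤ m ∧ SignPath x a L s u m'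

variable {x y : ℕ → ℝ} {a L : ℕ} {s t : Bool} {m : ℕ}

lemma SignPath.mono {m' : ℕ} (h : SignPath x a L s t m) (hm : m ≤ m') : SignPath x a L s t m' := by
  cases L with
  | zero => exact le_trans h hm
  | succ L =>
    obtain ⟨u, hu, m1, h1, h2⟩ := h
    exact ⟨u, hu, m1, h1.trans hm, h2⟩

lemma SignPath.start (s' : Bool) (h : SignPath x a L s t m) :
    SignPath x a L s' t (m + chi s' s) := by
  induction L generalizing t m with
  | zero =>
    have h : chi s t ≤ m := h
    have := chi_triangle s' s t
    show chi s' t ≤ _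
    omega
  | succ L ih =>
    obtain ⟨u, hu, m1, h1, h2⟩ := h
    exact ⟨u, hu, m1 + chi s' s, by omega, ih h2⟩

lemma SignPath.finish (t' : Bool) (h : SignPath x a L s t m) :
    SignPath x a L s t' (m + chi t t') := by
  cases L with
  | zero =>
    have h : chi s t ≤ m := h
    have := chi_triangle s t t'
    show chi s t' ≤ _
    omega
  | succ L =>
    obtain ⟨u, hu, m1, h1, h2⟩ := h
    have := chi_triangle u t t'
    exact ⟨u, hu, m1, by omega, h2⟩

lemma SignPath.congr {b : ℕ} (h : SignPath x a L s t m) (hxy : ∀ j < L, x (a + j) = y (b + j)) :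
    SignPath y b L s t m := by
  induction L generalizing t m with
  | zero => exact h
  | succ L ih =>
    obtain ⟨u, hu, m1, h1, h2⟩ := h
    exact ⟨u, by rw [← hxy L (by omega)]; exact hu, m1, h1, ih h2 fun j hj => hxy j (by omega)⟩

lemma SignPath.append {L' m' : ℕ} {u : Bool} (h : SignPath x a L s u m)
    (h' : SignPath x (a + L) L' u t m') : SignPath x a (L + L') s t (m + m') := by
  induction L' generalizing t m' with
  | zero =>
    have h' : chi u t ≤ m' := h'
    exact (h.finish t).mono (by omega)
  | succ L' ih =>
    obtain ⟨w, hw, m1, h1, h2⟩ := h'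
    exact ⟨w, by
      have e : a + (L + L') = a + L + L' := by omega
      show Fill w (x (a + (L + L')))
      rwa [e], m + m1, by omega, ih h2⟩

lemma SignPath.cons {u : Bool} (hu : Fill u (x a)) (h : SignPath x (a + 1) L u t m) :
    SignPath x a (L + 1) s t (m + chi s u) := by
  have h1 : SignPath x a 1 s u (chi s u) := ⟨u, hu, chi s u, by simp [chi_self], le_refl _⟩
  have := h1.append h
  rw [add_comm 1 L] at this
  exact this.mono (by omega)

lemma SignPath.uncons (h : SignPath x a (L + 1) s t m) :
    ∃ u, Fill u (x a) ∧ ∃ m', m' + chi s u ≤ m ∧ SignPath x (a + 1) L u t m' := by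
  induction L generalizing t m with
  | zero =>
    obtain ⟨u, hu, m1, h1, h2⟩ := h
    have h2 : chi s u ≤ m1 := h2
    exact ⟨u, hu, chi u t, by omega, le_refl _⟩
  | succ L ih =>
    obtain ⟨w, hw, m1, h1, h2⟩ := h
    obtain ⟨u, hu, m2, h3, h4⟩ := ih h2
    refine ⟨u, hu, m2 + chi w t, by omega, w, ?_, m2, le_refl _, h4⟩
    convert hw using 2
    omega

lemma signPath_zero (h : ∀ j < L, x (a + j) = 0) : SignPath x a L s t (chi s t) := by
  induction L generalizing t with
  | zero => exact le_refl _
  | succ L ih =>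
    exact ⟨t, by rw [h L (by omega)]; exact fill_zero t, chi s t, by simp [chi_self],
      ih fun j hj => h j (by omega)⟩

lemma fill_add_or {s p : Bool} {x P c : ℝ} (hc : 0 ≤ c) (hs : Fill s x) (hp : Fill p P) :
    Fill s (x + c * P) ∨ Fill p (x + c * P) := by
  have h1 := fill_mul hc hp
  rw [mul_comm] at h1
  unfold Fill at *
  cases s <;> cases p <;> simp at * <;> first | linarith | skip
  · exact le_total _ _
  · exact le_total _ _

/-- Adding to the last entry a nonnegative multiple of a number following it. -/
lemma SignPath.add_last {p : Bool} {P c : ℝ} (hc : 0 ≤ c) (hp : Fill p P)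
    (h : SignPath x a (L + 1) s p m) (hy : ∀ j < L, y (a + j) = x (a + j))
    (hl : y (a + L) = x (a + L) + c * P) : SignPath y a (L + 1) s p m := by
  obtain ⟨u, hu, m1, h1, h2⟩ := h
  have h2 := h2.congr (y := y) (b := a) fun j hj => (hy j hj).symm
  rcases fill_add_or hc hu hp with h | h
  · exact ⟨u, hl ▸ h, m1, h1, h2⟩
  · exact ⟨p, hl ▸ h, m, by simp [chi_self], (h2.finish p).mono h1⟩

/-- Adding to the first entry a nonnegative multiple of a number preceding it. -/
lemma SignPath.add_first {p : Bool} {P c : ℝ} (hc : 0 ≤ c) (hp : Fill p P)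
    (h : SignPath x a (L + 1) p t m) (hy : ∀ j < L, y (a + 1 + j) = x (a + 1 + j))
    (hl : y a = x a + c * P) : SignPath y a (L + 1) p t m := by
  obtain ⟨u, hu, m1, h1, h2⟩ := h.uncons
  have h2 := h2.congr (y := y) (b := a + 1) fun j hj => (hy j hj).symm
  rcases fill_add_or hc hu hp with h | h
  · exact (SignPath.cons (hl ▸ h) h2).mono h1
  · exact (SignPath.cons (hl ▸ h) (h2.start p)).mono (by
      have e : chi p p = 0 := chi_self p
      omega)

/-- The entries `x 1, …, x n` can be given compatible signs with at most `k - 1` sign changes,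
cyclically with a twist by `(-1) ^ (k - 1)`. -/
def CycLE (x : ℕ → ℝ) (n k : ℕ) : Prop :=
  ∃ u, Fill u (x n) ∧ ∃ m, m + 1 ≤ k ∧ SignPath x 1 (n - 1) (xor (!k.bodd) u) u m

open Filter Topology in
lemma eventually_fill {X c : ℝ} (hc : c ≠ 0) :
    ∀ᶠ t in 𝓝[>] (0 : ℝ), X + t * c ≠ 0 ∧ Fill (decide (0 < X + t * c)) X := by
  have hcont : Tendsto (fun t : ℝ => X + t * c) (𝓝[>] 0) (𝓝 X) := by
    have : Continuous fun t : ℝ => X + t * c := by fun_prop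
    have h := this.tendsto 0
    simp only [zero_mul, add_zero] at h
    exact h.mono_left nhdsWithin_le_nhds
  rcases lt_trichotomy X 0 with h | h | h
  · filter_upwards [hcont.eventually (gt_mem_nhds h)] with t ht
    exact ⟨ht.ne, by simp [Fill, h.le, not_lt.2 ht.le]⟩
  · filter_upwards [self_mem_nhdsWithin] with t ht
    refine ⟨?_, by rw [h]; exact fill_zero _⟩
    rw [h, zero_add]
    exact mul_ne_zero (ne_of_gt ht) hc
  · filter_upwards [hcont.eventually (lt_mem_nhds h)] with t ht
    exact ⟨ht.ne', by simp [Fill, ht, h.le]⟩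

lemma decide_fill {s : Bool} {x c : ℝ} (h : Fill s x) (hc : 0 < c) :
    decide (0 < x + (if s then c else -c)) = s := by
  cases s
  · have := h.2 rfl
    simp; linarith
  · have := h.1 rfl
    simp; linarith

lemma sign_count_of_ne {p q U V l e : ℝ} (he : 0 < e) (hp : p ≠ 0) (hq : q ≠ 0) (hU : U ≠ 0)
    (hV : V ≠ 0) (h1 : p + l - V ≠ 0) (h2 : U + l ≠ 0) (h3 : e * l - q ≠ 0) :
    chi (decide (0 < p)) (decide (0 < p + l - V)) + chi (decide (0 < p + l - V)) (!decide (0 < V)) +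
      chi (decide (0 < U)) (decide (0 < U + l)) +
      chi (decide (0 < U + l)) (decide (0 < e * l - q)) +
      chi (!decide (0 < e * l - q)) (decide (0 < q)) ≤
      chi (decide (0 < p)) (decide (0 < q)) + chi (decide (0 < U)) (decide (0 < V)) + 2 := by
  have hel : 0 ≤ l ∧ 0 ≤ e * l ∨ l ≤ 0 ∧ e * l ≤ 0 := by
    rcases le_total 0 l with hl | hl
    · exact Or.inl ⟨hl, by positivity⟩
    · exact Or.inr ⟨hl, mul_nonpos_of_nonneg_of_nonpos he.le hl⟩
  rcases hel with ⟨hl, hel⟩ | ⟨hl, hel⟩ <;>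
  rcases lt_or_gt_of_ne hp with a1 | a1 <;> rcases lt_or_gt_of_ne hV with a2 | a2 <;>
  rcases lt_or_gt_of_ne h1 with a3 | a3 <;> (try (exfalso; linarith)) <;>
  rcases lt_or_gt_of_ne hU with a4 | a4 <;> rcases lt_or_gt_of_ne h2 with a5 | a5 <;>
  (try (exfalso; linarith)) <;>
  rcases lt_or_gt_of_ne hq with a6 | a6 <;> rcases lt_or_gt_of_ne h3 with a7 | a7 <;>
  (try (exfalso; linarith)) <;>
  simp [a1, a2, a3, a4, a5, a6, a7, not_lt.2 a1.le, not_lt.2 a2.le, not_lt.2 a3.le,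
    not_lt.2 a4.le, not_lt.2 a5.le, not_lt.2 a6.le, not_lt.2 a7.le, chi, -sub_pos, -sub_neg]

lemma sign_ne {s : Bool} {x c : ℝ} (h : Fill s x) (hc : 0 < c) :
    x + (if s then c else -c) ≠ 0 := by
  cases s
  · have := h.2 rfl
    simp; linarith
  · have := h.1 rfl
    simp; linarith

lemma sign_count {p q U V l e : ℝ} {sp sq sU sV : Bool} (he : 0 < e) (hp : Fill sp p)
    (hq : Fill sq q) (hU : Fill sU U) (hV : Fill sV V) :
    ∃ tP tU tL, Fill tP (p + l - V) ∧ Fill tU (U + l) ∧ Fill tL (e * l - q) ∧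
      chi sp tP + chi tP (!sV) + chi sU tU + chi tU tL + chi (!tL) sq ≤
        chi sp sq + chi sU sV + 2 := by
  have c1 : ((if sp then 1 else -1 : ℝ) - (if sV then 2 else -2)) ≠ 0 := by
    cases sp <;> cases sV <;> norm_num
  have c2 : (if sU then 1 else -1 : ℝ) ≠ 0 := by cases sU <;> norm_num
  have c3 : (-(if sq then 1 else -1 : ℝ)) ≠ 0 := by cases sq <;> norm_num
  obtain ⟨t, ⟨⟨⟨h1, h1'⟩, h2, h2'⟩, h3, h3'⟩, ht⟩ :=
    (((eventually_fill (X := p + l - V) c1).and (eventually_fill (X := U + l) c2)).and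
      (eventually_fill (X := e * l - q) c3) |>.and self_mem_nhdsWithin).exists
  have ht : 0 < t := ht
  have e1 : p + l - V + t * ((if sp then 1 else -1 : ℝ) - (if sV then 2 else -2)) =
      (p + if sp then t else -t) + l - (V + if sV then 2 * t else -(2 * t)) := by
    cases sp <;> cases sV <;> simp <;> ring
  have e2 : U + l + t * (if sU then 1 else -1 : ℝ) = (U + if sU then t else -t) + l := by
    cases sU <;> simp <;> ring
  have e3 : e * l - q + t * (-(if sq then 1 else -1 : ℝ)) = e * l - (q + if sq then t else -t) := by
    cases sq <;> simp <;> ring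
  have ht2 : 0 < 2 * t := by positivity
  have key := sign_count_of_ne he (sign_ne hp ht) (sign_ne hq ht) (sign_ne hU ht) (sign_ne hV ht2)
    (e1 ▸ h1) (e2 ▸ h2) (e3 ▸ h3)
  rw [decide_fill hp ht, decide_fill hq ht, decide_fill hU ht, decide_fill hV ht2, ← e1, ← e2,
    ← e3] at key
  exact ⟨_, _, _, h1', h2', h3', key⟩

lemma sign_count_left {U V l e : ℝ} {sU sV : Bool} (he : 0 < e)
    (hU : Fill sU U) (hV : Fill sV V) :
    ∃ tP tU tL, Fill tP (l - V) ∧ Fill tU (U + l) ∧ Fill tL (e * l) ∧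
      chi tL tP + chi tP (!sV) + chi sU tU + chi tU tL ≤ chi sU sV + 1 := by
  rcases lt_trichotomy l 0 with hl | rfl | hl
  · have h3 : Fill false (e * l) := ⟨by simp, fun _ => by nlinarith⟩
    have hU' : ∃ tU, Fill tU (U + l) ∧ (sU = false → tU = false) := by
      cases sU
      · exact ⟨false, ⟨by simp, fun _ => by have := hU.2 rfl; linarith⟩, by simp⟩
      · rcases le_total 0 (U + l) with h | h
        · exact ⟨true, by simp [Fill, h], by simp⟩
        · exact ⟨false, by simp [Fill, h], by simp⟩
    have hV' : ∃ tP, Fill tP (l - V) ∧ (sV = true → tP = false) := by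
      cases sV
      · rcases le_total 0 (l - V) with h | h
        · exact ⟨true, by simp only [Fill, h]; simp, by simp⟩
        · exact ⟨false, by simp only [Fill, h]; simp, by simp⟩
      · exact ⟨false, ⟨by simp, fun _ => by have := hV.1 rfl; linarith⟩, by simp⟩
    obtain ⟨tU, h1, h1'⟩ := hU'
    obtain ⟨tP, h2, h2'⟩ := hV'
    refine ⟨tP, tU, false, h2, h1, h3, ?_⟩
    cases tU <;> cases tP <;> cases sU <;> cases sV <;> simp_all [chi]
  · refine ⟨!sV, sU, !sV, ?_, by simpa using hU, by simpa using fill_zero _, ?_⟩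
    · rw [zero_sub, fill_not]; exact hV
    · cases sU <;> cases sV <;> simp [chi]
  · have h3 : Fill true (e * l) := ⟨fun _ => by positivity, by simp⟩
    have hU' : ∃ tU, Fill tU (U + l) ∧ (sU = true → tU = true) := by
      cases sU
      · rcases le_total 0 (U + l) with h | h
        · exact ⟨true, by simp [Fill, h], by simp⟩
        · exact ⟨false, by simp [Fill, h], by simp⟩
      · exact ⟨true, ⟨fun _ => by have := hU.1 rfl; linarith, by simp⟩, by simp⟩
    have hV' : ∃ tP, Fill tP (l - V) ∧ (sV = false → tP = true) := by
      cases sV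
      · exact ⟨true, ⟨fun _ => by have := hV.2 rfl; linarith, by simp⟩, by simp⟩
      · rcases le_total 0 (l - V) with h | h
        · exact ⟨true, by simp only [Fill, h]; simp, by simp⟩
        · exact ⟨false, by simp only [Fill, h]; simp, by simp⟩
    obtain ⟨tU, h1, h1'⟩ := hU'
    obtain ⟨tP, h2, h2'⟩ := hV'
    refine ⟨tP, tU, true, h2, h1, h3, ?_⟩
    cases tU <;> cases tP <;> cases sU <;> cases sV <;> simp_all [chi]

lemma sign_count_right {p q l e : ℝ} {sp sq : Bool} (he : 0 < e)
    (hp : Fill sp p) (hq : Fill sq q) :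
    ∃ tP tU tL, Fill tP (p + l) ∧ Fill tU l ∧ Fill tL (e * l - q) ∧
      chi sp tP + chi tP tU + chi tU tL + chi (!tL) sq ≤ chi sp sq + 1 := by
  have hq' : Fill (!sq) (-(q / e)) := by
    rw [fill_not, div_eq_mul_inv]; exact fill_mul (by positivity) hq
  have hp' : Fill (!sp) (-p) := fill_not.2 hp
  obtain ⟨tL, tP, tU, h1, h2, h3, h4⟩ := sign_count_left (U := p) (V := q / e) (l := l) (e := 1)
    one_pos hp (by rw [div_eq_mul_inv]; exact fill_mul (by positivity) hq : Fill sq (q / e))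
  refine ⟨tP, tU, tL, h2, by simpa using h3, ?_, ?_⟩
  · have : e * l - q = (l - q / e) * e := by field_simp
    rw [this]; exact fill_mul he.le h1
  · have e1 : chi (!tL) sq = chi tL (!sq) := by cases tL <;> cases sq <;> simp [chi]
    have e2 : chi tU tL ≤ chi tU tL := le_refl _
    have e3 : chi tP tU = chi tU tP := by cases tP <;> cases tU <;> simp [chi]
    have e4 : chi tL tU = chi tU tL := by cases tL <;> cases tU <;> simp [chi]
    omega

end SignPaths

namespace ChordDiagram

section Coeff

variable {n k : ℕ}

/-- The entries (indexed by markers) of a linear combination of the rows of the domino matrix. -/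
def coeff (D : ChordDiagram n k) (v : DominoVars k) (c : Fin k → ℝ) : ℕ → ℝ :=
  ∑ t, c t • D.row v (fun p => (Pi.single p 1 : ℕ → ℝ)) t

lemma sum_row {M : Type*} [AddCommGroup M] [Module ℝ M] (D : ChordDiagram n k) (v : DominoVars k)
    (c : Fin k → ℝ) (z : ℕ → M) :
    ∑ t, c t • D.row v z t = ∑ p ∈ Finset.Icc 1 n, D.coeff v c p • z p := by
  let f : (ℕ → ℝ) →ₗ[ℝ] M := ∑ p ∈ Finset.Icc 1 n, (LinearMap.proj p).smulRight (z p)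
  have hf : ∀ x, f x = ∑ p ∈ Finset.Icc 1 n, x p • z p := fun x => by
    simp [f, LinearMap.sum_apply]
  rw [← hf, coeff, map_sum]
  refine Finset.sum_congr rfl fun t _ => ?_
  rw [map_smul, map_row]
  congr 1
  refine row_congr _ _ (fun p h1 h2 => ?_) t
  rw [hf, Finset.sum_eq_single p]
  · simp
  · intro q _ hq
    simp [hq]
  · intro h
    exact absurd (Finset.mem_Icc.2 ⟨h1, h2⟩) h

end Coeff

section Glue

variable {i m l r : ℕ} (hi : 1 ≤ i) (hm : 2 ≤ m) (L : ChordDiagram (i + 2) l)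
  (R : ChordDiagram (m + 2) r) (vL : DominoVars l) (vR : DominoVars r) (a b g d e : ℝ)

lemma glue_coeff (cL : Fin l → ℝ) (y : ℝ) (cR : Fin r → ℝ) (p : ℕ) :
    (glue hi hm L R).coeff (glueVars L R vL vR a b g d e) (glueFun cL y cR) p =
      (if 1 ≤ p ∧ p ≤ i then L.coeff vL cL p else 0) +
      (if i + 1 ≤ p ∧ p ≤ i + m then R.coeff vR cR (p - i) else 0) +
      (L.coeff vL cL (i + 1) + y - (-1) ^ r * R.coeff vR cR (m + 2)) *
        ((if p = i then a else 0) + if p = i + 1 then b else 0) +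
      (R.coeff vR cR (m + 1) + (-1) ^ r * y) *
        ((if p = i + m then g else 0) + if p = i + m + 1 then d else 0) +
      (if p = i + m + 2 then (-1) ^ r * (e * y - L.coeff vL cL (i + 2)) else 0) := by
  rw [coeff, sum_glue]
  simp only [glueFun_idxL, glueFun_idxC, glueFun_idxR, glue_row_L, glue_row_C, glue_row_R, sum_row]
  rw [Finset.sum_Icc_succ_top (by omega : 1 ≤ i + 1 + 1),
    Finset.sum_Icc_succ_top (by omega : 1 ≤ i + 1),
    Finset.sum_Icc_succ_top (by omega : 1 ≤ m + 1 + 1),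
    Finset.sum_Icc_succ_top (by omega : 1 ≤ m + 1)]
  have h1 : ∀ x : ℕ → ℝ, (∑ q ∈ Finset.Icc 1 i, x q • leftPart i m r a b
      (fun p => (Pi.single p 1 : ℕ → ℝ)) q) p = if 1 ≤ p ∧ p ≤ i then x p else 0 := by
    intro x
    have : ∀ q ∈ Finset.Icc 1 i, (x q • leftPart i m r a b
      (fun p => (Pi.single p 1 : ℕ → ℝ)) q) p = if p = q then x q else 0 := by
      intro q hq
      rw [Finset.mem_Icc] at hq
      simp [leftPart, hq.2, Pi.single_apply]
    rw [Finset.sum_apply, Finset.sum_congr rfl this, Finset.sum_ite_eq]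
    simp
  have h2 : ∀ x : ℕ → ℝ, (∑ q ∈ Finset.Icc 1 m, x q • rightPart i m r a b g d
      (fun p => (Pi.single p 1 : ℕ → ℝ)) q) p =
        if i + 1 ≤ p ∧ p ≤ i + m then x (p - i) else 0 := by
    intro x
    have : ∀ q ∈ Finset.Icc 1 m, (x q • rightPart i m r a b g d
      (fun p => (Pi.single p 1 : ℕ → ℝ)) q) p = if p = q + i then x q else 0 := by
      intro q hq
      rw [Finset.mem_Icc] at hq
      simp [rightPart, hq.2, Pi.single_apply]
    rw [Finset.sum_apply, Finset.sum_congr rfl this]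
    by_cases hp : i + 1 ≤ p ∧ p ≤ i + m
    · rw [if_pos hp, Finset.sum_eq_single (p - i)]
      · rw [if_pos (by omega)]
      · intro q _ hq; rw [if_neg (by omega)]
      · intro h; rw [Finset.mem_Icc] at h; omega
    · rw [if_neg hp]
      refine Finset.sum_eq_zero fun q hq => ?_
      rw [Finset.mem_Icc] at hq
      rw [if_neg (by omega)]
  simp only [Pi.add_apply, h1, h2]
  have hs : ((-1 : ℝ) ^ r) * (-1) ^ r = 1 := by rw [← mul_pow]; simp
  simp [leftPart, rightPart, Pi.single_apply]
  split_ifs <;> first | omega | ring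

end Glue

end ChordDiagram

lemma cycLE_glue {x xL xR : ℕ → ℝ} {i m l r mL mR : ℕ} (hi : 1 ≤ i) (hm : 2 ≤ m)
    {a b g d P U : ℝ} (ha : 0 ≤ a) (hb : 0 ≤ b) (hg : 0 ≤ g) (hd : 0 ≤ d) {tP tU tL : Bool}
    (hx : ∀ p, 1 ≤ p → p ≤ i + m + 1 → x p = (if 1 ≤ p ∧ p ≤ i then xL p else 0) +
      (if i + 1 ≤ p ∧ p ≤ i + m then xR (p - i) else 0) +
      P * ((if p = i then a else 0) + if p = i + 1 then b else 0) +
      U * ((if p = i + m then g else 0) + if p = i + m + 1 then d else 0))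
    (hP : Fill tP P) (hU : Fill (xor r.bodd tU) U) (hl : Fill (xor r.bodd tL) (x (i + m + 2)))
    (pL : SignPath xL 1 i (xor l.bodd tL) tP mL)
    (pR : SignPath xR 1 m tP (xor r.bodd tU) mR) (hc : mL + mR + chi tU tL ≤ l + r) :
    CycLE x (i + m + 2) (l + (r + 1)) := by
  refine ⟨_, hl, mL + mR + chi tU tL, by omega, ?_⟩
  have hstart : (xor (!(l + (r + 1)).bodd) (xor r.bodd tL)) = xor l.bodd tL := by
    rw [Nat.bodd_add, Nat.bodd_succ]
    cases l.bodd <;> cases r.bodd <;> cases tL <;> rfl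
  rw [hstart]
  obtain ⟨i', rfl⟩ : ∃ i', i = i' + 1 := ⟨i - 1, by omega⟩
  obtain ⟨m', rfl⟩ : ∃ m', m = m' + 1 := ⟨m - 1, by omega⟩
  have h1 : SignPath x 1 (i' + 1) (xor l.bodd tL) tP mL := by
    refine SignPath.add_last ha hP pL (fun j hj => ?_) ?_
    · rw [hx _ (by omega) (by omega)]
      simp (disch := omega) only [if_pos, if_neg]
      simp
    · rw [hx _ (by omega) (by omega)]
      simp (disch := omega) only [if_pos, if_neg]
      ring
  have h2 : SignPath (fun p => xR p + if p = 1 then b * P else 0) 1 (m' + 1) tP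
      (xor r.bodd tU) mR := by
    refine SignPath.add_first hb hP pR (fun j hj => ?_) ?_
    · simp; omega
    · simp
  have h3 : SignPath (fun p => xR p + (if p = 1 then b * P else 0) +
      (if p = m' + 1 then g * U else 0)) 1 (m' + 1) tP (xor r.bodd tU) mR := by
    refine SignPath.add_last hg hU h2 (fun j hj => ?_) ?_
    · simp; omega
    · simp [add_comm]
  have h4 : SignPath x (1 + (i' + 1)) (m' + 1) tP (xor r.bodd tU) mR := by
    refine h3.congr fun j hj => ?_
    rw [hx _ (by omega) (by omega)]
    have : 1 + (i' + 1) + j - (i' + 1) = 1 + j := by omega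
    rw [this]
    split_ifs <;> first | omega | ring
  have h5 := h1.append h4
  have h6 : SignPath x 1 ((i' + 1) + (m' + 1) + 1) (xor l.bodd tL) (xor r.bodd tL)
      (mL + mR + chi tU tL) := by
    refine ⟨xor r.bodd tU, ?_, mL + mR, by rw [chi_twist], h5⟩
    have : x (1 + (i' + 1 + (m' + 1))) = U * d := by
      rw [hx _ (by omega) (by omega)]
      simp (disch := omega) only [if_pos, if_neg]
      ring
    rw [this]
    exact fill_mul hd hU
  exact h6

namespace ChordDiagram

lemma coeff_of_isEmpty {n : ℕ} (D : ChordDiagram n 0) (v : DominoVars 0) (c : Fin 0 → ℝ) :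
    D.coeff v c = 0 := by
  simp [coeff]

section Glue

variable {i m l r : ℕ} (hi : 1 ≤ i) (hm : 2 ≤ m) (L : ChordDiagram (i + 2) l)
  (R : ChordDiagram (m + 2) r) (vL : DominoVars l) (vR : DominoVars r) {a b g d e : ℝ}

lemma eq_glueFun (c : Fin (l + (r + 1)) → ℝ) :
    ∃ cL y cR, c = glueFun cL y cR := by
  refine ⟨fun t => c (idxL r t), c (idxC l r), fun t => c (idxR l t), ?_⟩
  funext t
  revert t
  rw [forall_glue]
  simp

lemma glue_cycLE (ha : 0 < a) (hb : 0 < b) (hg : 0 < g) (hd : 0 < d) (he : 0 < e)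
    (hL : 1 ≤ l → ∀ c, CycLE (L.coeff vL c) (i + 2) l)
    (hR : 1 ≤ r → ∀ c, CycLE (R.coeff vR c) (m + 2) r) (c : Fin (l + (r + 1)) → ℝ) :
    CycLE ((glue hi hm L R).coeff (glueVars L R vL vR a b g d e) c) (i + m + 2)
      (l + (r + 1)) := by
  obtain ⟨cL, y, cR, rfl⟩ := eq_glueFun c
  set x := (glue hi hm L R).coeff (glueVars L R vL vR a b g d e) (glueFun cL y cR) with hxdef
  set xL := L.coeff vL cL with hxL
  set xR := R.coeff vR cR with hxR
  set s : ℝ := (-1) ^ r with hs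
  have hs2 : s * s = 1 := by rw [hs, ← mul_pow]; simp
  have hx : ∀ p, 1 ≤ p → p ≤ i + m + 1 → x p = (if 1 ≤ p ∧ p ≤ i then xL p else 0) +
      (if i + 1 ≤ p ∧ p ≤ i + m then xR (p - i) else 0) +
      (xL (i + 1) + y - s * xR (m + 2)) * ((if p = i then a else 0) + if p = i + 1 then b else 0) +
      (xR (m + 1) + s * y) * ((if p = i + m then g else 0) + if p = i + m + 1 then d else 0) := by
    intro p h1 h2
    rw [hxdef, glue_coeff]
    rw [if_neg (by omega : ¬ p = i + m + 2)]
    ring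
  have hlast : x (i + m + 2) = s * (e * y - xL (i + 2)) := by
    rw [hxdef, glue_coeff]
    simp (disch := omega) only [if_neg, if_true]
    ring
  have hUs : xR (m + 1) + s * y = s * (s * xR (m + 1) + y) := by
    linear_combination (-xR (m + 1)) * hs2
  rcases Nat.eq_zero_or_pos l with h0l | hl
  · have hxL0 : ∀ p, xL p = 0 := by subst h0l; simp [hxL, coeff_of_isEmpty]
    have hl0 : l.bodd = false := by subst h0l; rfl
    rcases Nat.eq_zero_or_pos r with h0r | hr
    · have hxR0 : ∀ p, xR p = 0 := by subst h0r; simp [hxR, coeff_of_isEmpty]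
      have hr0 : r.bodd = false := by subst h0r; rfl
      have hs1 : s = 1 := by rw [hs, h0r]; simp
      obtain ⟨t, ht⟩ : ∃ t, Fill t y := by
        rcases le_total 0 y with h | h
        · exact ⟨true, by simp [Fill, h]⟩
        · exact ⟨false, by simp [Fill, h]⟩
      refine cycLE_glue (tP := t) (tU := t) (tL := t) hi hm ha.le hb.le hg.le hd.le hx ?_ ?_ ?_
        (signPath_zero fun j _ => hxL0 _) (signPath_zero fun j _ => hxR0 _) ?_
      · simpa [hxL0, hxR0] using ht
      · simpa [hxR0, hr0, hs1] using ht
      · rw [hlast, hxL0, hs1, hr0]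
        simpa [mul_comm] using fill_mul he.le ht
      · simp [hl0, hr0, chi_self]
    · obtain ⟨sv, hv, mR, hmR, su, hu, mR', hmR', pR⟩ := hR hr cR
      have hu : Fill su (xR (m + 1)) := by rw [add_comm]; exact hu
      obtain ⟨tP, tU, tL, h1, h2, h3, h4⟩ := sign_count_left (l := y) he (fill_twist r hu)
        (fill_twist r hv)
      refine cycLE_glue (tP := tP) (tU := tU) (tL := tL) hi hm ha.le hb.le hg.le hd.le hx ?_ ?_ ?_
        (signPath_zero fun j _ => hxL0 _)
        ((pR.start tP).finish (xor r.bodd tU)) ?_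
      · simpa [hxL0] using h1
      · rw [hUs]; exact fill_twist r h2
      · rw [hlast, hxL0, sub_zero]
        exact fill_twist r h3
      · have e1 : chi su (xor r.bodd tU) = chi (xor r.bodd su) tU := by
          cases su <;> cases tU <;> cases r.bodd <;> rfl
        have e2 : (xor (!r.bodd) sv) = !(xor r.bodd sv) := by
          cases sv <;> cases r.bodd <;> rfl
        rw [chi_twist] at h4
        rw [e1, e2, hl0]
        simp only [Bool.false_xor]
        omega
  · obtain ⟨sq, hq, mL, hmL, sp, hp, mL', hmL', pL⟩ := hL hl cL
    have e3 : ∀ tL, chi (xor l.bodd tL) (xor (!l.bodd) sq) = chi (!tL) sq := fun tL => by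
      cases sq <;> cases tL <;> cases l.bodd <;> rfl
    have hp : Fill sp (xL (i + 1)) := by rw [add_comm]; exact hp
    rcases Nat.eq_zero_or_pos r with h0r | hr
    · have hxR0 : ∀ p, xR p = 0 := by subst h0r; simp [hxR, coeff_of_isEmpty]
      have hr0 : r.bodd = false := by subst h0r; rfl
      have hs1 : s = 1 := by rw [hs, h0r]; simp
      obtain ⟨tP, tU, tL, h1, h2, h3, h4⟩ := sign_count_right (l := y) he hp hq
      refine cycLE_glue (tP := tP) (tU := tU) (tL := tL) hi hm ha.le hb.le hg.le hd.le hx ?_ ?_ ?_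
        ((pL.start (xor l.bodd tL)).finish tP) (signPath_zero fun j _ => hxR0 _) ?_
      · simpa [hxR0] using h1
      · simpa [hxR0, hr0, hs1] using h2
      · rw [hlast, hs1, hr0]
        simpa using h3
      · rw [e3, hr0]
        simp only [Bool.false_xor]
        omega
    · obtain ⟨sv, hv, mR, hmR, su, hu, mR', hmR', pR⟩ := hR hr cR
      have hu : Fill su (xR (m + 1)) := by rw [add_comm]; exact hu
      obtain ⟨tP, tU, tL, h1, h2, h3, h4⟩ := sign_count (l := y) he hp hq (fill_twist r hu)
        (fill_twist r hv)
      refine cycLE_glue (tP := tP) (tU := tU) (tL := tL) hi hm ha.le hb.le hg.le hd.le hx h1 ?_ ?_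
        ((pL.start (xor l.bodd tL)).finish tP) ((pR.start tP).finish (xor r.bodd tU)) ?_
      · rw [hUs]; exact fill_twist r h2
      · rw [hlast]; exact fill_twist r h3
      · have e1 : chi su (xor r.bodd tU) = chi (xor r.bodd su) tU := by
          cases su <;> cases tU <;> cases r.bodd <;> rfl
        have e2 : (xor (!r.bodd) sv) = !(xor r.bodd sv) := by
          cases sv <;> cases r.bodd <;> rfl
        rw [chi_twist] at h4
        rw [e1, e2, e3]
        omega

end Glue

end ChordDiagram

/-- The configuration `z 1, …, z n` satisfies the relations given by the rows of a domino matrix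
with `k` rows, the combinations of these rows being suitably restricted. -/
def HasDomino {M : Type*} [AddCommGroup M] [Module ℝ M] (n k : ℕ) (z : ℕ → M) : Prop :=
  ∃ (D : ChordDiagram n k) (v : DominoVars k), D.SignRules v.α v.β v.γ v.δ v.ε ∧
    (∀ l, D.row v z l = 0) ∧ (1 ≤ k → ∀ c, CycLE (D.coeff v c) n k) ∧
    ∀ c, (∀ p, 1 ≤ p → p ≤ n → D.coeff v c p = 0) → c = 0

section HasDomino

variable {M : Type*} [AddCommGroup M] [Module ℝ M]

lemma hasDomino_zero (n : ℕ) (z : ℕ → M) : HasDomino n 0 z := by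
  let D : ChordDiagram n 0 :=
    ⟨Fin.elim0, Fin.elim0, fun l => l.elim0, fun l => l.elim0, fun l => l.elim0, fun l => l.elim0,
      fun l => l.elim0⟩
  refine ⟨D, ⟨Fin.elim0, Fin.elim0, Fin.elim0, Fin.elim0, Fin.elim0⟩, ?_, fun l => l.elim0,
    by omega, fun c _ => funext fun l => l.elim0⟩
  refine ⟨?_, ?_, ?_, ?_, ?_, ?_, ?_, ?_⟩ <;> exact fun l => l.elim0

lemma HasDomino.map {N : Type*} [AddCommGroup N] [Module ℝ N] {n k : ℕ} {z : ℕ → M}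
    (h : HasDomino n k z) (f : M →ₗ[ℝ] N) : HasDomino n k fun p => f (z p) := by
  obtain ⟨D, v, h1, h2, h3⟩ := h
  exact ⟨D, v, h1, fun l => by rw [← ChordDiagram.map_row, h2, map_zero], h3⟩

lemma HasDomino.congr {n k : ℕ} {z z' : ℕ → M} (h : HasDomino n k z)
    (hz : ∀ p, 1 ≤ p → p ≤ n → z p = z' p) : HasDomino n k z' := by
  obtain ⟨D, v, h1, h2, h3⟩ := h
  exact ⟨D, v, h1, fun l => by rw [← ChordDiagram.row_congr D v hz, h2], h3⟩

lemma SignPath.snoc_zero {x : ℕ → ℝ} {a L m : ℕ} {s t : Bool} (h : SignPath x a L s t m)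
    (hx : x (a + L) = 0) : SignPath x a (L + 1) s t m :=
  ⟨t, hx ▸ fill_zero t, m, by simp [chi_self], h⟩

lemma HasDomino.addMarker {n k : ℕ} (hn : 1 ≤ n) {z : ℕ → M}
    (h : HasDomino n k fun p => if p < n then z p else z (n + 1)) : HasDomino (n + 1) k z := by
  obtain ⟨D, v, h1, h2, h3, h4⟩ := h
  have hc : ∀ c p, D.addMarker.coeff v c p =
      if p < n then D.coeff v c p else if p = n + 1 then D.coeff v c n else 0 := by
    intro c p
    have : D.addMarker.coeff v c = ∑ q ∈ Finset.Icc 1 n, D.coeff v c q •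
        (if q < n then Pi.single q 1 else Pi.single (n + 1) 1 : ℕ → ℝ) := by
      rw [ChordDiagram.coeff, ← ChordDiagram.sum_row]
      simp only [ChordDiagram.addMarker_row]
    rw [this]
    obtain ⟨n, rfl⟩ : ∃ n', n = n' + 1 := ⟨n - 1, by omega⟩
    rw [Finset.sum_Icc_succ_top (by omega), Finset.sum_congr rfl (g := fun q =>
      D.coeff v c q • (Pi.single q 1 : ℕ → ℝ))]
    · simp only [lt_irrefl, if_false, Pi.add_apply, Finset.sum_apply, Pi.smul_apply, smul_eq_mul,
        Pi.single_apply, mul_ite, mul_one, mul_zero]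
      rw [Finset.sum_ite_eq]
      simp only [Finset.mem_Icc]
      by_cases h0 : p = 0
      · subst h0
        have : D.coeff v c 0 = 0 := by
          rw [ChordDiagram.coeff, Finset.sum_apply]
          refine Finset.sum_eq_zero fun t _ => ?_
          have e1 := D.row_congr v (z := fun p => (Pi.single p 1 : ℕ → ℝ))
            (z' := fun p => if 1 ≤ p then (Pi.single p 1 : ℕ → ℝ) else 0)
            (fun p h1 _ => by simp [h1]) t
          have e2 := ChordDiagram.map_row (LinearMap.proj 0 : (ℕ → ℝ) →ₗ[ℝ] ℝ) D v
            (fun p => if 1 ≤ p then (Pi.single p 1 : ℕ → ℝ) else 0) t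
          have e3 : (fun p => (LinearMap.proj 0 : (ℕ → ℝ) →ₗ[ℝ] ℝ)
              (if 1 ≤ p then (Pi.single p 1 : ℕ → ℝ) else 0)) = fun _ => 0 := by
            funext p
            split_ifs with hp
            · rw [LinearMap.proj_apply, Pi.single_eq_of_ne (by omega)]
            · simp
          rw [e3] at e2
          rw [Pi.smul_apply, e1]
          have : D.row v (fun _ => (0 : ℝ)) t = 0 := by simp [ChordDiagram.row]
          simp only [LinearMap.proj_apply] at e2
          rw [e2, this, smul_zero]
        simp [this]
      · split_ifs <;> first | omega | simp
    · intro q hq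
      rw [Finset.mem_Icc] at hq
      rw [if_pos (by omega)]
  refine ⟨D.addMarker, v, D.addMarker_signRules v h1, fun l => by rw [D.addMarker_row, h2], ?_, ?_⟩
  · intro hk c
    obtain ⟨u, hu, m, hm, hp⟩ := h3 hk c
    refine ⟨u, by simpa [hc] using hu, m, hm, ?_⟩
    obtain ⟨n, rfl⟩ : ∃ n', n = n' + 1 := ⟨n - 1, by omega⟩
    refine SignPath.snoc_zero (L := n) ?_ ?_
    · refine hp.congr fun j hj => ?_
      rw [hc, if_pos (by omega)]
    · rw [hc, if_neg (by omega), if_neg (by omega)]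
  · intro c hx
    refine h4 c fun p hp1 hp2 => ?_
    rcases hp2.lt_or_eq with h | rfl
    · have := hx p hp1 (by omega)
      rwa [hc, if_pos h] at this
    · have := hx (p + 1) (by omega) le_rfl
      rwa [hc, if_neg (by omega), if_pos rfl] at this

lemma HasDomino.glue {i m l r : ℕ} (hi : 1 ≤ i) (hm : 2 ≤ m) {a b g d e : ℝ} (ha : 0 < a)
    (hb : 0 < b) (hg : 0 < g) (hd : 0 < d) (he : 0 < e) {z : ℕ → M}
    (hL : HasDomino (i + 2) l (ChordDiagram.leftPart i m r a b z))
    (hR : HasDomino (m + 2) r (ChordDiagram.rightPart i m r a b g d z))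
    (hC : (a • z i + b • z (i + 1)) + ((-1) ^ r : ℝ) • (g • z (i + m) + d • z (i + m + 1)) +
        ((-1) ^ r * e : ℝ) • z (i + m + 2) = 0)
    (hind : 1 ≤ l → ∀ u v w : ℝ, u • z i + v • (a • z i + b • z (i + 1)) +
      w • (-(-1) ^ r : ℝ) • z (i + m + 2) = 0 → u = 0 ∧ v = 0 ∧ w = 0) :
    HasDomino (i + m + 2) (l + (r + 1)) z := by
  obtain ⟨L, vL, L1, L2, L3, L4⟩ := hL
  obtain ⟨R, vR, R1, R2, R3, R4⟩ := hR
  refine ⟨ChordDiagram.glue hi hm L R, ChordDiagram.glueVars L R vL vR a b g d e,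
    ChordDiagram.glue_signRules hi hm L R vL vR a b g d e ha hb hg hd he L1 R1, ?_, fun _ c =>
      ChordDiagram.glue_cycLE hi hm L R vL vR ha hb hg hd he L3 R3 c, ?_⟩
  · rw [ChordDiagram.forall_glue]
    refine ⟨fun c => ?_, ?_, fun c => ?_⟩
    · rw [ChordDiagram.glue_row_L, L2]
    · rw [ChordDiagram.glue_row_C, hC]
    · rw [ChordDiagram.glue_row_R, R2]
  · intro c hx
    obtain ⟨cL, y, cR, rfl⟩ := ChordDiagram.eq_glueFun c
    simp only [ChordDiagram.glue_coeff] at hx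
    set xL := L.coeff vL cL with hxL
    set xR := R.coeff vR cR with hxR
    have hs : ((-1 : ℝ) ^ r) ≠ 0 := by simp
    have hU : xR (m + 1) + (-1) ^ r * y = 0 := by
      have := hx (i + m + 1) (by omega) (by omega)
      simp (disch := omega) only [if_neg, if_true] at this
      simpa [hd.ne'] using this
    have hE : e * y - xL (i + 2) = 0 := by
      have := hx (i + m + 2) (by omega) (by omega)
      simp (disch := omega) only [if_neg, if_true] at this
      simpa using this
    rw [hU] at hx
    have hlt : ∀ p, 1 ≤ p → p < i → xL p = 0 := fun p h1 h2 => by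
      have := hx p (by omega) (by omega)
      simp (disch := omega) only [if_neg, if_pos] at this
      simpa using this
    have hxi : xL i + (xL (i + 1) + y - (-1) ^ r * xR (m + 2)) * a = 0 := by
      have := hx i (by omega) (by omega)
      simp (disch := omega) only [if_neg, if_pos] at this
      simpa using this
    have hall : xL i = 0 ∧ xL (i + 1) = 0 ∧ xL (i + 2) = 0 := by
      rcases Nat.eq_zero_or_pos l with rfl | hl
      · simp [hxL, ChordDiagram.coeff_of_isEmpty]
      · apply hind hl
        have h0 := L.sum_row vL cL (ChordDiagram.leftPart i m r a b z)
        simp only [L2, smul_zero, Finset.sum_const_zero] at h0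
        rw [Finset.sum_Icc_succ_top (by omega : 1 ≤ i + 1 + 1),
          Finset.sum_Icc_succ_top (by omega : 1 ≤ i + 1), Finset.sum_eq_single i] at h0
        · simpa [ChordDiagram.leftPart] using h0.symm
        · intro p hp hpi
          rw [Finset.mem_Icc] at hp
          rw [← hxL, hlt p hp.1 (by omega), zero_smul]
        · intro h; rw [Finset.mem_Icc] at h; omega
    obtain ⟨e1, e2, e3⟩ := hall
    have hy : y = 0 := by rw [e3] at hE; simpa [he.ne'] using hE
    subst hy
    have hcL : cL = 0 := by
      apply L4
      intro p h1 h2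
      rcases lt_trichotomy p i with h | rfl | h
      · exact hlt p h1 h
      · exact e1
      · obtain rfl | rfl : p = i + 1 ∨ p = i + 2 := by omega
        · exact e2
        · exact e3
    have hP : xL (i + 1) + 0 - (-1) ^ r * xR (m + 2) = 0 := by
      rw [e1] at hxi; simpa [ha.ne'] using hxi
    rw [hP] at hx
    have hcR : cR = 0 := by
      apply R4
      intro p h1 h2
      by_cases h : p ≤ m
      · have := hx (p + i) (by omega) (by omega)
        simp (disch := omega) only [if_neg, if_pos] at this
        simpa using this
      · obtain rfl | rfl : p = m + 1 ∨ p = m + 2 := by omega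
        · simpa using hU
        · rw [e2] at hP
          simpa using hP
    subst hcL hcR
    funext t
    revert t
    rw [ChordDiagram.forall_glue]
    simp

end HasDomino

/-- The determinant of four vectors in `ℝ⁴`. -/
def br (a b c d : Fin 4 → ℝ) : ℝ := (Matrix.of ![a, b, c, d]).det

section Bracket

variable (a b c d e : Fin 4 → ℝ)

lemma br_eq : br a b c d =
    (a 0 * b 1 - a 1 * b 0) * (c 2 * d 3 - c 3 * d 2) - (a 0 * b 2 - a 2 * b 0) *
      (c 1 * d 3 - c 3 * d 1) + (a 0 * b 3 - a 3 * b 0) * (c 1 * d 2 - c 2 * d 1) +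
    (a 1 * b 2 - a 2 * b 1) * (c 0 * d 3 - c 3 * d 0) - (a 1 * b 3 - a 3 * b 1) *
      (c 0 * d 2 - c 2 * d 0) + (a 2 * b 3 - a 3 * b 2) * (c 0 * d 1 - c 1 * d 0) := by
  simp [br, Matrix.det_succ_row_zero, Fin.sum_univ_succ, Fin.succAbove]
  ring

lemma br_swap34 : br a b c d = -br a b d c := by simp only [br_eq]; ring

lemma br_pair : br a b c d = br c d a b := by simp only [br_eq]; ring
lemma br_rotate : br a b c d = br b c a d := by simp only [br_eq]; ring
lemma br_cycle : br a b c d = -br b c d a := by simp only [br_eq]; ring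

@[simp] lemma br_self12 : br a a c d = 0 := by simp only [br_eq]; ring
@[simp] lemma br_self13 : br a b a d = 0 := by simp only [br_eq]; ring
@[simp] lemma br_self14 : br a b c a = 0 := by simp only [br_eq]; ring
@[simp] lemma br_self23 : br a b b d = 0 := by simp only [br_eq]; ring
@[simp] lemma br_self24 : br a b c b = 0 := by simp only [br_eq]; ring
@[simp] lemma br_self34 : br a b c c = 0 := by simp only [br_eq]; ring

lemma br_add1 : br (a + e) b c d = br a b c d + br e b c d := by
  simp only [br_eq, Pi.add_apply]; ring
lemma br_add2 : br a (b + e) c d = br a b c d + br a e c d := by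
  simp only [br_eq, Pi.add_apply]; ring
lemma br_add3 : br a b (c + e) d = br a b c d + br a b e d := by
  simp only [br_eq, Pi.add_apply]; ring
lemma br_add4 : br a b c (d + e) = br a b c d + br a b c e := by
  simp only [br_eq, Pi.add_apply]; ring

lemma br_smul1 (t : ℝ) : br (t • a) b c d = t * br a b c d := by
  simp only [br_eq, Pi.smul_apply, smul_eq_mul]; ring
lemma br_smul2 (t : ℝ) : br a (t • b) c d = t * br a b c d := by
  simp only [br_eq, Pi.smul_apply, smul_eq_mul]; ring
lemma br_smul3 (t : ℝ) : br a b (t • c) d = t * br a b c d := by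
  simp only [br_eq, Pi.smul_apply, smul_eq_mul]; ring
lemma br_smul4 (t : ℝ) : br a b c (t • d) = t * br a b c d := by
  simp only [br_eq, Pi.smul_apply, smul_eq_mul]; ring

lemma br_five : br b c d e • a - br a c d e • b + br a b d e • c - br a b c e • d +
    br a b c d • e = 0 := by
  funext j
  simp only [br_eq, Pi.add_apply, Pi.sub_apply, Pi.smul_apply, smul_eq_mul, Pi.zero_apply]
  fin_cases j <;> simp only [Fin.zero_eta, Fin.mk_one, Fin.reduceFinMk] <;> ring

lemma br_pencil (x y u v p q : Fin 4 → ℝ) :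
    br x y u p * br x y v q - br x y u q * br x y v p = br x y u v * br x y p q := by
  have h := congrArg (fun w => br x y w q) (br_five x y u v p)
  simp only [sub_eq_add_neg, ← neg_smul, br_add3, br_smul3, br_self13, br_self23] at h
  have h0 : br x y 0 q = 0 := by simpa using br_smul3 x y 0 q 0
  rw [h0] at h
  linear_combination -h

end Bracket

/-- Whether a real number is positive. -/
def pos (x : ℝ) : Bool := decide (0 < x)

lemma pos_eq_true {x : ℝ} : pos x = true ↔ 0 < x := by simp [pos]

lemma pos_eq_false {x : ℝ} (hx : x ≠ 0) : pos x = false ↔ x < 0 := by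
  simp only [pos, decide_eq_false_iff_not, not_lt]
  exact ⟨fun h => lt_of_le_of_ne h hx, le_of_lt⟩

lemma pos_of_pos {x : ℝ} (h : 0 < x) : pos x = true := pos_eq_true.2 h

lemma pos_of_neg {x : ℝ} (h : x < 0) : pos x = false := (pos_eq_false h.ne).2 h

lemma pos_neg {x : ℝ} (h : x ≠ 0) : pos (-x) = !pos x := by
  rcases lt_or_gt_of_ne h with h | h
  · rw [pos_of_neg h, pos_of_pos (by linarith)]; rfl
  · rw [pos_of_pos h, pos_of_neg (by linarith)]; rfl

lemma pos_mul_pos {c x : ℝ} (hc : 0 < c) : pos (c * x) = pos x := by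
  simp [pos, hc]

lemma pos_mul {c x : ℝ} (hc : c ≠ 0) (hx : x ≠ 0) : pos (c * x) = !xor (pos c) (pos x) := by
  rcases lt_or_gt_of_ne hc with h | h
  · rw [pos_of_neg h, show c * x = -(-c * x) by ring,
      pos_neg (mul_ne_zero (neg_ne_zero.2 hc) hx), pos_mul_pos (by linarith)]
    simp
  · rw [pos_of_pos h, pos_mul_pos h]; simp

/-- The number of sign changes of `u a, …, u b`. -/
def flips (u : ℕ → ℝ) (a b : ℕ) : ℕ := ∑ q ∈ Finset.Ico a b, chi (pos (u q)) (pos (u (q + 1)))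

lemma flips_self (u : ℕ → ℝ) (a : ℕ) : flips u a a = 0 := by simp [flips]

lemma flips_add (u : ℕ → ℝ) {a b c : ℕ} (hab : a ≤ b) (hbc : b ≤ c) :
    flips u a c = flips u a b + flips u b c :=
  (Finset.sum_Ico_consecutive _ hab hbc).symm

lemma flips_succ (u : ℕ → ℝ) (a : ℕ) : flips u a (a + 1) = chi (pos (u a)) (pos (u (a + 1))) := by
  simp [flips]

lemma flips_le (u : ℕ → ℝ) (a b : ℕ) : flips u a b ≤ b - a := by
  refine (Finset.sum_le_card_nsmul _ _ 1 fun q _ => ?_).trans (by simp)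
  unfold chi; split_ifs <;> simp

lemma flips_congr {u v : ℕ → ℝ} {a b a' : ℕ} (c : ℕ) (hc : a' = a + c)
    (h : ∀ q, a ≤ q → q ≤ b → pos (v (q + c)) = pos (u q)) : flips v a' (b + c) = flips u a b := by
  subst hc
  rw [flips, ← Finset.sum_Ico_add']
  refine Finset.sum_congr rfl fun q hq => ?_
  rw [Finset.mem_Ico] at hq
  rw [h q hq.1 hq.2.le, show q + c + 1 = q + 1 + c by ring, h (q + 1) (by omega) (by omega)]

lemma flips_mul {u : ℕ → ℝ} {c : ℝ} {a b : ℕ} (hc : c ≠ 0)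
    (h : ∀ q, a ≤ q → q ≤ b → u q ≠ 0) : flips (fun q => c * u q) a b = flips u a b := by
  refine Finset.sum_congr rfl fun q hq => ?_
  rw [Finset.mem_Ico] at hq
  rw [pos_mul hc (h q hq.1 hq.2.le), pos_mul hc (h (q + 1) (by omega) (by omega))]
  cases pos c <;> cases pos (u q) <;> cases pos (u (q + 1)) <;> rfl

lemma flips_compare_step {a b a' b' : ℝ} (ha : a ≠ 0) (hb : b ≠ 0) (ha' : a' ≠ 0) (hb' : b' ≠ 0)
    (h : 0 ≤ a * b' - a' * b) :
    chi (pos a) (pos a') + chi (pos a) (pos b) = chi (pos b) (pos b') + chi (pos a') (pos b') := by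
  rcases lt_or_gt_of_ne ha with h1 | h1 <;> rcases lt_or_gt_of_ne hb with h2 | h2 <;>
    rcases lt_or_gt_of_ne ha' with h3 | h3 <;> rcases lt_or_gt_of_ne hb' with h4 | h4 <;>
    simp only [pos_of_pos, pos_of_neg, h1, h2, h3, h4, chi] <;> simp <;>
    first
      | nlinarith [mul_pos h1 h4, mul_pos_of_neg_of_neg h3 h2]
      | nlinarith [mul_pos_of_neg_of_neg h1 h4, mul_pos h3 h2]
      | nlinarith [mul_neg_of_pos_of_neg h1 h4, mul_pos h3 h2]
      | nlinarith [mul_neg_of_neg_of_pos h1 h4, mul_pos h3 h2]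
      | nlinarith [mul_neg_of_pos_of_neg h1 h4, mul_pos_of_neg_of_neg h3 h2]
      | nlinarith [mul_neg_of_neg_of_pos h1 h4, mul_pos_of_neg_of_neg h3 h2]

lemma flips_compare {u v : ℕ → ℝ} {a b : ℕ} (hab : a ≤ b) (hu : ∀ q, a ≤ q → q ≤ b → u q ≠ 0)
    (hv : ∀ q, a ≤ q → q ≤ b → v q ≠ 0)
    (h : ∀ q, a ≤ q → q + 1 ≤ b → 0 ≤ u q * v (q + 1) - u (q + 1) * v q) :
    flips u a b + chi (pos (u a)) (pos (v a)) = flips v a b + chi (pos (u b)) (pos (v b)) := by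
  induction b, hab using Nat.le_induction with
  | base => simp [flips_self]
  | succ b hb ih =>
    have := ih (fun q h1 h2 => hu q h1 (by omega)) (fun q h1 h2 => hv q h1 (by omega))
      (fun q h1 h2 => h q h1 (by omega))
    rw [flips_add u hb (Nat.le_succ b), flips_add v hb (Nat.le_succ b), flips_succ, flips_succ]
    have h2 := flips_compare_step (hu b hb (by omega)) (hv b hb (by omega))
      (hu (b + 1) (by omega) le_rfl) (hv (b + 1) (by omega) le_rfl) (h b hb le_rfl)
    omega

/-- The sign conditions satisfied by `z 1, …, z n` when these vectors are the projections of the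
rows of a positive matrix from a generic point of the amplituhedron. -/
structure Cls (n k : ℕ) (z : ℕ → Fin 4 → ℝ) : Prop where
  pos_pair : ∀ p q, 1 ≤ p → p + 1 < q → q + 1 ≤ n → 0 < br (z p) (z (p + 1)) (z q) (z (q + 1))
  pos_twist : ∀ p, 2 ≤ p → p + 1 < n → 0 < (-1) ^ (k + 1) * br (z p) (z (p + 1)) (z n) (z 1)
  ne_zero : ∀ q, 1 ≤ q → q + 3 ≤ n → br (z (n - 2)) (z (n - 1)) (z n) (z q) ≠ 0
  count : flips (fun q => br (z (n - 2)) (z (n - 1)) (z n) (z q)) 1 (n - 3) = k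

/-- All brackets of four different vectors among `z 1, …, z n` are nonzero. -/
def Generic (n : ℕ) (z : ℕ → Fin 4 → ℝ) : Prop :=
  ∀ a b c d, a ∈ Finset.Icc 1 n → b ∈ Finset.Icc 1 n → c ∈ Finset.Icc 1 n → d ∈ Finset.Icc 1 n →
    a ≠ b → a ≠ c → a ≠ d → b ≠ c → b ≠ d → c ≠ d → br (z a) (z b) (z c) (z d) ≠ 0

/-- The twisted periodic continuation of `z 1, …, z n`. -/
def wrap (n k : ℕ) (z : ℕ → Fin 4 → ℝ) (p : ℕ) : Fin 4 → ℝ :=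
  if p ≤ n then z p else ((-1) ^ (k + 1) : ℝ) • z (p - n)

lemma chi_comm (s t : Bool) : chi s t = chi t s := by
  cases s <;> cases t <;> rfl

section Wrap

variable {n k : ℕ} {z : ℕ → Fin 4 → ℝ}

lemma neg_one_pow_mul_self (k : ℕ) : ((-1 : ℝ) ^ k) * (-1) ^ k = 1 := by
  rw [← mul_pow]; simp

lemma wrap_of_le {p : ℕ} (h : p ≤ n) : wrap n k z p = z p := if_pos h

lemma wrap_add {p : ℕ} (h : 1 ≤ p) : wrap n k z (p + n) = ((-1) ^ (k + 1) : ℝ) • z p := by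
  rw [wrap, if_neg (by omega), Nat.add_sub_cancel]

lemma Cls.wrap_pos (h : Cls n k z) {p q : ℕ} (hp : 1 ≤ p) (hpn : p ≤ n) (hpq : p + 1 < q)
    (hqp : q + 1 < p + n) :
    0 < br (wrap n k z p) (wrap n k z (p + 1)) (wrap n k z q) (wrap n k z (q + 1)) := by
  have hs := neg_one_pow_mul_self (k + 1)
  rw [wrap_of_le hpn]
  rcases lt_trichotomy q n with hq | rfl | hq
  · rw [wrap_of_le (by omega), wrap_of_le (by omega), wrap_of_le (by omega)]
    exact h.pos_pair p q hp hpq (by omega)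
  · rw [wrap_of_le (by omega), wrap_of_le (by omega), add_comm q 1, wrap_add le_rfl, br_smul4]
    exact h.pos_twist p (by omega) (by omega)
  · obtain ⟨q, rfl⟩ : ∃ q', q = q' + n := ⟨q - n, by omega⟩
    rw [wrap_add (by omega), add_right_comm, wrap_add (by omega), br_smul3, br_smul4,
      ← mul_assoc, hs, one_mul]
    rcases hpn.lt_or_eq with hp' | rfl
    · rw [wrap_of_le (by omega), br_pair]
      exact h.pos_pair q p (by omega) (by omega) (by omega)
    · rw [add_comm p 1, wrap_add le_rfl, br_smul2, br_pair]
      exact h.pos_twist q (by omega) (by omega)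

lemma Generic.wrap_ne (h : Generic n z) {a b c d : ℕ} (ha : 1 ≤ a) (hab : a < b) (hbc : b < c)
    (hcd : c < d) (hda : d < a + n) (han : a ≤ n) :
    br (wrap n k z a) (wrap n k z b) (wrap n k z c) (wrap n k z d) ≠ 0 := by
  have key : ∀ p, 1 ≤ p → p ≤ 2 * n → ∃ t : ℝ, t ≠ 0 ∧ ∃ p', 1 ≤ p' ∧ p' ≤ n ∧
      (p = p' ∨ p = p' + n) ∧ wrap n k z p = t • z p' := by
    intro p h1 h2
    by_cases hp : p ≤ n
    · exact ⟨1, one_ne_zero, p, h1, hp, Or.inl rfl, by rw [wrap_of_le hp, one_smul]⟩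
    · exact ⟨(-1) ^ (k + 1), by simp, p - n, by omega, by omega, Or.inr (by omega), by
        rw [wrap, if_neg hp]⟩
  obtain ⟨ta, ha0, a', ha1, ha2, ha3, ha4⟩ := key a (by omega) (by omega)
  obtain ⟨tb, hb0, b', hb1, hb2, hb3, hb4⟩ := key b (by omega) (by omega)
  obtain ⟨tc, hc0, c', hc1, hc2, hc3, hc4⟩ := key c (by omega) (by omega)
  obtain ⟨td, hd0, d', hd1, hd2, hd3, hd4⟩ := key d (by omega) (by omega)
  rw [ha4, hb4, hc4, hd4, br_smul1, br_smul2, br_smul3, br_smul4]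
  refine mul_ne_zero ha0 (mul_ne_zero hb0 (mul_ne_zero hc0 (mul_ne_zero hd0 ?_)))
  apply h <;> first | exact Finset.mem_Icc.2 ⟨by omega, by omega⟩ | omega

/-- The number of sign changes of the brackets of `p, p + 1, p + 2` with the other vectors. -/
def wflips (n k : ℕ) (z : ℕ → Fin 4 → ℝ) (p : ℕ) : ℕ :=
  flips (fun q => br (wrap n k z p) (wrap n k z (p + 1)) (wrap n k z (p + 2)) (wrap n k z q))
    (p + 3) (p + n - 1)

lemma Cls.wflips_last (h : Cls n k z) (hn : 4 ≤ n) :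
    wflips n k z (n - 2) = k := by
  refine Eq.trans ?_ h.count
  rw [wflips, show n - 2 + n - 1 = (n - 3) + n by omega, show n - 2 + 3 = 1 + n by omega]
  rw [flips_congr (a := 1) (u := fun q => (-1) ^ (k + 1) * br (z (n - 2)) (z (n - 1)) (z n) (z q))
    n rfl, flips_mul (by simp)]
  · intro q h1 h2
    exact h.ne_zero q h1 (by omega)
  · intro q h1 h2
    rw [wrap_of_le (by omega), wrap_of_le (by omega), wrap_of_le (by omega), wrap_add h1, br_smul4,
       show n - 2 + 1 = n - 1 by omega, show n - 2 + 2 = n by omega]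

lemma Cls.wflips_pred (h : Cls n k z) (hg : Generic n z) {p : ℕ} (hp : 1 ≤ p) (hpn : p + 3 ≤ n)
    (hn : 5 ≤ n) : wflips n k z p = wflips n k z (p + 1) := by
  set w := wrap n k z with hw
  have hs := neg_one_pow_mul_self (k + 1)
  set u : ℕ → ℝ := fun q => br (w p) (w (p + 1)) (w (p + 2)) (w q) with hu
  set v : ℕ → ℝ := fun q => br (w (p + 1)) (w (p + 2)) (w (p + 3)) (w q) with hv
  have hu0 : ∀ q, p + 3 ≤ q → q < p + n → u q ≠ 0 := fun q h1 h2 =>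
    hg.wrap_ne hp (by omega) (by omega) (by omega) (by omega) (by omega)
  have hv0 : ∀ q, p + 4 ≤ q → q < p + 1 + n → v q ≠ 0 := fun q h1 h2 =>
    hg.wrap_ne (by omega) (by omega) (by omega) (by omega) (by omega) (by omega)
  have hcmp : ∀ q, p + 4 ≤ q → q + 1 ≤ p + n - 1 → 0 ≤ u q * v (q + 1) - u (q + 1) * v q := by
    intro q h1 h2
    have e1 := br_pencil (w (p + 1)) (w (p + 2)) (w p) (w (p + 3)) (w q) (w (q + 1))
    rw [← br_rotate (w p), ← br_rotate (w p)] at e1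
    change u q * v (q + 1) - u (q + 1) * v q = _ at e1
    rw [e1, ← br_rotate]
    exact (mul_pos (h.wrap_pos hp (by omega) (by omega) (by omega))
      (h.wrap_pos (by omega) (by omega) (by omega) (by omega))).le
  have hT := flips_compare (a := p + 4) (b := p + n - 1) (by omega)
    (fun q h1 h2 => hu0 q (by omega) (by omega)) (fun q h1 h2 => hv0 q h1 (by omega)) hcmp
  have e1 : wflips n k z p =
      chi (pos (u (p + 3))) (pos (u (p + 4))) + flips u (p + 4) (p + n - 1) := by
    rw [wflips, flips_add _ (by omega : p + 3 ≤ p + 4) (by omega), flips_succ]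
  have e2 : wflips n k z (p + 1) = flips v (p + 4) (p + n - 1) +
      chi (pos (v (p + n - 1))) (pos (v (p + n))) := by
    rw [wflips, show p + 1 + n - 1 = p + n - 1 + 1 by omega,
      flips_add _ (by omega : p + 1 + 3 ≤ p + n - 1) (by omega), flips_succ]
    simp only [hv, hw]
    rw [show p + n - 1 + 1 = p + n by omega, add_right_comm p 1 2, add_right_comm p 1 1]
  have h1 : pos (u (p + 3)) = true := pos_of_pos (h.wrap_pos hp (by omega) (by omega) (by omega))
  have h2 : pos (v (p + 4)) = true :=
    pos_of_pos (h.wrap_pos (by omega) (by omega) (by omega) (by omega))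
  have hwn : w (p + n) = ((-1) ^ (k + 1) : ℝ) • w p := by
    rw [hw, wrap_add hp, wrap_of_le (by omega)]
  have h3 : 0 < (-1) ^ (k + 1) * -v (p + n) := by
    have := h.wrap_pos (p := p) (q := p + 2) hp (by omega) (by omega) (by omega)
    rw [br_cycle] at this
    simp only [hv, hwn, br_smul4]
    rw [← mul_neg, ← mul_assoc, hs, one_mul]
    exact this
  have h4 : 0 < (-1) ^ (k + 1) * -u (p + n - 1) := by
    have := h.wrap_pos (p := p + 1) (q := p + n - 1) (by omega) (by omega) (by omega) (by omega)
    rw [show p + n - 1 + 1 = p + n by omega, ← hw, hwn, br_smul4] at this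
    simp only [hu]
    rwa [br_cycle, neg_neg]
  have h5 : pos (v (p + n)) = pos (u (p + n - 1)) := by
    have a1 := pos_of_pos h3
    have a2 := pos_of_pos h4
    have n1 := hv0 (p + n) (by omega) (by omega)
    have n2 := hu0 (p + n - 1) (by omega) (by omega)
    rw [pos_mul (by simp) (neg_ne_zero.2 n1), pos_neg n1] at a1
    rw [pos_mul (by simp) (neg_ne_zero.2 n2), pos_neg n2, ← a1] at a2
    revert a2
    generalize pos ((-1 : ℝ) ^ (k + 1)) = t
    cases t <;> cases pos (v (p + n)) <;> cases pos (u (p + n - 1)) <;> simp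
  rw [e1, e2, h1, h5, chi_comm (pos (v (p + n - 1)))]
  rw [h2, chi_comm _ true] at hT
  omega

lemma Cls.wflips_eq (h : Cls n k z) (hg : Generic n z) {p : ℕ} (hp : 1 ≤ p) (hpn : p + 2 ≤ n)
    (hn : 5 ≤ n) : wflips n k z p = k := by
  obtain ⟨j, rfl⟩ : ∃ j, p = n - 2 - j := ⟨n - 2 - p, by omega⟩
  induction j with
  | zero => exact h.wflips_last (by omega)
  | succ j ih =>
    rw [h.wflips_pred hg hp (by omega) hn, show n - 2 - (j + 1) + 1 = n - 2 - j by omega]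
    exact ih (by omega) (by omega)

lemma Cls.five_le (h : Cls n k z) (hk : 1 ≤ k) : 5 ≤ n := by
  have := flips_le (fun q => br (z (n - 2)) (z (n - 1)) (z n) (z q)) 1 (n - 3)
  rw [h.count] at this
  omega

end Wrap

section Delete

variable {n k : ℕ} {z : ℕ → Fin 4 → ℝ}

lemma Cls.delete (h : Cls (n + 1) k z) (hg : Generic (n + 1) z) (hn : 4 ≤ n)
    (hpos : ∀ p, 1 ≤ p → p + 3 ≤ n → 0 < br (z p) (z (p + 1)) (z (n - 1)) (z (n + 1))) :
    Cls n k fun p => if p < n then z p else z (n + 1) := by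
  set u : ℕ → ℝ := fun q => br (z (n - 2)) (z (n - 1)) (z n) (z q) with hu
  set v : ℕ → ℝ := fun q => br (z (n - 2)) (z (n - 1)) (z (n + 1)) (z q) with hv
  have hu0 : ∀ q, 1 ≤ q → q + 3 ≤ n → u q ≠ 0 := fun q h1 h2 => by
    apply hg <;> first | exact Finset.mem_Icc.2 ⟨by omega, by omega⟩ | omega
  have hv0 : ∀ q, 1 ≤ q → q + 3 ≤ n → v q ≠ 0 := fun q h1 h2 => by
    apply hg <;> first | exact Finset.mem_Icc.2 ⟨by omega, by omega⟩ | omega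
  have hs := neg_one_pow_mul_self (k + 1)
  refine ⟨fun p q hp hpq hq => ?_, fun p hp hpn => ?_, fun q h1 h2 => ?_, ?_⟩
  · rw [if_pos (by omega), if_pos (by omega), if_pos (by omega)]
    rcases hq.lt_or_eq with hq | rfl
    · rw [if_pos hq]
      exact h.pos_pair p q hp hpq (by omega)
    · rw [if_neg (by omega)]
      exact hpos p hp (by omega)
  · rw [if_pos (by omega), if_pos (by omega), if_neg (by omega), if_pos (by omega)]
    exact h.pos_twist p hp (by omega)
  · rw [if_pos (by omega), if_pos (by omega), if_neg (by omega), if_pos (by omega)]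
    exact hv0 q h1 h2
  · have e0 : flips (fun q => br (if n - 2 < n then z (n - 2) else z (n + 1))
        (if n - 1 < n then z (n - 1) else z (n + 1)) (if n < n then z n else z (n + 1))
        (if q < n then z q else z (n + 1))) 1 (n - 3) = flips v 1 (n - 3) := by
      refine flips_congr (b := n - 3) 0 (by omega) fun q h1 h2 => ?_
      simp only [add_zero]
      rw [if_pos (by omega), if_pos (by omega), if_neg (by omega), if_pos (by omega)]
    rw [e0]
    have hT := flips_compare (u := u) (v := v) (a := 1) (b := n - 3) (by omega)
      (fun q h1 h2 => hu0 q h1 (by omega)) (fun q h1 h2 => hv0 q h1 (by omega)) (fun q h1 h2 => by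
        have := br_pencil (z (n - 2)) (z (n - 1)) (z n) (z (n + 1)) (z q) (z (q + 1))
        change u q * v (q + 1) - u (q + 1) * v q = _ at this
        rw [this, br_pair _ _ (z q)]
        have a1 := h.pos_pair (n - 2) n (by omega) (by omega) (by omega)
        rw [show n - 2 + 1 = n - 1 by omega] at a1
        have a2 := h.pos_pair q (n - 2) (by omega) (by omega) (by omega)
        rw [show n - 2 + 1 = n - 1 by omega] at a2
        positivity)
    have hw := h.wflips_eq hg (p := n - 2) (by omega) (by omega) (by omega)
    rw [wflips, flips_add _ (by omega : n - 2 + 3 ≤ n - 2 + 3 + 1) (by omega), flips_succ] at hw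
    rw [show n - 2 + 3 = n + 1 by omega, show n - 2 + 1 = n - 1 by omega,
      show n - 2 + 2 = n by omega, wrap_of_le (by omega), wrap_of_le (by omega),
      wrap_of_le (by omega), wrap_of_le le_rfl, show n + 1 + 1 = 1 + (n + 1) by omega,
      wrap_add le_rfl, show n - 2 + (n + 1) - 1 = n - 3 + (n + 1) by omega,
      flips_congr (a := 1) (u := fun q => (-1) ^ (k + 1) * u q) (n + 1) rfl, flips_mul (by simp)
        fun q h1 h2 => hu0 q h1 (by omega), br_smul4] at hw
    · have a1 := h.pos_pair (n - 2) n (by omega) (by omega) (by omega)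
      rw [show n - 2 + 1 = n - 1 by omega] at a1
      have a2 : pos (u (n - 3)) = false := by
        have := h.pos_pair (n - 3) (n - 1) (by omega) (by omega) (by omega)
        rw [show n - 1 + 1 = n by omega, show n - 3 + 1 = n - 2 by omega, br_cycle] at this
        exact pos_of_neg (by linarith)
      have a3 : pos (v (n - 3)) = false := by
        have := hpos (n - 3) (by omega) (by omega)
        rw [show n - 3 + 1 = n - 2 by omega, br_cycle] at this
        exact pos_of_neg (by linarith)
      have a4 : pos ((-1) ^ (k + 1) * v 1) = true := by
        have := h.pos_twist (n - 2) (by omega) (by omega)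
        rw [show n - 2 + 1 = n - 1 by omega] at this
        exact pos_of_pos this
      have a5 : chi (pos (br (z (n - 2)) (z (n - 1)) (z n) (z (n + 1))))
          (pos ((-1) ^ (k + 1) * br (z (n - 2)) (z (n - 1)) (z n) (z 1))) =
          chi (pos (u 1)) (pos (v 1)) := by
        rw [pos_of_pos a1, ← a4, chi_comm, pos_mul (by simp) (hu0 1 le_rfl (by omega)),
          pos_mul (by simp) (hv0 1 le_rfl (by omega))]
        generalize pos ((-1 : ℝ) ^ (k + 1)) = t
        cases t <;> cases pos (v 1) <;> cases pos (u 1) <;> rfl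
      rw [a5] at hw
      rw [a2, a3, chi_self] at hT
      omega
    · intro q h1 h2
      rw [wrap_add h1, br_smul4]

end Delete

section Cut

variable {i m k : ℕ} {z : ℕ → Fin 4 → ℝ}

/-- The chord with tail `i` and head `i + m` is admissible for cutting `z 1, …, z (i + m + 2)`:
the point where the line through the last three vectors' edge meets the hyperplanes behaves as a
new marker. -/
structure Cuttable (i m : ℕ) (z : ℕ → Fin 4 → ℝ) : Prop where
  one_le : 1 ≤ i
  two_le : 2 ≤ m
  neg : br (z i) (z (i + 1)) (z (i + m)) (z (i + m + 2)) < 0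
  pos_of_ne : ∀ p, 1 ≤ p → p + 2 ≤ i + m → p ≠ i →
    0 < br (z i) (z (i + 1)) (z (i + m + 1)) (z (i + m + 2)) *
        br (z p) (z (p + 1)) (z (i + m)) (z (i + m + 2)) -
      br (z i) (z (i + 1)) (z (i + m)) (z (i + m + 2)) *
        br (z p) (z (p + 1)) (z (i + m + 1)) (z (i + m + 2))

/-- The brackets of `i, i + 1, n`. -/
def edgeBr (i n : ℕ) (z : ℕ → Fin 4 → ℝ) (q : ℕ) : ℝ := br (z i) (z (i + 1)) (z n) (z q)

/-- The brackets of `n - 2, n - 1, n`, with `n = N + 2`. -/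
def lastBr (N : ℕ) (z : ℕ → Fin 4 → ℝ) (q : ℕ) : ℝ := br (z N) (z (N + 1)) (z (N + 2)) (z q)

lemma edgeBr_mul_lastBr (i N q q' : ℕ) (z : ℕ → Fin 4 → ℝ) :
    edgeBr i (N + 2) z q * lastBr N z q' - edgeBr i (N + 2) z q' * lastBr N z q =
      br (z i) (z (i + 1)) (z (N + 1)) (z (N + 2)) * br (z q) (z q') (z N) (z (N + 2)) -
      br (z i) (z (i + 1)) (z N) (z (N + 2)) * br (z q) (z q') (z (N + 1)) (z (N + 2)) := by
  have h := congrArg (fun x => br (z i) (z (i + 1)) (z (N + 2)) x)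
    (br_five (z q) (z q') (z N) (z (N + 1)) (z (N + 2)))
  have h0 : br (z i) (z (i + 1)) (z (N + 2)) 0 = 0 := by
    simpa using br_smul4 (z i) (z (i + 1)) (z (N + 2)) 0 0
  simp only [sub_eq_add_neg, ← neg_smul, br_add4, br_smul4, br_self34, h0] at h
  rw [br_cycle (z q') (z N), br_cycle (z q) (z N), br_swap34 _ _ _ (z N),
    br_swap34 _ _ _ (z (N + 1))] at h
  simp only [edgeBr, lastBr]
  linear_combination -h

lemma pos_eq_of_mul_pos {x y : ℝ} (h : 0 < x * y) : pos x = pos y := by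
  rcases pos_and_pos_or_neg_and_neg_of_mul_pos h with ⟨h1, h2⟩ | ⟨h1, h2⟩
  · rw [pos_of_pos h1, pos_of_pos h2]
  · rw [pos_of_neg h1, pos_of_neg h2]

lemma Cuttable.lastBr_left (hc : Cuttable i m z) (h : Cls (i + m + 2) k z)
    (hg : Generic (i + m + 2) z) :
    flips (lastBr (i + m) z) 1 i = flips (edgeBr i (i + m + 2) z) 1 (i - 1) := by
  obtain ⟨hi, hm, hneg, hpos⟩ := hc
  rcases hi.eq_or_lt with rfl | hi2
  · simp [flips]
  set u := edgeBr i (i + m + 2) z with hu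
  set v := lastBr (i + m) z with hv
  have hu0 : ∀ q, 1 ≤ q → q < i → u q ≠ 0 := fun q h1 h2 => by
    apply hg <;> first | exact Finset.mem_Icc.2 ⟨by omega, by omega⟩ | omega
  have hv0 : ∀ q, 1 ≤ q → q < i → v q ≠ 0 := fun q h1 h2 => by
    apply hg <;> first | exact Finset.mem_Icc.2 ⟨by omega, by omega⟩ | omega
  have hT := flips_compare (u := u) (v := v) (a := 1) (b := i - 1) (by omega)
    (fun q h1 h2 => hu0 q h1 (by omega)) (fun q h1 h2 => hv0 q h1 (by omega)) (fun q h1 h2 => by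
      rw [hu, hv, edgeBr_mul_lastBr]
      exact (hpos q h1 (by omega) (by omega)).le)
  have e1 : pos (u 1) = pos (v 1) := by
    apply pos_eq_of_mul_pos
    have a1 := h.pos_twist i hi2 (by omega)
    have a2 := h.pos_twist (i + m) (by omega) (by omega)
    have := mul_pos a1 a2
    have hs := neg_one_pow_mul_self (k + 1)
    calc (0:ℝ) < _ := this
      _ = ((-1) ^ (k + 1) * (-1) ^ (k + 1)) * (u 1 * v 1) := by
        simp only [hu, hv, edgeBr, lastBr]; ring
      _ = _ := by rw [hs, one_mul]
  have e2 : pos (u (i - 1)) = pos (v i) := by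
    apply pos_eq_of_mul_pos
    have a1 := edgeBr_mul_lastBr i (i + m) (i - 1) i z
    have a2 := hpos (i - 1) (by omega) (by omega) (by omega)
    rw [show i - 1 + 1 = i by omega, ← a1] at a2
    have : edgeBr i (i + m + 2) z i = 0 := by simp [edgeBr]
    rwa [this, zero_mul, sub_zero] at a2
  rw [flips_add v (by omega : 1 ≤ i - 1) (by omega : i - 1 ≤ i)]
  have := flips_succ v (i - 1)
  rw [show i - 1 + 1 = i by omega] at this
  rw [this]
  rw [e1, chi_self, e2, chi_comm] at hT
  omega

lemma Cuttable.pos_edgeBr (hc : Cuttable i m z) (h : Cls (i + m + 2) k z) :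
    pos (edgeBr i (i + m + 2) z (i + 2)) = !pos (lastBr (i + m) z (i + 1)) := by
  obtain ⟨hi, hm, hneg, hpos⟩ := hc
  rcases hm.eq_or_lt with rfl | hm
  · have h1 : 0 < edgeBr i (i + 2 + 2) z (i + 2) := by
      rw [edgeBr, br_swap34]; linarith
    have h2 : lastBr (i + 2) z (i + 1) < 0 := by
      have := h.pos_pair (i + 1) (i + 3) (by omega) (by omega) (by omega)
      rw [lastBr, show br (z (i + 2)) (z (i + 2 + 1)) (z (i + 2 + 2)) (z (i + 1)) =
        -br (z (i + 1)) (z (i + 2)) (z (i + 2 + 1)) (z (i + 2 + 2)) by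
          rw [br_cycle (z (i + 1))]; ring]
      linarith
    rw [pos_of_pos h1, pos_of_neg h2]; rfl
  · have a1 := edgeBr_mul_lastBr i (i + m) (i + 1) (i + 2) z
    have a2 := hpos (i + 1) (by omega) (by omega) (by omega)
    rw [show i + 1 + 1 = i + 2 by ring, ← a1] at a2
    have : edgeBr i (i + m + 2) z (i + 1) = 0 := by simp [edgeBr]
    rw [this, zero_mul, zero_sub, ← mul_neg] at a2
    have := pos_eq_of_mul_pos a2
    rw [this, pos_neg]
    rintro h0
    rw [h0] at a2
    simp at a2

lemma Cuttable.lastBr_right (hc : Cuttable i m z) (h : Cls (i + m + 2) k z)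
    (hg : Generic (i + m + 2) z) :
    flips (lastBr (i + m) z) (i + 1) (i + m - 1) =
      flips (edgeBr i (i + m + 2) z) (i + 2) (i + m) := by
  have hc' := hc.pos_edgeBr h
  obtain ⟨hi, hm, hneg, hpos⟩ := hc
  rcases hm.eq_or_lt with rfl | hm
  · simp [flips]
  set u := edgeBr i (i + m + 2) z with hu
  set v := lastBr (i + m) z with hv
  have hu0 : ∀ q, i + 2 ≤ q → q < i + m → u q ≠ 0 := fun q h1 h2 => by
    apply hg <;> first | exact Finset.mem_Icc.2 ⟨by omega, by omega⟩ | omega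
  have hv0 : ∀ q, i + 2 ≤ q → q < i + m → v q ≠ 0 := fun q h1 h2 => by
    apply hg <;> first | exact Finset.mem_Icc.2 ⟨by omega, by omega⟩ | omega
  have hT := flips_compare (u := u) (v := v) (a := i + 2) (b := i + m - 1) (by omega)
    (fun q h1 h2 => hu0 q h1 (by omega)) (fun q h1 h2 => hv0 q h1 (by omega)) (fun q h1 h2 => by
      rw [hu, hv, edgeBr_mul_lastBr]
      exact (hpos q (by omega) (by omega) (by omega)).le)
  have e1 : pos (v (i + m - 1)) = false := by
    have := h.pos_pair (i + m - 1) (i + m + 1) (by omega) (by omega) (by omega)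
    rw [br_cycle, show i + m - 1 + 1 = i + m by omega] at this
    exact pos_of_neg (neg_pos.1 this)
  have e2 : pos (u (i + m)) = true := by
    apply pos_of_pos
    rw [hu, edgeBr, br_swap34]; linarith
  rw [flips_add v (by omega : i + 1 ≤ i + 2) (by omega), flips_succ v (i + 1),
    flips_add u (by omega : i + 2 ≤ i + m - 1) (by omega)]
  have := flips_succ u (i + m - 1)
  rw [show i + m - 1 + 1 = i + m by omega] at this
  rw [this, e2, show i + 1 + 1 = i + 2 by ring]
  rw [hc', e1] at hT
  revert hT
  cases pos (v (i + 1)) <;> cases pos (v (i + 2)) <;> cases pos (u (i + m - 1)) <;>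
    simp [chi] <;> omega

lemma Cuttable.count_last (hc : Cuttable i m z) (h : Cls (i + m + 2) k z)
    (hg : Generic (i + m + 2) z) :
    k = flips (edgeBr i (i + m + 2) z) 1 (i - 1) +
      chi (pos (lastBr (i + m) z i)) (pos (lastBr (i + m) z (i + 1))) +
      flips (edgeBr i (i + m + 2) z) (i + 2) (i + m) := by
  have := h.count
  change flips (lastBr (i + m) z) 1 (i + m - 1) = k at this
  rw [← hc.lastBr_left h hg, ← hc.lastBr_right h hg, ← flips_succ, ← this]
  have := hc.one_le
  have := hc.two_le
  rw [← flips_add _ (by omega) (by omega), ← flips_add _ (by omega) (by omega)]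

end Cut

section Count

variable {i m k : ℕ} {z : ℕ → Fin 4 → ℝ}

/-- The brackets of `i, i + 1, i + 2`. -/
def stepBr (i : ℕ) (z : ℕ → Fin 4 → ℝ) (q : ℕ) : ℝ := br (z i) (z (i + 1)) (z (i + 2)) (z q)

lemma stepBr_mul_edgeBr (i n q q' : ℕ) (z : ℕ → Fin 4 → ℝ) :
    stepBr i z q * edgeBr i n z q' - stepBr i z q' * edgeBr i n z q =
      stepBr i z n * br (z i) (z (i + 1)) (z q) (z q') := br_pencil ..

lemma Cuttable.flips_stepBr_right (hc : Cuttable i m z) (h : Cls (i + m + 2) k z)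
    (hg : Generic (i + m + 2) z) :
    flips (stepBr i z) (i + 3) (i + m + 2) =
      flips (edgeBr i (i + m + 2) z) (i + 2) (i + m) + 1 := by
  have hi := hc.one_le
  have hm := hc.two_le
  set u := stepBr i z with hu
  set v := edgeBr i (i + m + 2) z with hv
  have hu0 : ∀ q, i + 3 ≤ q → q ≤ i + m + 2 → u q ≠ 0 := fun q h1 h2 => by
    apply hg <;> first | exact Finset.mem_Icc.2 ⟨by omega, by omega⟩ | omega
  have hv0 : ∀ q, i + 2 ≤ q → q < i + m + 2 → v q ≠ 0 := fun q h1 h2 => by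
    apply hg <;> first | exact Finset.mem_Icc.2 ⟨by omega, by omega⟩ | omega
  have hun : u (i + m + 2) = -v (i + 2) := by simp only [hu, hv, stepBr, edgeBr]; rw [br_swap34]
  have h1 : pos (u (i + 3)) = true :=
    pos_of_pos (h.pos_pair i (i + 2) hi (by omega) (by omega))
  have h2 : pos (v (i + m)) = true := by
    have := hc.neg
    apply pos_of_pos
    rw [hv, edgeBr, br_swap34]; linarith
  have h3 : pos (v (i + m + 1)) = false := by
    have := h.pos_pair i (i + m + 1) hi (by omega) (by omega)
    rw [br_swap34] at this
    exact pos_of_neg (neg_pos.1 this)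
  have hpair : ∀ q, i + 3 ≤ q → q + 1 ≤ i + m + 1 → 0 < br (z i) (z (i + 1)) (z q) (z (q + 1)) :=
    fun q h1 h2 => h.pos_pair i q hi (by omega) (by omega)
  have e1 : flips v (i + 2) (i + m) + 1 = chi (pos (v (i + 2))) (pos (v (i + 3))) +
      flips v (i + 3) (i + m + 1) := by
    rw [← flips_succ, ← flips_add v (by omega) (by omega), flips_add v (by omega : i + 2 ≤ i + m)
      (by omega : i + m ≤ i + m + 1), flips_succ, h2, h3]
    rfl
  rw [e1, flips_add u (by omega : i + 3 ≤ i + m + 1) (by omega), flips_succ, hun,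
    pos_neg (hv0 _ le_rfl (by omega))]
  rcases lt_or_gt_of_ne (hv0 _ le_rfl (by omega)) with hs | hs
  · have hT := flips_compare (u := u) (v := v) (a := i + 3) (b := i + m + 1) (by omega)
      (fun q h1 h2 => hu0 q h1 (by omega)) (fun q h1 h2 => hv0 q (by omega) (by omega))
      (fun q h1 h2 => by
        rw [hu, hv, stepBr_mul_edgeBr, ← hu, hun]
        exact (mul_pos (by linarith) (hpair q h1 h2)).le)
    rw [h1, h3] at hT
    rw [pos_of_neg hs]
    revert hT
    cases pos (v (i + 3)) <;> cases pos (u (i + m + 1)) <;> simp [chi] <;> omega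
  · have hT := flips_compare (u := v) (v := u) (a := i + 3) (b := i + m + 1) (by omega)
      (fun q h1 h2 => hv0 q (by omega) (by omega)) (fun q h1 h2 => hu0 q h1 (by omega))
      (fun q h1 h2 => by
        have := stepBr_mul_edgeBr i (i + m + 2) q (q + 1) z
        rw [← hu, ← hv, hun] at this
        nlinarith [mul_pos hs (hpair q h1 h2)])
    rw [h1, h3] at hT
    rw [pos_of_pos hs]
    revert hT
    cases pos (v (i + 3)) <;> cases pos (u (i + m + 1)) <;> simp [chi] <;> omega

lemma Cuttable.flips_stepBr_left (hc : Cuttable i m z) (h : Cls (i + m + 2) k z)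
    (hg : Generic (i + m + 2) z) (hi : 2 ≤ i) :
    chi (pos (stepBr i z (i + m + 2))) (pos ((-1) ^ (k + 1) * stepBr i z 1)) +
        flips (stepBr i z) 1 (i - 1) =
      flips (edgeBr i (i + m + 2) z) 1 (i - 1) +
        chi (pos (edgeBr i (i + m + 2) z (i + 2))) (pos (edgeBr i (i + m + 2) z (i - 1))) := by
  have hm := hc.two_le
  set u := stepBr i z with hu
  set v := edgeBr i (i + m + 2) z with hv
  have hu0 : ∀ q, 1 ≤ q → q < i → u q ≠ 0 := fun q h1 h2 => by
    apply hg <;> first | exact Finset.mem_Icc.2 ⟨by omega, by omega⟩ | omega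
  have hv0 : ∀ q, 1 ≤ q → q < i ∨ q = i + 2 → v q ≠ 0 := fun q h1 h2 => by
    apply hg <;> first | exact Finset.mem_Icc.2 ⟨by omega, by omega⟩ | omega
  have hun : u (i + m + 2) = -v (i + 2) := by simp only [hu, hv, stepBr, edgeBr]; rw [br_swap34]
  have h1 : pos ((-1) ^ (k + 1) * v 1) = true :=
    pos_of_pos (h.pos_twist i hi (by omega))
  have h2 : pos (u (i - 1)) = false := by
    have := h.pos_pair (i - 1) (i + 1) (by omega) (by omega) (by omega)
    rw [br_cycle, show i - 1 + 1 = i by omega] at this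
    exact pos_of_neg (neg_pos.1 this)
  have hpair : ∀ q, 1 ≤ q → q + 1 ≤ i - 1 → 0 < br (z i) (z (i + 1)) (z q) (z (q + 1)) :=
    fun q h1 h2 => by rw [br_pair]; exact h.pos_pair q i h1 (by omega) (by omega)
  have hs : ((-1 : ℝ) ^ (k + 1)) ≠ 0 := by simp
  rw [pos_mul hs (hv0 1 le_rfl (by omega))] at h1
  rw [hun, pos_neg (hv0 _ (by omega) (by omega)), pos_mul hs (hu0 1 le_rfl (by omega))]
  rcases lt_or_gt_of_ne (hv0 (i + 2) (by omega) (by omega)) with hs | hs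
  · have hT := flips_compare (u := u) (v := v) (a := 1) (b := i - 1) (by omega)
      (fun q h1 h2 => hu0 q h1 (by omega)) (fun q h1 h2 => hv0 q (by omega) (by omega))
      (fun q h1 h2 => by
        rw [hu, hv, stepBr_mul_edgeBr, ← hu, hun]
        exact (mul_pos (by linarith) (hpair q h1 h2)).le)
    rw [h2] at hT
    rw [pos_of_neg hs]
    revert hT h1
    generalize pos ((-1) ^ (k + 1)) = s
    cases s <;> cases pos (u 1) <;> cases pos (v 1) <;> cases pos (v (i - 1)) <;>
      simp [chi] <;> omega
  · have hT := flips_compare (u := v) (v := u) (a := 1) (b := i - 1) (by omega)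
      (fun q h1 h2 => hv0 q (by omega) (by omega)) (fun q h1 h2 => hu0 q h1 (by omega))
      (fun q h1 h2 => by
        have := stepBr_mul_edgeBr i (i + m + 2) q (q + 1) z
        rw [← hu, ← hv, hun] at this
        nlinarith [mul_pos hs (hpair q h1 h2)])
    rw [h2] at hT
    rw [pos_of_pos hs]
    revert hT h1
    generalize pos ((-1) ^ (k + 1)) = s
    cases s <;> cases pos (u 1) <;> cases pos (v 1) <;> cases pos (v (i - 1)) <;>
      simp [chi] <;> omega

lemma Cuttable.count_step (hc : Cuttable i m z) (h : Cls (i + m + 2) k z)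
    (hg : Generic (i + m + 2) z) :
    k = flips (edgeBr i (i + m + 2) z) 1 (i - 1) +
      (flips (edgeBr i (i + m + 2) z) (i + 2) (i + m) + 1) +
      if 2 ≤ i then
        chi (pos (edgeBr i (i + m + 2) z (i + 2))) (pos (edgeBr i (i + m + 2) z (i - 1)))
      else 0 := by
  have hi := hc.one_le
  have hm := hc.two_le
  have hw := h.wflips_eq hg hi (by omega) (by omega)
  have e0 : ∀ q, q ≤ i + m + 2 → br (wrap (i + m + 2) k z i) (wrap (i + m + 2) k z (i + 1))
      (wrap (i + m + 2) k z (i + 2)) (wrap (i + m + 2) k z q) = stepBr i z q := fun q hq => by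
    rw [wrap_of_le hq, wrap_of_le (by omega), wrap_of_le (by omega), wrap_of_le (by omega)]; rfl
  have e1 : ∀ q, 1 ≤ q → br (wrap (i + m + 2) k z i) (wrap (i + m + 2) k z (i + 1))
      (wrap (i + m + 2) k z (i + 2)) (wrap (i + m + 2) k z (q + (i + m + 2))) =
      (-1) ^ (k + 1) * stepBr i z q := fun q hq => by
    rw [wrap_add hq, wrap_of_le (by omega), wrap_of_le (by omega), wrap_of_le (by omega),
      br_smul4]; rfl
  have eR := hc.flips_stepBr_right h hg
  rw [wflips] at hw
  set f := fun q => br (wrap (i + m + 2) k z i) (wrap (i + m + 2) k z (i + 1))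
      (wrap (i + m + 2) k z (i + 2)) (wrap (i + m + 2) k z q) with hf
  have eR' : flips f (i + 3) (i + m + 2) = flips (stepBr i z) (i + 3) (i + m + 2) :=
    flips_congr 0 rfl fun q h1 h2 => by rw [add_zero]; simp only [hf]; rw [e0 q h2]
  split_ifs with hi2
  · have eL := hc.flips_stepBr_left h hg hi2
    have hu0 : ∀ q, 1 ≤ q → q ≤ i - 1 → stepBr i z q ≠ 0 := fun q h1 h2 => by
      apply hg <;> first | exact Finset.mem_Icc.2 ⟨by omega, by omega⟩ | omega
    have eL' : flips f (1 + (i + m + 2)) (i - 1 + (i + m + 2)) = flips (stepBr i z) 1 (i - 1) := by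
      rw [← flips_mul (c := (-1) ^ (k + 1)) (by simp) hu0]
      exact flips_congr _ rfl fun q h1 h2 => by simp only [hf]; rw [e1 q h1]
    rw [flips_add f (by omega : i + 3 ≤ i + m + 2) (by omega),
      flips_add f (by omega : i + m + 2 ≤ i + m + 2 + 1) (by omega), flips_succ,
      show i + (i + m + 2) - 1 = i - 1 + (i + m + 2) by omega, add_comm (i + m + 2) 1, eL', eR',
      eR, show f (i + m + 2) = _ from e0 _ le_rfl, show f (1 + (i + m + 2)) = _ from e1 1 le_rfl]
      at hw
    omega
  · have : i + (i + m + 2) - 1 = i + m + 2 := by omega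
    rw [this, eR', eR] at hw
    have : flips (edgeBr i (i + m + 2) z) 1 (i - 1) = 0 := by
      obtain rfl : i = 1 := by omega
      exact flips_self _ _
    omega

lemma Cuttable.pos_edgeBr_pred (hc : Cuttable i m z) (hi : 2 ≤ i) :
    pos (edgeBr i (i + m + 2) z (i - 1)) = pos (lastBr (i + m) z i) := by
  apply pos_eq_of_mul_pos
  have hm := hc.two_le
  have a1 := edgeBr_mul_lastBr i (i + m) (i - 1) i z
  have a2 := hc.pos_of_ne (i - 1) (by omega) (by omega) (by omega)
  rw [show i - 1 + 1 = i by omega, ← a1] at a2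
  have : edgeBr i (i + m + 2) z i = 0 := by simp [edgeBr]
  rwa [this, zero_mul, sub_zero] at a2

lemma Cuttable.count (hc : Cuttable i m z) (h : Cls (i + m + 2) k z)
    (hg : Generic (i + m + 2) z) :
    k = flips (edgeBr i (i + m + 2) z) 1 (i - 1) +
      (flips (edgeBr i (i + m + 2) z) (i + 2) (i + m) + 1) ∧
    pos (lastBr (i + m) z (i + 1)) = !pos (lastBr (i + m) z i) := by
  have h1 := hc.count_last h hg
  have h2 := hc.count_step h hg
  have h3 := hc.pos_edgeBr h
  split_ifs at h2 with hi
  · rw [hc.pos_edgeBr_pred hi, h3] at h2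
    revert h1 h2
    cases pos (lastBr (i + m) z i) <;> cases pos (lastBr (i + m) z (i + 1)) <;>
      simp [chi] <;> omega
  · revert h1 h2
    cases pos (lastBr (i + m) z i) <;> cases pos (lastBr (i + m) z (i + 1)) <;>
      simp [chi] <;> omega

lemma pos_of_flips {u : ℕ → ℝ} {a b : ℕ} (hab : a ≤ b) (hu : ∀ q, a ≤ q → q ≤ b → u q ≠ 0)
    (hb : 0 < u b) : 0 < (-1) ^ flips u a b * u a := by
  induction b, hab using Nat.le_induction generalizing u with
  | base => simpa [flips_self] using hb
  | succ b hab ih =>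
    rw [flips_add u hab (Nat.le_succ b), flips_succ, pos_of_pos hb]
    rcases lt_or_gt_of_ne (hu b hab (by omega)) with h | h
    · have h2 : flips (fun q => (-1) * u q) a b = flips u a b :=
        flips_mul (by norm_num) fun q h1 h2 => hu q h1 (by omega)
      have h3 := ih (u := fun q => (-1) * u q)
        (fun q h1 h2 => mul_ne_zero (by norm_num) (hu q h1 (by omega))) (by linarith)
      rw [h2] at h3
      rw [pos_of_neg h, show chi false true = 1 from rfl, pow_succ]
      linarith
    · rw [pos_of_pos h, chi_self, add_zero]
      exact ih (fun q h1 h2 => hu q h1 (by omega)) h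

end Count

lemma Cuttable.lastBr_sign {i m k : ℕ} {z : ℕ → Fin 4 → ℝ} (hc : Cuttable i m z)
    (h : Cls (i + m + 2) k z) (hg : Generic (i + m + 2) z) :
    0 < (-1) ^ flips (edgeBr i (i + m + 2) z) (i + 2) (i + m) * lastBr (i + m) z i ∧
      0 < (-1) ^ flips (edgeBr i (i + m + 2) z) (i + 2) (i + m) * -lastBr (i + m) z (i + 1) := by
  have hi := hc.one_le
  have hm := hc.two_le
  have h1 : 0 < (-1) ^ flips (edgeBr i (i + m + 2) z) (i + 2) (i + m) *
      edgeBr i (i + m + 2) z (i + 2) :=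
    pos_of_flips (by omega) (fun q h1 h2 => by
      apply hg <;> first | exact Finset.mem_Icc.2 ⟨by omega, by omega⟩ | omega) (by
      have := hc.neg
      rw [edgeBr, br_swap34]; linarith)
  have h2 := hc.pos_edgeBr h
  have h4 : lastBr (i + m) z i ≠ 0 := by
    apply hg <;> first | exact Finset.mem_Icc.2 ⟨by omega, by omega⟩ | omega
  have h5 : lastBr (i + m) z (i + 1) ≠ 0 := by
    apply hg <;> first | exact Finset.mem_Icc.2 ⟨by omega, by omega⟩ | omega
  rw [← pos_neg h5] at h2
  have h6 : pos (-lastBr (i + m) z (i + 1)) = pos (lastBr (i + m) z i) := by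
    rw [pos_neg h5, (hc.count h hg).2, Bool.not_not]
  have hs : ((-1 : ℝ) ^ flips (edgeBr i (i + m + 2) z) (i + 2) (i + m)) ≠ 0 := by simp
  have he : edgeBr i (i + m + 2) z (i + 2) ≠ 0 := right_ne_zero_of_mul h1.ne'
  have h7 := pos_of_pos h1
  rw [pos_mul hs he, h2] at h7
  constructor
  · rw [← pos_eq_true, pos_mul hs h4, ← h6, h7]
  · rw [← pos_eq_true, pos_mul hs (neg_ne_zero.2 h5), h7]

section CutParts

open ChordDiagram

variable {i m k l r : ℕ} {z : ℕ → Fin 4 → ℝ} {a b g d e : ℝ}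

lemma leftPart_of_le {p : ℕ} (h : p ≤ i) : leftPart i m r a b z p = z p := if_pos h

lemma leftPart_succ : leftPart i m r a b z (i + 1) = a • z i + b • z (i + 1) := by
  simp [leftPart]

lemma leftPart_last : leftPart i m r a b z (i + 2) = (-(-1) ^ r : ℝ) • z (i + m + 2) := by
  simp [leftPart]

lemma rightPart_of_le {p : ℕ} (h : p ≤ m) : rightPart i m r a b g d z p = z (p + i) := if_pos h

lemma rightPart_succ :
    rightPart i m r a b g d z (m + 1) = g • z (i + m) + d • z (i + m + 1) := by
  simp [rightPart]

lemma rightPart_last :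
    rightPart i m r a b g d z (m + 2) = (-(-1) ^ r : ℝ) • (a • z i + b • z (i + 1)) := by
  simp [rightPart]

lemma cut_relation_left
    (hC : (a • z i + b • z (i + 1)) + ((-1) ^ r : ℝ) • (g • z (i + m) + d • z (i + m + 1)) +
      ((-1) ^ r * e : ℝ) • z (i + m + 2) = 0) :
    a • z i + b • z (i + 1) =
      (-(-1) ^ r : ℝ) • (g • z (i + m) + d • z (i + m + 1) + e • z (i + m + 2)) := by
  rw [← sub_eq_zero, ← hC]
  module

lemma cut_relation_right
    (hC : (a • z i + b • z (i + 1)) + ((-1) ^ r : ℝ) • (g • z (i + m) + d • z (i + m + 1)) +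
      ((-1) ^ r * e : ℝ) • z (i + m + 2) = 0) :
    (-(-1) ^ r : ℝ) • (a • z i + b • z (i + 1)) =
      g • z (i + m) + d • z (i + m + 1) + e • z (i + m + 2) := by
  rw [cut_relation_left hC, smul_smul, neg_mul_neg, neg_one_pow_mul_self, one_smul]

lemma Cuttable.cls_left (hc : Cuttable i m z) (h : Cls (i + m + 2) k z)
    (hg : Generic (i + m + 2) z) (hb : 0 < b) (hl : 1 ≤ l)
    (hG : g = br (z i) (z (i + 1)) (z (i + m + 1)) (z (i + m + 2)))
    (hD : d = -br (z i) (z (i + 1)) (z (i + m)) (z (i + m + 2)))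
    (hk : k = l + (r + 1)) (hcount : flips (edgeBr i (i + m + 2) z) 1 (i - 1) = l)
    (hC : (a • z i + b • z (i + 1)) + ((-1) ^ r : ℝ) • (g • z (i + m) + d • z (i + m + 1)) +
      ((-1) ^ r * e : ℝ) • z (i + m + 2) = 0) :
    Cls (i + 2) l (leftPart i m r a b z) := by
  have hm := hc.two_le
  have hi : 3 ≤ i := by
    have := flips_le (edgeBr i (i + m + 2) z) 1 (i - 1)
    omega
  have hs := neg_one_pow_mul_self r
  have hsl := neg_one_pow_mul_self (l + 1)
  have hI := cut_relation_left hC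
  have hF : ∀ q, br (z i) (a • z i + b • z (i + 1)) ((-(-1) ^ r : ℝ) • z (i + m + 2)) (z q) =
      (-(-1) ^ r * b) * edgeBr i (i + m + 2) z q := fun q => by
    rw [br_add2, br_smul2, br_smul2, br_self12, br_smul3, edgeBr]; ring
  have hu0 : ∀ q, 1 ≤ q → q < i → edgeBr i (i + m + 2) z q ≠ 0 := fun q h1 h2 => by
    apply hg <;> first | exact Finset.mem_Icc.2 ⟨by omega, by omega⟩ | omega
  have hcb : (-(-1) ^ r * b) ≠ 0 := by simp [hb.ne']
  refine ⟨fun p q hp hpq hq => ?_, fun p hp hpn => ?_, fun q h1 h2 => ?_, ?_⟩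
  · rw [leftPart_of_le (by omega), leftPart_of_le (by omega)]
    obtain hq' | rfl | rfl : q + 1 ≤ i ∨ q = i ∨ q = i + 1 := by omega
    · rw [leftPart_of_le (by omega), leftPart_of_le (by omega)]
      exact h.pos_pair p q hp hpq (by omega)
    · rw [leftPart_of_le le_rfl, leftPart_succ, br_add4, br_smul4, br_smul4, br_self34, mul_zero,
        zero_add]
      exact mul_pos hb (h.pos_pair p q hp hpq (by omega))
    · rw [leftPart_succ, leftPart_last, hI, br_smul3, br_smul4, ← mul_assoc, neg_mul_neg, hs,
        one_mul, br_add3, br_add3, br_smul3, br_smul3, br_smul3, br_self34, hG, hD]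
      have := hc.pos_of_ne p hp (by omega) (by omega)
      linarith
  · have hsign : ((-1) ^ (l + 1) * -(-1) ^ r : ℝ) = (-1) ^ (k + 1) := by
      rw [hk]; ring
    have ht : ∀ p, 2 ≤ p → p ≤ i → 0 < (-1) ^ (l + 1) *
        br (z p) (z (p + 1)) ((-(-1) ^ r : ℝ) • z (i + m + 2)) (z 1) := fun p h1 h2 => by
      rw [br_smul3, ← mul_assoc, hsign]
      exact h.pos_twist p h1 (by omega)
    rw [leftPart_last, leftPart_of_le (by omega : 1 ≤ i), leftPart_of_le (by omega : p ≤ i)]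
    obtain hp' | rfl : p + 1 ≤ i ∨ p = i := by omega
    · rw [leftPart_of_le hp']
      exact ht p hp (by omega)
    · rw [leftPart_succ, br_add2, br_smul2, br_smul2, br_self12, mul_zero, zero_add]
      nlinarith [mul_pos hb (ht p hp le_rfl)]
  · rw [show i + 2 - 2 = i by omega, show i + 2 - 1 = i + 1 by omega, leftPart_of_le le_rfl,
      leftPart_succ, leftPart_last, leftPart_of_le (by omega), hF]
    exact mul_ne_zero hcb (hu0 q h1 (by omega))
  · rw [← hcount, ← flips_mul hcb (fun q h1 h2 => hu0 q h1 (by omega))]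
    rw [show i + 2 - 3 = i - 1 by omega]
    refine flips_congr (b := i - 1) 0 (by omega) fun q h1 h2 => ?_
    rw [add_zero, show i + 2 - 2 = i by omega, show i + 2 - 1 = i + 1 by omega,
      leftPart_of_le le_rfl, leftPart_succ, leftPart_last, leftPart_of_le (by omega), hF]

lemma Cuttable.cls_right (hc : Cuttable i m z) (h : Cls (i + m + 2) k z)
    (hg : Generic (i + m + 2) z) (ha : 0 < a) (he : 0 < e) (hr : 1 ≤ r)
    (hG : g = br (z i) (z (i + 1)) (z (i + m + 1)) (z (i + m + 2)))
    (hD : d = -br (z i) (z (i + 1)) (z (i + m)) (z (i + m + 2)))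
    (hcount : flips (edgeBr i (i + m + 2) z) (i + 2) (i + m) = r)
    (hC : (a • z i + b • z (i + 1)) + ((-1) ^ r : ℝ) • (g • z (i + m) + d • z (i + m + 1)) +
      ((-1) ^ r * e : ℝ) • z (i + m + 2) = 0) :
    Cls (m + 2) r (rightPart i m r a b g d z) := by
  have hi := hc.one_le
  have hd : 0 < d := by rw [hD]; have := hc.neg; linarith
  have hm : 3 ≤ m := by
    have := flips_le (edgeBr i (i + m + 2) z) (i + 2) (i + m)
    omega
  have hs := neg_one_pow_mul_self r
  have hV := cut_relation_right hC
  have hF : ∀ q, br (z (i + m)) (g • z (i + m) + d • z (i + m + 1))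
      ((-(-1) ^ r : ℝ) • (a • z i + b • z (i + 1))) (z q) = (d * e) * lastBr (i + m) z q := by
    intro q
    rw [hV]
    simp only [br_add2, br_add3, br_smul2, br_smul3, br_self12, br_self23, lastBr]
    ring
  have hu0 : ∀ q, i + 1 ≤ q → q < i + m → lastBr (i + m) z q ≠ 0 := fun q h1 h2 => by
    apply hg <;> first | exact Finset.mem_Icc.2 ⟨by omega, by omega⟩ | omega
  have hcb : d * e ≠ 0 := (mul_pos hd he).ne'
  have hz : ∀ p, p ≤ m → rightPart i m r a b g d z p = z (p + i) := fun p h => rightPart_of_le h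
  have hcomm : m + i = i + m := add_comm _ _
  refine ⟨fun p q hp hpq hq => ?_, fun p hp hpn => ?_, fun q h1 h2 => ?_, ?_⟩
  · rw [hz p (by omega)]
    obtain hq' | rfl | rfl : q + 1 ≤ m ∨ q = m ∨ q = m + 1 := by omega
    · rw [hz _ (by omega), hz _ hq', hz _ (by omega), add_right_comm, add_right_comm q]
      exact h.pos_pair (p + i) (q + i) (by omega) (by omega) (by omega)
    · rw [hz _ (by omega), hz _ le_rfl, rightPart_succ, add_right_comm, hcomm, br_add4, br_smul4,
        br_smul4, br_self34, mul_zero, zero_add]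
      exact mul_pos hd (h.pos_pair (p + i) (i + q) (by omega) (by omega) (by omega))
    · rw [rightPart_succ, rightPart_last, hV, br_add4]
      obtain hp' | rfl : p + 2 ≤ m ∨ p + 1 = m := by omega
      · rw [hz _ (by omega), br_self34, zero_add, br_smul4, br_add3, br_smul3, br_smul3, hG, hD,
          add_right_comm p]
        have := hc.pos_of_ne (p + i) (by omega) (by omega) (by omega)
        exact mul_pos he (by linarith)
      · rw [hz _ le_rfl, br_self34, zero_add, br_smul4, br_add3, br_smul3, br_smul3, hcomm,
          br_self23, mul_zero, zero_add]
        have := h.pos_pair (p + i) (i + (p + 1) + 1) (by omega) (by omega) (by omega)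
        rw [show p + i + 1 = i + (p + 1) by ring] at this
        exact mul_pos he (mul_pos hd this)
  · have hlast : rightPart i m r a b g d z (m + 2) =
        (-(-1) ^ r : ℝ) • (a • z i + b • z (i + 1)) := rightPart_last
    have hV' : ∀ x y, br x y (rightPart i m r a b g d z (m + 2)) (z (i + 1)) =
        (-(-1) ^ r) * (a * br x y (z i) (z (i + 1))) := fun x y => by
      rw [hlast, br_smul3, br_add3, br_smul3, br_smul3, br_self34, mul_zero, add_zero]
    rw [hz 1 (by omega), hz p (by omega), add_comm 1 i, hV']
    have hx : ∀ x : ℝ, (-1) ^ (r + 1) * (-(-1) ^ r * x) = x := fun x => by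
      rw [← mul_assoc, pow_succ]; linear_combination x * hs
    rw [hx]
    refine mul_pos ha ?_
    rw [br_pair]
    obtain hp' | rfl : p + 1 ≤ m ∨ p = m := by omega
    · rw [hz _ hp', add_right_comm]
      exact h.pos_pair i (p + i) hi (by omega) (by omega)
    · rw [rightPart_succ, hcomm, br_add4, br_smul4, br_smul4, br_self34, mul_zero, zero_add]
      exact mul_pos hd (h.pos_pair i (i + p) hi (by omega) (by omega))
  · rw [show m + 2 - 2 = m by omega, show m + 2 - 1 = m + 1 by omega, hz _ le_rfl,
      rightPart_succ, rightPart_last, hz _ (by omega), hcomm, hF]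
    exact mul_ne_zero hcb (hu0 _ (by omega) (by omega))
  · refine Eq.trans ?_ hcount
    rw [← hc.lastBr_right h hg, ← flips_mul hcb (fun q h1 h2 => hu0 q h1 (by omega)),
      show i + m - 1 = (m + 2 - 3) + i by omega]
    refine (flips_congr i (by omega) fun q h1 h2 => ?_).symm
    rw [show m + 2 - 2 = m by omega, show m + 2 - 1 = m + 1 by omega, hz _ le_rfl,
      rightPart_succ, rightPart_last, hz _ (by omega), hcomm, hF]

/-- Cutting a configuration along an admissible chord. -/
theorem Cuttable.exists_cut (hc : Cuttable i m z) (h : Cls (i + m + 2) k z)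
    (hg : Generic (i + m + 2) z) :
    ∃ (l r : ℕ) (a b g d e : ℝ), 0 < a ∧ 0 < b ∧ 0 < g ∧ 0 < d ∧ 0 < e ∧ k = l + (r + 1) ∧
      (a • z i + b • z (i + 1)) + ((-1) ^ r : ℝ) • (g • z (i + m) + d • z (i + m + 1)) +
        ((-1) ^ r * e : ℝ) • z (i + m + 2) = 0 ∧
      (1 ≤ l → Cls (i + 2) l (leftPart i m r a b z)) ∧
      (1 ≤ r → Cls (m + 2) r (rightPart i m r a b g d z)) := by
  have hi := hc.one_le
  have hm := hc.two_le
  obtain ⟨h1, h2⟩ := hc.lastBr_sign h hg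
  have hk := (hc.count h hg).1
  set r := flips (edgeBr i (i + m + 2) z) (i + 2) (i + m) with hr
  set l := flips (edgeBr i (i + m + 2) z) 1 (i - 1) with hl
  have hs := neg_one_pow_mul_self r
  have hC : (((-1) ^ r * -lastBr (i + m) z (i + 1) : ℝ) • z i +
      ((-1) ^ r * lastBr (i + m) z i : ℝ) • z (i + 1)) +
      ((-1) ^ r : ℝ) • (br (z i) (z (i + 1)) (z (i + m + 1)) (z (i + m + 2)) • z (i + m) +
        (-br (z i) (z (i + 1)) (z (i + m)) (z (i + m + 2))) • z (i + m + 1)) +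
      ((-1) ^ r * br (z i) (z (i + 1)) (z (i + m)) (z (i + m + 1)) : ℝ) • z (i + m + 2) = 0 := by
    have := br_five (z i) (z (i + 1)) (z (i + m)) (z (i + m + 1)) (z (i + m + 2))
    rw [br_cycle (z (i + 1)), br_cycle (z i) (z (i + m))] at this
    have h2 := congrArg (fun x => ((-1) ^ r : ℝ) • x) this
    simp only [smul_zero] at h2
    rw [← h2]
    simp only [lastBr]
    module
  have hG := h.pos_pair i (i + m + 1) hi (by omega) (by omega)
  have hE := h.pos_pair i (i + m) hi (by omega) (by omega)
  exact ⟨l, r, _, _, _, _, _, h2, h1, hG, neg_pos.2 hc.neg, hE, hk, hC,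
    fun h3 => hc.cls_left h hg h1 h3 rfl rfl hk hl.symm hC,
    fun h3 => hc.cls_right h hg h2 hE h3 rfl rfl hr.symm hC⟩

end CutParts

/-- If the vector `n - 1` cannot be deleted, then there is an admissible chord, provided that the
places where the pencils of planes spanned by `i, i + 1, n` meet the last edge differ. -/
theorem exists_cuttable {N k : ℕ} {z : ℕ → Fin 4 → ℝ} (h : Cls (N + 2) k z)
    (hw : ∀ p q, 1 ≤ p → p < q → q + 2 ≤ N →
      br (z p) (z (p + 1)) (z (N + 1)) (z (N + 2)) * br (z q) (z (q + 1)) (z N) (z (N + 2)) -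
        br (z q) (z (q + 1)) (z (N + 1)) (z (N + 2)) * br (z p) (z (p + 1)) (z N) (z (N + 2)) ≠ 0)
    (hneg : ∃ p, 1 ≤ p ∧ p + 2 ≤ N ∧ br (z p) (z (p + 1)) (z N) (z (N + 2)) < 0) :
    ∃ i m, N = i + m ∧ Cuttable i m z := by
  set G : ℕ → ℝ := fun p => br (z p) (z (p + 1)) (z (N + 1)) (z (N + 2)) with hG
  set B : ℕ → ℝ := fun p => br (z p) (z (p + 1)) (z N) (z (N + 2)) with hB
  have hGpos : ∀ p, 1 ≤ p → p + 2 ≤ N → 0 < G p := fun p h1 h2 =>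
    h.pos_pair p (N + 1) h1 (by omega) (by omega)
  obtain ⟨p₀, h1, h2, h3⟩ := hneg
  set S := (Finset.Icc 1 (N - 2)).filter fun p => B p < 0 with hS
  obtain ⟨i, hiS, hmin⟩ := S.exists_min_image (fun p => -(G p / B p))
    ⟨p₀, Finset.mem_filter.2 ⟨Finset.mem_Icc.2 ⟨h1, by omega⟩, h3⟩⟩
  rw [hS, Finset.mem_filter, Finset.mem_Icc] at hiS
  obtain ⟨⟨hi1, hi2⟩, hi3⟩ := hiS
  obtain ⟨m, rfl⟩ : ∃ m, N = i + m := ⟨N - i, by omega⟩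
  refine ⟨i, m, rfl, hi1, by omega, hi3, fun p hp1 hp2 hpi => ?_⟩
  change 0 < G i * B p - B i * G p
  have hGp := hGpos p hp1 hp2
  have hGi := hGpos i hi1 (by omega)
  by_cases hBp : B p < 0
  · have hle := hmin p (by
      rw [hS, Finset.mem_filter, Finset.mem_Icc]; exact ⟨⟨hp1, by omega⟩, hBp⟩)
    have hne : G i * B p - B i * G p ≠ 0 := by
      rcases lt_or_gt_of_ne hpi with hlt | hlt
      · have := hw p i hp1 hlt (by omega)
        change G p * B i - G i * B p ≠ 0 at this
        intro h0; apply this; linarith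
      · have := hw i p hi1 hlt hp2
        change G i * B p - G p * B i ≠ 0 at this
        intro h0; apply this; linarith
    refine lt_of_le_of_ne ?_ hne.symm
    rw [← neg_div_neg_eq, ← neg_div_neg_eq (G p), neg_le_neg_iff] at hle
    have h5 : -G p / -B p ≤ -G i / -B i := hle
    rw [div_le_div_iff₀ (by linarith) (by linarith)] at h5
    linarith
  · have : 0 ≤ B p := not_lt.1 hBp
    nlinarith [mul_nonneg hGi.le this, mul_pos (neg_pos.2 hi3) hGp]

section Generic

open Filter Topology

lemma Continuous.br {X : Type*} [TopologicalSpace X] {a b c d : X → Fin 4 → ℝ} (ha : Continuous a)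
    (hb : Continuous b) (hc : Continuous c) (hd : Continuous d) :
    Continuous fun x => _root_.br (a x) (b x) (c x) (d x) := by
  simp only [br_eq]; fun_prop

lemma analyticAt_br {a b c d : ℝ → Fin 4 → ℝ} {t : ℝ} (ha : ∀ j, AnalyticAt ℝ (a · j) t)
    (hb : ∀ j, AnalyticAt ℝ (b · j) t) (hc : ∀ j, AnalyticAt ℝ (c · j) t)
    (hd : ∀ j, AnalyticAt ℝ (d · j) t) : AnalyticAt ℝ (fun t => br (a t) (b t) (c t) (d t)) t := by
  simp only [br_eq]; fun_prop

lemma dense_ne_zero {E : Type*} [AddCommGroup E] [Module ℝ E] [TopologicalSpace E]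
    [IsTopologicalAddGroup E] [ContinuousSMul ℝ E] {f : E → ℝ}
    (hf : ∀ z u t, AnalyticAt ℝ (fun t : ℝ => f (z + t • u)) t) {u : E} (hu : f u ≠ 0) :
    Dense {z | f z ≠ 0} := by
  intro z
  set g : ℝ → ℝ := fun t => f (z + t • (u - z)) with hg
  have hga : AnalyticOnNhd ℝ g Set.univ := fun t _ => hf z (u - z) t
  have hlim : Tendsto (fun t : ℝ => z + t • (u - z)) (𝓝[≠] 0) (𝓝 z) := by
    have : Continuous fun t : ℝ => z + t • (u - z) := by fun_prop
    simpa using (this.tendsto 0).mono_left nhdsWithin_le_nhds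
  refine mem_closure_of_tendsto hlim ?_
  rcases (hga 0 trivial).eventually_eq_zero_or_eventually_ne_zero with h | h
  · have := hga.eqOn_zero_of_preconnected_of_eventuallyEq_zero isPreconnected_univ trivial h
      (Set.mem_univ 1)
    simp [hg, hu] at this
  · exact h

/-- Configurations in which all brackets are nonzero and all pencils meet a given edge at
different places. -/
structure Good (z : ℕ → Fin 4 → ℝ) : Prop where
  br_ne : ∀ a b c d, a ≠ b → a ≠ c → a ≠ d → b ≠ c → b ≠ d → c ≠ d →
    br (z a) (z b) (z c) (z d) ≠ 0
  meet_ne : ∀ N p q, p < q → q + 2 ≤ N →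
    br (z p) (z (p + 1)) (z (N + 1)) (z (N + 2)) * br (z q) (z (q + 1)) (z N) (z (N + 2)) -
      br (z q) (z (q + 1)) (z (N + 1)) (z (N + 2)) * br (z p) (z (p + 1)) (z N) (z (N + 2)) ≠ 0

lemma Good.generic {z : ℕ → Fin 4 → ℝ} (h : Good z) (n : ℕ) : Generic n z :=
  fun a b c d _ _ _ _ => h.br_ne a b c d

lemma br_single : br (Pi.single 0 1) (Pi.single 1 1) (Pi.single 2 1) (Pi.single 3 1) = 1 := by
  simp [br_eq]

lemma dense_good : Dense {z | Good z} := by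
  have h1 : Dense {z : ℕ → Fin 4 → ℝ | ∀ j : ℕ × ℕ × ℕ × ℕ, j.1 ≠ j.2.1 → j.1 ≠ j.2.2.1 →
      j.1 ≠ j.2.2.2 → j.2.1 ≠ j.2.2.1 → j.2.1 ≠ j.2.2.2 → j.2.2.1 ≠ j.2.2.2 →
      br (z j.1) (z j.2.1) (z j.2.2.1) (z j.2.2.2) ≠ 0} := by
    rw [Set.ofPred_forall]
    refine dense_iInter_of_isOpen (fun j => ?_) fun j => ?_
    · simp only [Set.ofPred_forall]
      repeat refine isOpen_iInter_of_finite fun _ => ?_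
      exact isOpen_ne_fun (Continuous.br (by fun_prop) (by fun_prop) (by fun_prop) (by fun_prop))
        continuous_const
    · obtain ⟨a, b, c, d⟩ := j
      by_cases h : a ≠ b ∧ a ≠ c ∧ a ≠ d ∧ b ≠ c ∧ b ≠ d ∧ c ≠ d
      · obtain ⟨h1, h2, h3, h4, h5, h6⟩ := h
        refine (dense_ne_zero (f := fun z : ℕ → Fin 4 → ℝ => br (z a) (z b) (z c) (z d))
          (fun z u t => ?_) (u := fun p => if p = a then Pi.single 0 1 else if p = b then
            Pi.single 1 1 else if p = c then Pi.single 2 1 else Pi.single 3 1) ?_).mono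
            fun z hz _ _ _ _ _ _ => hz
        · apply analyticAt_br <;> intro j <;> simp only [Pi.add_apply, Pi.smul_apply] <;> fun_prop
        · simp only [if_true, if_neg h1.symm, if_neg h2.symm, if_neg h3.symm, if_neg h4.symm,
            if_neg h5.symm, if_neg h6.symm, br_single]
          exact one_ne_zero
      · convert dense_univ
        rw [Set.eq_univ_iff_forall]
        intro z h1 h2 h3 h4 h5 h6
        exact absurd ⟨h1, h2, h3, h4, h5, h6⟩ h
  have h2 : Dense {z : ℕ → Fin 4 → ℝ | ∀ j : ℕ × ℕ × ℕ, j.2.1 < j.2.2 → j.2.2 + 2 ≤ j.1 →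
      br (z j.2.1) (z (j.2.1 + 1)) (z (j.1 + 1)) (z (j.1 + 2)) *
          br (z j.2.2) (z (j.2.2 + 1)) (z j.1) (z (j.1 + 2)) -
        br (z j.2.2) (z (j.2.2 + 1)) (z (j.1 + 1)) (z (j.1 + 2)) *
          br (z j.2.1) (z (j.2.1 + 1)) (z j.1) (z (j.1 + 2)) ≠ 0} := by
    rw [Set.ofPred_forall]
    refine dense_iInter_of_isOpen (fun j => ?_) fun j => ?_
    · simp only [Set.ofPred_forall]
      repeat refine isOpen_iInter_of_finite fun _ => ?_
      refine isOpen_ne_fun (Continuous.sub (Continuous.mul ?_ ?_) (Continuous.mul ?_ ?_))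
        continuous_const <;> apply Continuous.br <;> fun_prop
    · obtain ⟨N, p, q⟩ := j
      by_cases h : p < q ∧ q + 2 ≤ N
      · obtain ⟨h1, h2⟩ := h
        refine (dense_ne_zero (f := fun z : ℕ → Fin 4 → ℝ =>
          br (z p) (z (p + 1)) (z (N + 1)) (z (N + 2)) * br (z q) (z (q + 1)) (z N) (z (N + 2)) -
          br (z q) (z (q + 1)) (z (N + 1)) (z (N + 2)) * br (z p) (z (p + 1)) (z N) (z (N + 2)))
          (fun z u t => ?_) (u := fun x => if x = p ∨ x = N then Pi.single 0 1 else if x = q + 1 ∨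
            x = N + 1 then Pi.single 2 1 else if x = N + 2 then Pi.single 3 1 else Pi.single 1 1)
            ?_).mono fun z hz _ _ => hz
        · refine AnalyticAt.sub (AnalyticAt.mul ?_ ?_) (AnalyticAt.mul ?_ ?_) <;>
          apply analyticAt_br <;> intro j <;> simp only [Pi.add_apply, Pi.smul_apply] <;> fun_prop
        · simp (disch := omega) only [true_or, or_true, if_true, if_neg, br_single, br_self23]
          rw [← br_rotate, br_single]
          norm_num
      · convert dense_univ
        rw [Set.eq_univ_iff_forall]
        intro z h1 h2
        exact absurd ⟨h1, h2⟩ h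
  have h3 := h1.inter_of_Gδ ?_ ?_ h2
  · refine h3.mono fun z hz => ⟨fun a b c d => hz.1 (a, b, c, d), fun N p q => hz.2 (N, p, q)⟩
  · rw [Set.ofPred_forall]
    refine IsGδ.iInter_of_isOpen fun j => ?_
    simp only [Set.ofPred_forall]
    repeat refine isOpen_iInter_of_finite fun _ => ?_
    exact isOpen_ne_fun (Continuous.br (by fun_prop) (by fun_prop) (by fun_prop) (by fun_prop))
      continuous_const
  · rw [Set.ofPred_forall]
    refine IsGδ.iInter_of_isOpen fun j => ?_
    simp only [Set.ofPred_forall]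
    repeat refine isOpen_iInter_of_finite fun _ => ?_
    refine isOpen_ne_fun (Continuous.sub (Continuous.mul ?_ ?_) (Continuous.mul ?_ ?_))
      continuous_const <;> apply Continuous.br <;> fun_prop

lemma eventually_pos_eq {X : Type*} [TopologicalSpace X] {f : X → ℝ} (hf : Continuous f) {x : X}
    (hx : f x ≠ 0) : ∀ᶠ y in 𝓝 x, pos (f y) = pos (f x) := by
  rcases lt_or_gt_of_ne hx with h | h
  · filter_upwards [hf.continuousAt.eventually_lt continuousAt_const h] with y hy
    rw [pos_of_neg h, pos_of_neg hy]
  · filter_upwards [continuousAt_const.eventually_lt hf.continuousAt h] with y hy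
    rw [pos_of_pos h, pos_of_pos hy]

lemma eventually_br_pos {n k : ℕ} {z : ℕ → Fin 4 → ℝ}
    (hp : ∀ p q, 1 ≤ p → p + 1 < q → q + 1 ≤ n → 0 < br (z p) (z (p + 1)) (z q) (z (q + 1)))
    (ht : ∀ p, 2 ≤ p → p + 1 < n → 0 < (-1) ^ (k + 1) * br (z p) (z (p + 1)) (z n) (z 1)) :
    ∀ᶠ y : ℕ → Fin 4 → ℝ in 𝓝 z,
      (∀ p q, 1 ≤ p → p + 1 < q → q + 1 ≤ n → 0 < br (y p) (y (p + 1)) (y q) (y (q + 1))) ∧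
      ∀ p, 2 ≤ p → p + 1 < n → 0 < (-1) ^ (k + 1) * br (y p) (y (p + 1)) (y n) (y 1) := by
  have h1 : ∀ᶠ y : ℕ → Fin 4 → ℝ in 𝓝 z, ∀ p ∈ Finset.range n, ∀ q ∈ Finset.range n,
      1 ≤ p → p + 1 < q → q + 1 ≤ n → 0 < br (y p) (y (p + 1)) (y q) (y (q + 1)) := by
    simp only [Filter.eventually_all_finset, Filter.eventually_imp_distrib_left]
    intro p _ q _ h1 h2 h3
    exact continuousAt_const.eventually_lt (Continuous.br (by fun_prop) (by fun_prop)
      (by fun_prop) (by fun_prop)).continuousAt (hp p q h1 h2 h3)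
  have h2 : ∀ᶠ y : ℕ → Fin 4 → ℝ in 𝓝 z, ∀ p ∈ Finset.range n,
      2 ≤ p → p + 1 < n → 0 < (-1) ^ (k + 1) * br (y p) (y (p + 1)) (y n) (y 1) := by
    simp only [Filter.eventually_all_finset, Filter.eventually_imp_distrib_left]
    intro p _ h1 h2
    exact continuousAt_const.eventually_lt (continuous_const.mul (Continuous.br (by fun_prop)
      (by fun_prop) (by fun_prop) (by fun_prop))).continuousAt (ht p h1 h2)
  filter_upwards [h1, h2] with y h1 h2
  exact ⟨fun p q hp hpq hq => h1 p (by simp; omega) q (by simp; omega) hp hpq hq,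
    fun p hp hpn => h2 p (by simp; omega) hp hpn⟩

lemma isOpen_cls (n k : ℕ) : IsOpen {z | Cls n k z} := by
  rw [isOpen_iff_mem_nhds]
  intro z h
  have hc : ∀ q, Continuous fun y : ℕ → Fin 4 → ℝ => br (y (n - 2)) (y (n - 1)) (y n) (y q) :=
    fun q => Continuous.br (by fun_prop) (by fun_prop) (by fun_prop) (by fun_prop)
  have h3 : ∀ᶠ y : ℕ → Fin 4 → ℝ in 𝓝 z, ∀ q ∈ Finset.range n, 1 ≤ q → q + 3 ≤ n →
      br (y (n - 2)) (y (n - 1)) (y n) (y q) ≠ 0 := by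
    simp only [Filter.eventually_all_finset, Filter.eventually_imp_distrib_left]
    intro q _ h1 h2
    exact (hc q).continuousAt.eventually_ne (h.ne_zero q h1 h2)
  have h4 : ∀ᶠ y : ℕ → Fin 4 → ℝ in 𝓝 z, ∀ q ∈ Finset.range n, 1 ≤ q → q + 3 ≤ n →
      pos (br (y (n - 2)) (y (n - 1)) (y n) (y q)) =
        pos (br (z (n - 2)) (z (n - 1)) (z n) (z q)) := by
    simp only [Filter.eventually_all_finset, Filter.eventually_imp_distrib_left]
    intro q _ h1 h2
    exact eventually_pos_eq (hc q) (h.ne_zero q h1 h2)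
  filter_upwards [eventually_br_pos h.pos_pair h.pos_twist, h3, h4] with y h1 h3 h4
  refine ⟨h1.1, h1.2, fun q hq hqn => h3 q (by simp; omega) hq hqn, ?_⟩
  rw [← h.count]
  refine Finset.sum_congr rfl fun q hq => ?_
  rw [Finset.mem_Ico] at hq
  rw [h4 q (by simp; omega) (by omega) (by omega),
    h4 (q + 1) (by simp; omega) (by omega) (by omega)]

lemma Cls.mem_closure_good {n k : ℕ} {z : ℕ → Fin 4 → ℝ} (h : Cls n k z) :
    z ∈ closure {z | Cls n k z ∧ Good z} :=
  dense_good.open_subset_closure_inter (isOpen_cls n k) h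

end Generic

section Induction

open Filter Topology ChordDiagram

/-- The linear map sending the basis `r₁, …, r₄` to `t₁, …, t₄`, by Cramer's rule. -/
def frameMap (r₁ r₂ r₃ r₄ t₁ t₂ t₃ t₄ : Fin 4 → ℝ) : (Fin 4 → ℝ) →ₗ[ℝ] (Fin 4 → ℝ) where
  toFun x := (br r₁ r₂ r₃ r₄)⁻¹ • (br x r₂ r₃ r₄ • t₁ + br r₁ x r₃ r₄ • t₂ + br r₁ r₂ x r₄ • t₃ +
    br r₁ r₂ r₃ x • t₄)
  map_add' x y := by simp only [br_add1, br_add2, br_add3, br_add4]; module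
  map_smul' c x := by
    simp only [br_smul1, br_smul2, br_smul3, br_smul4, RingHom.id_apply]; module

section FrameMap

variable {r₁ r₂ r₃ r₄ : Fin 4 → ℝ} (t₁ t₂ t₃ t₄ : Fin 4 → ℝ)

lemma frameMap_one (h : br r₁ r₂ r₃ r₄ ≠ 0) : frameMap r₁ r₂ r₃ r₄ t₁ t₂ t₃ t₄ r₁ = t₁ := by
  simp [frameMap, h]

lemma frameMap_two (h : br r₁ r₂ r₃ r₄ ≠ 0) : frameMap r₁ r₂ r₃ r₄ t₁ t₂ t₃ t₄ r₂ = t₂ := by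
  simp [frameMap, h]

lemma frameMap_three (h : br r₁ r₂ r₃ r₄ ≠ 0) : frameMap r₁ r₂ r₃ r₄ t₁ t₂ t₃ t₄ r₃ = t₃ := by
  simp [frameMap, h]

lemma frameMap_four (h : br r₁ r₂ r₃ r₄ ≠ 0) : frameMap r₁ r₂ r₃ r₄ t₁ t₂ t₃ t₄ r₄ = t₄ := by
  simp [frameMap, h]

lemma frameMap_self (h : br r₁ r₂ r₃ r₄ ≠ 0) (x : Fin 4 → ℝ) :
    frameMap r₁ r₂ r₃ r₄ r₁ r₂ r₃ r₄ x = x := by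
  have h5 := br_five r₁ r₂ r₃ r₄ x
  simp only [frameMap, LinearMap.coe_mk, AddHom.coe_mk]
  rw [inv_smul_eq_iff₀ h]
  have e1 : br x r₂ r₃ r₄ = -br r₂ r₃ r₄ x := br_cycle ..
  have e2 : br r₁ x r₃ r₄ = br r₁ r₃ r₄ x := by simp only [br_eq]; ring
  have e3 : br r₁ r₂ x r₄ = -br r₁ r₂ r₄ x := br_swap34 ..
  rw [e1, e2, e3, ← sub_eq_zero, ← neg_eq_zero, ← h5]
  module

end FrameMap

/-- The configuration obtained by gluing approximations `L` and `R` of the two parts of `z`. -/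
def reglue (i m r : ℕ) (a b g d e : ℝ) (z L R : ℕ → Fin 4 → ℝ) (p : ℕ) : Fin 4 → ℝ :=
  if p ≤ i then L p
  else if p ≤ i + m then
    frameMap (R 1) (R m) (R (m + 1)) (R (m + 2)) (b⁻¹ • (L (i + 1) - a • L i)) (z (i + m))
      ((-(-1) ^ r : ℝ) • L (i + 1) + ((-1) ^ r * e : ℝ) • L (i + 2)) ((-(-1) ^ r : ℝ) • L (i + 1))
      (R (p - i))
  else if p = i + m + 1 then
    d⁻¹ • ((-(-1) ^ r : ℝ) • L (i + 1) + ((-1) ^ r * e : ℝ) • L (i + 2) - g • z (i + m))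
  else if p = i + m + 2 then (-(-1) ^ r : ℝ) • L (i + 2)
  else z p

section Reglue

variable {i m k l r : ℕ} {a b g d e : ℝ} {z L R : ℕ → Fin 4 → ℝ}

lemma hasDomino_reglue (hi : 1 ≤ i) (hm : 2 ≤ m) (ha : 0 < a) (hb : 0 < b) (hg : 0 < g)
    (hd : 0 < d) (he : 0 < e) (hL : HasDomino (i + 2) l L) (hR : HasDomino (m + 2) r R)
    (hR0 : br (R 1) (R m) (R (m + 1)) (R (m + 2)) ≠ 0)
    {x : Fin 4 → ℝ} (hL0 : br (L i) (L (i + 1)) (L (i + 2)) x ≠ 0) :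
    HasDomino (i + m + 2) (l + (r + 1)) (reglue i m r a b g d e z L R) := by
  have hs := neg_one_pow_mul_self r
  set y := reglue i m r a b g d e z L R with hy
  have y0 : ∀ p, p ≤ i → y p = L p := fun p hp => by simp [hy, reglue, hp]
  set T := frameMap (R 1) (R m) (R (m + 1)) (R (m + 2)) (b⁻¹ • (L (i + 1) - a • L i)) (z (i + m))
      ((-(-1) ^ r : ℝ) • L (i + 1) + ((-1) ^ r * e : ℝ) • L (i + 2)) ((-(-1) ^ r : ℝ) • L (i + 1))
    with hT
  have y1 : ∀ p, 1 ≤ p → p ≤ m → y (p + i) = T (R p) := fun p h1 h2 => by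
    simp only [hy, reglue]
    rw [if_neg (by omega), if_pos (by omega), Nat.add_sub_cancel]
  have y2 : y (i + m + 1) = d⁻¹ • ((-(-1) ^ r : ℝ) • L (i + 1) +
      ((-1) ^ r * e : ℝ) • L (i + 2) - g • z (i + m)) := by
    simp only [hy, reglue]
    rw [if_neg (by omega), if_neg (by omega), if_true]
  have y3 : y (i + m + 2) = (-(-1) ^ r : ℝ) • L (i + 2) := by
    simp only [hy, reglue]
    rw [if_neg (by omega), if_neg (by omega), if_neg (by omega), if_true]
  have y4 : y (i + 1) = b⁻¹ • (L (i + 1) - a • L i) := by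
    rw [add_comm i 1, y1 1 le_rfl (by omega), add_comm 1 i, hT]
    exact frameMap_one _ _ _ _ hR0
  have y5 : y (i + m) = z (i + m) := by
    rw [add_comm, y1 m (by omega) le_rfl, add_comm]
    exact frameMap_two _ _ _ _ hR0
  have hI : a • y i + b • y (i + 1) = L (i + 1) := by
    rw [y0 i le_rfl, y4, smul_inv_smul₀ hb.ne']; abel
  have hJ : g • y (i + m) + d • y (i + m + 1) =
      (-(-1) ^ r : ℝ) • L (i + 1) + ((-1) ^ r * e : ℝ) • L (i + 2) := by
    rw [y5, y2, smul_inv_smul₀ hd.ne']; abel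
  have hlast : (-(-1) ^ r : ℝ) • y (i + m + 2) = L (i + 2) := by
    rw [y3, smul_smul, neg_mul_neg, hs, one_smul]
  refine HasDomino.glue hi hm ha hb hg hd he (hL.congr fun p h1 h2 => ?_)
    ((hR.map T).congr fun p h1 h2 => ?_) ?_ fun _ u v w h => ?_
  · rw [leftPart]
    split_ifs with h3 h4
    · rw [y0 p h3]
    · rw [hI, h4]
    · rw [hlast, show p = i + 2 by omega]
  · rw [rightPart]
    split_ifs with h3 h4
    · rw [y1 p h1 h3]
    · rw [hJ, h4]
      rw [hT]
      exact frameMap_three _ _ _ _ hR0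
    · rw [hI, show p = m + 2 by omega]
      rw [hT]
      exact frameMap_four _ _ _ _ hR0
  · rw [hI, hJ, y3]
    have : ((-1) ^ r * e * -(-1) ^ r : ℝ) = -e := by linear_combination -e * hs
    rw [smul_smul, this, smul_add, smul_smul, smul_smul, mul_neg, hs, ← mul_assoc, hs, one_mul]
    module
  · rw [hI, hlast, y0 i le_rfl] at h
    have z0 : ∀ p q s : Fin 4 → ℝ, br 0 p q s = 0 := fun p q s => by
      simpa using br_smul1 0 p q s 0
    have e1 := congrArg (fun t => br t (L (i + 1)) (L (i + 2)) x) h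
    have e2 := congrArg (fun t => br t (L (i + 2)) (L i) x) h
    have e3 := congrArg (fun t => br t (L i) (L (i + 1)) x) h
    simp only [br_add1, br_smul1, br_self12, br_self13, z0, mul_zero, add_zero,
      zero_add] at e1 e2 e3
    rw [← br_rotate] at e2
    rw [br_rotate] at e3
    rw [br_rotate] at e3
    refine ⟨?_, ?_, ?_⟩
    · simpa [hL0] using e1
    · simpa [hL0] using e2
    · rw [← br_rotate] at e3
      simpa [hL0] using e3

lemma reglue_self (hb : 0 < b) (hd : 0 < d)
    (hC : (a • z i + b • z (i + 1)) + ((-1) ^ r : ℝ) • (g • z (i + m) + d • z (i + m + 1)) +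
      ((-1) ^ r * e : ℝ) • z (i + m + 2) = 0) (hm : 2 ≤ m)
    (h0 : br (z (i + 1)) (z (i + m)) (g • z (i + m) + d • z (i + m + 1))
      ((-(-1) ^ r : ℝ) • (a • z i + b • z (i + 1))) ≠ 0) :
    reglue i m r a b g d e z (leftPart i m r a b z) (rightPart i m r a b g d z) = z := by
  have hs := neg_one_pow_mul_self r
  have hJ : (-(-1) ^ r : ℝ) • (a • z i + b • z (i + 1)) +
      ((-1) ^ r * e : ℝ) • ((-(-1) ^ r : ℝ) • z (i + m + 2)) =
      g • z (i + m) + d • z (i + m + 1) := by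
    have : ((-1) ^ r * e * -(-1) ^ r : ℝ) = -e := by linear_combination -e * hs
    rw [cut_relation_right hC, smul_smul, this]; module
  funext p
  simp only [reglue, leftPart_succ, leftPart_last, rightPart_succ, rightPart_last, hJ]
  split_ifs with h1 h2 h3 h4
  · exact leftPart_of_le h1
  · have e1 : b⁻¹ • (a • z i + b • z (i + 1) - a • leftPart i m r a b z i) = z (i + 1) := by
      rw [leftPart_of_le le_rfl, add_sub_cancel_left, inv_smul_smul₀ hb.ne']
    rw [e1, rightPart_of_le (by omega : 1 ≤ m), rightPart_of_le le_rfl, rightPart_of_le (by omega),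
      add_comm 1 i, add_comm m i, Nat.sub_add_cancel (by omega)]
    exact frameMap_self h0 _
  · rw [add_sub_cancel_left, inv_smul_smul₀ hd.ne', h3]
  · rw [smul_smul, neg_mul_neg, hs, one_smul, h4]
  · rfl

lemma continuousAt_frameMap {X : Type*} [TopologicalSpace X]
    {r₁ r₂ r₃ r₄ t₁ t₂ t₃ t₄ y : X → Fin 4 → ℝ}
    (hr₁ : Continuous r₁) (hr₂ : Continuous r₂) (hr₃ : Continuous r₃) (hr₄ : Continuous r₄)
    (ht₁ : Continuous t₁) (ht₂ : Continuous t₂) (ht₃ : Continuous t₃) (ht₄ : Continuous t₄)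
    (hy : Continuous y) {x : X} (h : br (r₁ x) (r₂ x) (r₃ x) (r₄ x) ≠ 0) :
    ContinuousAt (fun x => frameMap (r₁ x) (r₂ x) (r₃ x) (r₄ x) (t₁ x) (t₂ x) (t₃ x) (t₄ x) (y x))
      x := by
  simp only [frameMap, LinearMap.coe_mk, AddHom.coe_mk]
  exact ((hr₁.br hr₂ hr₃ hr₄).continuousAt.inv₀ h).smul
    (((((hy.br hr₂ hr₃ hr₄).smul ht₁).add ((hr₁.br hy hr₃ hr₄).smul ht₂)).add
      ((hr₁.br hr₂ hy hr₄).smul ht₃)).add ((hr₁.br hr₂ hr₃ hy).smul ht₄)).continuousAt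

lemma continuousAt_reglue (i m r : ℕ) (a b g d e : ℝ) (z : ℕ → Fin 4 → ℝ)
    {P : (ℕ → Fin 4 → ℝ) × (ℕ → Fin 4 → ℝ)}
    (hR0 : br (P.2 1) (P.2 m) (P.2 (m + 1)) (P.2 (m + 2)) ≠ 0) :
    ContinuousAt (fun P : (ℕ → Fin 4 → ℝ) × (ℕ → Fin 4 → ℝ) =>
      reglue i m r a b g d e z P.1 P.2) P := by
  have hL : ∀ q, Continuous fun P : (ℕ → Fin 4 → ℝ) × (ℕ → Fin 4 → ℝ) => P.1 q :=
    fun q => (continuous_apply q).comp continuous_fst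
  have hR : ∀ q, Continuous fun P : (ℕ → Fin 4 → ℝ) × (ℕ → Fin 4 → ℝ) => P.2 q :=
    fun q => (continuous_apply q).comp continuous_snd
  have hJ := ((hL (i + 1)).const_smul (-(-1) ^ r : ℝ)).add
    ((hL (i + 2)).const_smul ((-1) ^ r * e : ℝ))
  rw [continuousAt_pi]
  intro p
  simp only [reglue]
  split_ifs with h1 h2 h3 h4
  · exact (hL p).continuousAt
  · exact continuousAt_frameMap (hR 1) (hR m) (hR (m + 1)) (hR (m + 2))
      (((hL (i + 1)).sub ((hL i).const_smul a)).const_smul b⁻¹) continuous_const hJ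
      ((hL (i + 1)).const_smul (-(-1) ^ r : ℝ)) (hR (p - i)) hR0
  · exact ((hJ.sub continuous_const).const_smul d⁻¹).continuousAt
  · exact ((hL (i + 2)).const_smul (-(-1) ^ r : ℝ)).continuousAt
  · exact continuousAt_const

end Reglue

lemma Cls.mem_closure_of_cuttable {i m k : ℕ} {z : ℕ → Fin 4 → ℝ} (h : Cls (i + m + 2) k z)
    (hz : Generic (i + m + 2) z) (hc : Cuttable i m z)
    (ih : ∀ n < i + m + 2, ∀ l z, (1 ≤ l → Cls n l z) → z ∈ closure {z | HasDomino n l z}) :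
    z ∈ closure {z | HasDomino (i + m + 2) k z} := by
  have hi := hc.one_le
  have hm := hc.two_le
  obtain ⟨l, r, a, b, g, d, e, ha, hb, hg, hd, he, rfl, hC, hL, hR⟩ := hc.exists_cut h hz
  have hL' := ih (i + 2) (by omega) l _ hL
  have hR' := ih (m + 2) (by omega) r _ hR
  have hs0 : (-(-1) ^ r : ℝ) ≠ 0 := by simp
  have h0 : br (z (i + 1)) (z (i + m)) (g • z (i + m) + d • z (i + m + 1))
      ((-(-1) ^ r : ℝ) • (a • z i + b • z (i + 1))) ≠ 0 := by
    rw [cut_relation_right hC]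
    simp only [br_add3, br_add4, br_smul3, br_smul4, br_self23, br_self34, mul_zero,
      zero_add]
    refine mul_ne_zero he.ne' (mul_ne_zero hd.ne' ?_)
    apply hz <;> first | exact Finset.mem_Icc.2 ⟨by omega, by omega⟩ | omega
  have h1 : br (leftPart i m r a b z i) (leftPart i m r a b z (i + 1))
      (leftPart i m r a b z (i + 2)) (z (i + m + 1)) ≠ 0 := by
    rw [leftPart_of_le le_rfl, leftPart_succ, leftPart_last, br_add2, br_smul2, br_smul2,
      br_self12, br_smul3, mul_zero, zero_add]
    refine mul_ne_zero hb.ne' (mul_ne_zero hs0 ?_)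
    apply hz <;> first | exact Finset.mem_Icc.2 ⟨by omega, by omega⟩ | omega
  have hR0 : br (rightPart i m r a b g d z 1) (rightPart i m r a b g d z m)
      (rightPart i m r a b g d z (m + 1)) (rightPart i m r a b g d z (m + 2)) ≠ 0 := by
    rwa [rightPart_succ, rightPart_last, rightPart_of_le le_rfl, rightPart_of_le (by omega),
      add_comm 1 i, add_comm m i]
  have hmem : (leftPart i m r a b z, rightPart i m r a b g d z) ∈
      closure ({z | HasDomino (i + 2) l z} ×ˢ {z | HasDomino (m + 2) r z}) := by
    rw [closure_prod_eq]; exact ⟨hL', hR'⟩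
  rw [mem_closure_iff_frequently] at hmem
  have hcont := continuousAt_reglue i m r a b g d e z
    (P := (leftPart i m r a b z, rightPart i m r a b g d z)) hR0
  have hlim : Tendsto (fun P : (ℕ → Fin 4 → ℝ) × (ℕ → Fin 4 → ℝ) =>
      reglue i m r a b g d e z P.1 P.2) (𝓝 (leftPart i m r a b z, rightPart i m r a b g d z))
      (𝓝 z) := by
    have := hcont.tendsto
    rwa [reglue_self hb hd hC hm h0] at this
  refine mem_closure_of_frequently_of_tendsto ?_ hlim
  have ev1 : ∀ᶠ P in 𝓝 (leftPart i m r a b z, rightPart i m r a b g d z),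
      br (P.1 i) (P.1 (i + 1)) (P.1 (i + 2)) (z (i + m + 1)) ≠ 0 :=
    (Continuous.br (by fun_prop) (by fun_prop) (by fun_prop)
      (by fun_prop)).continuousAt.eventually_ne h1
  have ev2 : ∀ᶠ P in 𝓝 (leftPart i m r a b z, rightPart i m r a b g d z),
      br (P.2 1) (P.2 m) (P.2 (m + 1)) (P.2 (m + 2)) ≠ 0 :=
    (Continuous.br (by fun_prop) (by fun_prop) (by fun_prop)
      (by fun_prop)).continuousAt.eventually_ne hR0
  refine (hmem.and_eventually (ev1.and ev2)).mono ?_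
  rintro ⟨L, R⟩ ⟨⟨hL, hR⟩, hL0, hR0⟩
  exact hasDomino_reglue hi hm ha hb hg hd he hL hR hR0 hL0

lemma Cls.mem_closure_of_delete {n k : ℕ} {z : ℕ → Fin 4 → ℝ} (hn : 1 ≤ n)
    (h : (fun p => if p < n then z p else z (n + 1)) ∈ closure {z | HasDomino n k z}) :
    z ∈ closure {z | HasDomino (n + 1) k z} := by
  set F : (ℕ → Fin 4 → ℝ) → ℕ → Fin 4 → ℝ := fun y p =>
    if p < n then y p else if p = n + 1 then y n else z p with hF
  have hFc : Continuous F := by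
    refine continuous_pi fun p => ?_
    simp only [hF]
    split_ifs <;> fun_prop
  have hFz : F (fun p => if p < n then z p else z (n + 1)) = z := by
    funext p
    simp only [hF, lt_irrefl, if_false]
    split_ifs with h1 h2
    · rfl
    · rw [h2]
    · rfl
  rw [← hFz]
  refine map_mem_closure hFc h fun y hy => ?_
  refine HasDomino.addMarker hn (HasDomino.congr hy fun p h1 h2 => ?_)
  simp only [hF]
  split_ifs with h3 h4
  · rfl
  · omega
  · rw [show p = n by omega]

/-- Configurations satisfying the sign conditions are limits of configurations annihilated by
domino matrices. -/
theorem mem_closure_hasDomino (n k : ℕ) (z : ℕ → Fin 4 → ℝ) (h : 1 ≤ k → Cls n k z) :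
    z ∈ closure {z | HasDomino n k z} := by
  induction n using Nat.strong_induction_on generalizing k z with
  | _ n ih =>
  rcases Nat.eq_zero_or_pos k with rfl | hk
  · exact subset_closure (hasDomino_zero n z)
  refine closure_minimal ?_ isClosed_closure (h hk).mem_closure_good
  rintro y ⟨hy, hgood⟩
  have hn := hy.five_le hk
  have hgen := hgood.generic n
  by_cases hneg : ∃ p, 1 ≤ p ∧ p + 4 ≤ n ∧ br (y p) (y (p + 1)) (y (n - 2)) (y n) < 0
  · obtain ⟨N, rfl⟩ : ∃ N, n = N + 2 := ⟨n - 2, by omega⟩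
    obtain ⟨p, h1, h2, h3⟩ := hneg
    obtain ⟨i, m, rfl, hc⟩ := exists_cuttable hy (fun p q _ => hgood.meet_ne N p q)
      ⟨p, h1, by omega, h3⟩
    exact hy.mem_closure_of_cuttable hgen hc ih
  · obtain ⟨n, rfl⟩ : ∃ N, n = N + 1 := ⟨n - 1, by omega⟩
    refine Cls.mem_closure_of_delete (by omega) (ih n (by omega) k _ fun _ =>
      hy.delete hgen (by omega) fun p h1 h2 => ?_)
    refine lt_of_le_of_ne (not_lt.1 fun h3 => hneg ⟨p, h1, by omega, ?_⟩) (Ne.symm ?_)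
    · rwa [show n + 1 - 2 = n - 1 by omega]
    · apply hgen <;> first | exact Finset.mem_Icc.2 ⟨by omega, by omega⟩ | omega

end Induction

section TotalPositivity

open Matrix

variable {n r : ℕ}

lemma det_submatrix_eq_cons (A : Matrix (Fin n) (Fin (r + 1)) ℝ) (f : Fin (r + 1) → Fin n)
    (i : Fin (r + 1)) : (A.submatrix f id).det = (-1) ^ (i : ℕ) *
      (Matrix.of (Fin.cons (A (f i)) fun j => A (f (i.succAbove j)))).det := by
  rw [det_succ_row _ i, det_succ_row_zero, Finset.mul_sum]
  refine Finset.sum_congr rfl fun j _ => ?_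
  have : (A.submatrix f id).submatrix i.succAbove j.succAbove =
      (Matrix.of (Fin.cons (A (f i)) fun j => A (f (i.succAbove j)))).submatrix Fin.succ
        j.succAbove := by ext; rfl
  rw [this, pow_add]
  simp only [submatrix_apply, id, of_apply, Fin.cons_zero]
  ring

lemma card_filter_lt_orderEmb {S : Finset (Fin n)} (hS : S.card = r) (i : Fin r) :
    (S.filter (· < S.orderEmbOfFin hS i)).card = i := by
  have : S.filter (· < S.orderEmbOfFin hS i) =
      (Finset.Iio i).map (S.orderEmbOfFin hS).toEmbedding := by
    ext q
    simp only [Finset.mem_filter, Finset.mem_map, Finset.mem_Iio]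
    constructor
    · rintro ⟨h1, h2⟩
      rw [← Finset.mem_coe, ← Finset.range_orderEmbOfFin S hS] at h1
      obtain ⟨j, rfl⟩ := h1
      exact ⟨j, (S.orderEmbOfFin hS).lt_iff_lt.1 h2, rfl⟩
    · rintro ⟨j, h1, rfl⟩
      exact ⟨Finset.orderEmbOfFin_mem S hS j, (S.orderEmbOfFin hS).lt_iff_lt.2 h1⟩
  rw [this, Finset.card_map, Fin.card_Iio]

lemma IsPositiveMatrix.det_cons_pos {A : Matrix (Fin n) (Fin (r + 1)) ℝ} (hA : IsPositiveMatrix A)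
    {S : Finset (Fin n)} (hS : S.card = r) {q : Fin n} (hq : q ∉ S) :
    0 < (-1) ^ (S.filter (· < q)).card *
      (Matrix.of (Fin.cons (A q) fun j => A (S.orderEmbOfFin hS j))).det := by
  have hI : (insert q S).card = r + 1 := by rw [Finset.card_insert_of_notMem hq, hS]
  set f := (insert q S).orderEmbOfFin hI with hf
  obtain ⟨i, hi⟩ : ∃ i, f i = q := by
    have : q ∈ Set.range f := by simp [hf]
    exact this
  have hc : (S.filter (· < q)).card = i := by
    rw [← card_filter_lt_orderEmb hI i, ← hf, hi, Finset.filter_insert, if_neg (lt_irrefl q)]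
  have hs : (fun j => f (i.succAbove j)) = S.orderEmbOfFin hS := by
    refine Finset.orderEmbOfFin_unique hS (fun j => ?_)
      (f.strictMono.comp (Fin.strictMono_succAbove i))
    have := Finset.orderEmbOfFin_mem (insert q S) hI (i.succAbove j)
    rw [Finset.mem_insert] at this
    refine this.resolve_left fun h => Fin.succAbove_ne i j (f.injective ?_)
    rw [hi]; exact h
  have h := hA f f.strictMono
  rw [det_submatrix_eq_cons A f i, hi] at h
  rw [hc]
  convert h using 5
  exact funext fun j => congrArg A (congrFun hs j).symm

lemma IsPositiveMatrix.eq_zero_of_signs {A : Matrix (Fin n) (Fin (r + 1)) ℝ}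
    (hA : IsPositiveMatrix A) (hn : r + 1 ≤ n) {x : Fin n → ℝ} (hx : x ᵥ* A = 0)
    (S : Finset (Fin n)) (hS : S.card ≤ r) {s : ℝ} (hs : s ≠ 0)
    (h : ∀ q ∉ S, 0 ≤ s * ((-1) ^ (S.filter (· < q)).card * x q)) : x = 0 := by
  obtain ⟨d, hd⟩ := Nat.exists_eq_add_of_le hS
  induction d generalizing S s with
  | zero =>
    have hS : S.card = r := by omega
    have hxA : ∑ q, x q • A q = 0 := by rw [← hx, Matrix.vecMul_eq_sum]
    have hz : ∀ q ∉ S, x q = 0 := by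
      set φ : (Fin (r + 1) → ℝ) → ℝ := fun y =>
        (Matrix.of (Fin.cons y fun j => A (S.orderEmbOfFin hS j))).det with hφ
      have hsum : ∑ q, x q * φ (A q) = 0 := by
        have : ∀ y, φ y = ∑ j : Fin (r + 1), y j * ((-1) ^ (j : ℕ) *
            (Matrix.of fun a b => A (S.orderEmbOfFin hS a) (j.succAbove b)).det) := fun y => by
          simp only [hφ]
          rw [det_succ_row_zero]
          refine Finset.sum_congr rfl fun j _ => ?_
          simp only [of_apply, Fin.cons_zero]
          rw [mul_comm _ (y j), mul_assoc]
          rfl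
        simp only [this, Finset.mul_sum]
        rw [Finset.sum_comm]
        refine Finset.sum_eq_zero fun j _ => ?_
        have := congrFun hxA j
        simp only [Finset.sum_apply, Pi.smul_apply, smul_eq_mul, Pi.zero_apply] at this
        simp only [← mul_assoc]
        rw [← Finset.sum_mul, ← Finset.sum_mul, this]
        simp
      have hterm : ∀ q ∈ Finset.univ, 0 ≤ s * (x q * φ (A q)) := by
        intro q _
        by_cases hq : q ∈ S
        · have : φ (A q) = 0 := by
            rw [← Finset.mem_coe, ← Finset.range_orderEmbOfFin S hS] at hq
            obtain ⟨j, rfl⟩ := hq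
            exact det_zero_of_row_eq (Fin.succ_ne_zero j).symm (by ext; rfl)
          simp [this]
        · have h1 := mul_nonneg (h q hq) (hA.det_cons_pos hS hq).le
          have h2 := neg_one_pow_mul_self (S.filter (· < q)).card
          calc (0 : ℝ) ≤ _ := h1
            _ = s * (x q * φ (A q)) := by linear_combination s * x q * φ (A q) * h2
      have hsum' : ∑ q, s * (x q * φ (A q)) = 0 := by rw [← Finset.mul_sum, hsum, mul_zero]
      intro q hq
      have h1 := (Finset.sum_eq_zero_iff_of_nonneg hterm).1 hsum' q (Finset.mem_univ q)
      have h2 : φ (A q) ≠ 0 := (mul_ne_zero_iff.1 (hA.det_cons_pos hS hq).ne').2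
      simpa [hs, h2] using h1
    obtain ⟨q, hq⟩ : ∃ q, q ∉ S := by
      by_contra! hc
      have := Finset.card_le_card (fun q _ => hc q : (Finset.univ : Finset (Fin n)) ⊆ S)
      simp at this; omega
    have h2 := (mul_ne_zero_iff.1 (hA.det_cons_pos hS hq).ne').2
    have hli := Matrix.linearIndependent_rows_of_det_ne_zero h2
    have hli' : LinearIndependent ℝ fun j => A (S.orderEmbOfFin hS j) :=
      hli.comp Fin.succ (Fin.succ_injective r)
    rw [Fintype.linearIndependent_iff] at hli'
    have h3 := hli' (fun j => x (S.orderEmbOfFin hS j)) (by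
      rw [← hxA, ← Finset.sum_subset (Finset.subset_univ S) fun q _ hq => by
        rw [hz q hq, zero_smul]]
      conv_rhs => rw [← Finset.image_orderEmbOfFin_univ S hS]
      rw [Finset.sum_image (S.orderEmbOfFin hS).injective.injOn])
    funext q
    by_cases hq : q ∈ S
    · rw [← Finset.mem_coe, ← Finset.range_orderEmbOfFin S hS] at hq
      obtain ⟨j, rfl⟩ := hq
      exact h3 j
    · exact hz q hq
  | succ d ih =>
    have hne : Sᶜ.Nonempty := by
      rw [← Finset.card_pos, Finset.card_compl, Fintype.card_fin]; omega
    set m := Sᶜ.min' hne with hm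
    have hmS : m ∉ S := Finset.mem_compl.1 (Finset.min'_mem _ hne)
    have hc : (insert m S).card = S.card + 1 := Finset.card_insert_of_notMem hmS
    refine ih (insert m S) (by omega) (neg_ne_zero.2 hs) (fun q hq => ?_) (by omega)
    rw [Finset.mem_insert, not_or] at hq
    have hmq : m < q := lt_of_le_of_ne (Finset.min'_le _ _ (Finset.mem_compl.2 hq.2)) (Ne.symm hq.1)
    rw [Finset.filter_insert, if_pos hmq, Finset.card_insert_of_notMem (by simp [hmS]), pow_succ]
    have := h q hq.2
    linarith

/-- A vector in the left kernel of a positive matrix with few sign changes vanishes. -/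
theorem IsPositiveMatrix.eq_zero_of_flips {A : Matrix (Fin n) (Fin (r + 1)) ℝ}
    (hA : IsPositiveMatrix A) (hn : r + 1 ≤ n) {x : Fin n → ℝ} (hx : x ᵥ* A = 0) {σ : ℕ → Bool}
    (hσ : ∀ q : Fin n, Fill (σ q) (x q))
    (hc : ∑ q ∈ Finset.range (n - 1), chi (σ q) (σ (q + 1)) ≤ r) : x = 0 := by
  set sg : Bool → ℝ := fun b => if b then 1 else -1 with hsg
  have hfill : ∀ b y, Fill b y → 0 ≤ sg b * y := by
    rintro (_ | _) y ⟨h1, h2⟩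
    · simpa [hsg] using h2 rfl
    · simpa [hsg] using h1 rfl
  set c : ℕ → ℕ := fun m => ∑ q ∈ Finset.range m, chi (σ q) (σ (q + 1)) with hcdef
  have hpar : ∀ m, (-1) ^ c m * sg (σ 0) = sg (σ m) := by
    intro m
    induction m with
    | zero => simp [hcdef]
    | succ m ih =>
      simp only [hcdef] at ih ⊢
      rw [Finset.sum_range_succ, pow_add, mul_right_comm, ih]
      cases h1 : σ m <;> cases h2 : σ (m + 1) <;> simp [chi, hsg]
  set S : Finset (Fin n) := Finset.univ.filter fun q => (q : ℕ) < n - 1 ∧ σ q ≠ σ (q + 1) with hS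
  have hcard : ∀ m, m ≤ n - 1 → (S.filter fun q : Fin n => (q : ℕ) < m).card = c m := by
    intro m hm
    have : c m = ((Finset.range m).filter fun q => σ q ≠ σ (q + 1)).card := by
      rw [Finset.card_filter]
      refine Finset.sum_congr rfl fun q _ => ?_
      simp [chi, ite_not]
    rw [this]
    refine Finset.card_nbij (fun q : Fin n => (q : ℕ)) (fun q hq => ?_) (fun _ _ _ _ h => Fin.ext h)
      fun q hq => ?_
    · rw [Finset.mem_coe, Finset.mem_filter] at hq
      exact Finset.mem_coe.2 <| Finset.mem_filter.2
        ⟨Finset.mem_range.2 hq.2, (Finset.mem_filter.1 hq.1).2.2⟩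
    · simp only [Finset.coe_filter, Finset.mem_range, Set.mem_ofPred_eq] at hq
      exact ⟨⟨q, by omega⟩, by simp [hS]; exact ⟨⟨by omega, hq.2⟩, hq.1⟩, rfl⟩
  refine hA.eq_zero_of_signs hn hx S ?_ (s := sg (σ 0)) (by cases σ 0 <;> simp [hsg]) fun q _ => ?_
  · have : S = S.filter fun q : Fin n => (q : ℕ) < n - 1 := by
      ext q; simp only [hS, Finset.mem_filter, Finset.mem_univ, true_and]; tauto
    rw [this, hcard _ le_rfl]
    exact hc
  · have h1 := hcard q (by omega)
    have h2 : S.filter (· < q) = S.filter fun p : Fin n => (p : ℕ) < q := by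
      ext; simp only [Finset.mem_filter, Fin.lt_def]
    rw [h2, h1, ← mul_assoc, mul_comm (sg _), hpar]
    exact hfill _ _ (hσ q)

/-- A vector in the column span of a positive matrix with many sign changes vanishes. -/
theorem IsPositiveMatrix.eq_zero_of_alternating {A : Matrix (Fin n) (Fin r) ℝ}
    (hA : IsPositiveMatrix A) {c : Fin r → ℝ} {f : Fin (r + 1) → Fin n} (hf : StrictMono f)
    {s : ℝ} (hs : s ≠ 0) (h : ∀ j : Fin (r + 1), 0 ≤ s * ((-1) ^ (j : ℕ) * (A *ᵥ c) (f j))) :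
    c = 0 := by
  set B : Matrix (Fin (r + 1)) (Fin (r + 1)) ℝ :=
    Matrix.of fun j => Fin.cons ((A *ᵥ c) (f j)) (A (f j)) with hB
  have hsub : ∀ j : Fin (r + 1), 0 < (B.submatrix j.succAbove Fin.succ).det := fun j =>
    hA (fun i => f (j.succAbove i)) (hf.comp (Fin.strictMono_succAbove j))
  have hdet : B.det = 0 := by
    refine Matrix.exists_mulVec_eq_zero_iff.1 ⟨Fin.cons (-1) c, fun h0 => ?_, ?_⟩
    · have := congrFun h0 0
      simp at this
    · ext j
      simp [hB, Matrix.mulVec, dotProduct, Fin.sum_univ_succ]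
  rw [det_succ_column_zero] at hdet
  have hterm : ∀ j ∈ (Finset.univ : Finset (Fin (r + 1))), 0 ≤ s * ((-1) ^ (j : ℕ) * B j 0 *
      (B.submatrix j.succAbove Fin.succ).det) := fun j _ => by
    rw [← mul_assoc]
    exact mul_nonneg (h j) (hsub j).le
  have hsum : ∑ j : Fin (r + 1), s * ((-1) ^ (j : ℕ) * B j 0 *
      (B.submatrix j.succAbove Fin.succ).det) = 0 := by rw [← Finset.mul_sum, hdet, mul_zero]
  have hz : ∀ j, (A *ᵥ c) (f j) = 0 := fun j => by
    have := (Finset.sum_eq_zero_iff_of_nonneg hterm).1 hsum j (Finset.mem_univ j)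
    have h0 := (hsub j).ne'
    have hB0 : B j 0 = (A *ᵥ c) (f j) := rfl
    simpa [hs, h0, hB0] using this
  refine Matrix.eq_zero_of_mulVec_eq_zero (hsub 0).ne' ?_
  ext i
  exact hz _

end TotalPositivity

section Minors

open Matrix

variable {n r : ℕ}

/-- A form of the Cauchy–Binet formula. -/
lemma factorial_mul_det_mul (M : Matrix (Fin r) (Fin n) ℝ) (N : Matrix (Fin n) (Fin r) ℝ) :
    (r.factorial : ℝ) * (M * N).det =
      ∑ f : Fin r → Fin n, (M.submatrix id f).det * (N.submatrix f id).det := by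
  have h1 : (M * N).det = ∑ f : Fin r → Fin n, (∏ i, M i (f i)) * (N.submatrix f id).det := by
    have := detRowAlternating.toMultilinearMap.map_sum (fun i (a : Fin n) => M i a • N a)
    have h2 : (fun i => ∑ a, M i a • N a) = M * N := by
      ext i j; simp [Matrix.mul_apply, Finset.sum_apply]
    rw [h2] at this
    refine Eq.trans this (Finset.sum_congr rfl fun f _ => ?_)
    exact (detRowAlternating.toMultilinearMap.map_smul_univ _ _)
  have h2 : ∀ σ : Equiv.Perm (Fin r), (M * N).det = ∑ f : Fin r → Fin n,
      (Equiv.Perm.sign σ : ℝ) * (∏ i, M i (f (σ i))) * (N.submatrix f id).det := fun σ => by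
    rw [h1, ← (Equiv.arrowCongr σ.symm (Equiv.refl (Fin n))).sum_comp]
    refine Finset.sum_congr rfl fun f _ => ?_
    have h3 : (Equiv.arrowCongr σ.symm (Equiv.refl (Fin n))) f = f ∘ σ := by
      ext i; simp
    have h4 : N.submatrix (f ∘ σ) id = (N.submatrix f id).submatrix σ id := rfl
    rw [h3, h4, det_permute]
    simp only [Function.comp_apply]
    ring
  calc (r.factorial : ℝ) * (M * N).det = ∑ σ : Equiv.Perm (Fin r), (M * N).det := by
        rw [Finset.sum_const, Finset.card_univ, Fintype.card_perm, Fintype.card_fin, nsmul_eq_mul]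
    _ = _ := by
        rw [Finset.sum_congr rfl fun σ _ => h2 σ, Finset.sum_comm]
        refine Finset.sum_congr rfl fun f _ => ?_
        rw [← Finset.sum_mul, ← det_transpose (M.submatrix id f), det_apply' (M.submatrix id f)ᵀ]
        rfl

lemma exists_strictMono_comp_perm {f : Fin r → Fin n} (hf : Function.Injective f) :
    ∃ (g : Fin r → Fin n) (σ : Equiv.Perm (Fin r)), StrictMono g ∧ f = g ∘ σ := by
  refine ⟨f ∘ Tuple.sort f, (Tuple.sort f)⁻¹, ?_, by ext; simp⟩
  exact (Tuple.monotone_sort f).strictMono_of_injective (hf.comp (Tuple.sort f).injective)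

lemma det_mul_pos {M : Matrix (Fin r) (Fin n) ℝ} {N : Matrix (Fin n) (Fin r) ℝ} {s : ℝ}
    (hN : IsPositiveMatrix N) (hM : ∀ g : Fin r → Fin n, StrictMono g →
      0 ≤ s * (M.submatrix id g).det) {f : Fin r → Fin n} (hf : Function.Injective f)
    (hs : s ≠ 0) (hMf : (M.submatrix id f).det ≠ 0) : 0 < s * (M * N).det := by
  have hterm : ∀ f : Fin r → Fin n, Function.Injective f →
      0 ≤ s * ((M.submatrix id f).det * (N.submatrix f id).det) ∧ (N.submatrix f id).det ≠ 0 := by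
    intro f hf
    obtain ⟨g, σ, hg, rfl⟩ := exists_strictMono_comp_perm hf
    have h1 : M.submatrix id (g ∘ σ) = (M.submatrix id g).submatrix id σ := rfl
    have h2 : N.submatrix (g ∘ σ) id = (N.submatrix g id).submatrix σ id := rfl
    have h3 : ((Equiv.Perm.sign σ : ℤ) : ℝ) * (Equiv.Perm.sign σ : ℤ) = 1 := by
      rw [← Int.cast_mul, ← Units.val_mul, Int.units_mul_self]; simp
    rw [h1, h2, det_permute', det_permute]
    refine ⟨?_, mul_ne_zero (by simp) (hN g hg).ne'⟩
    have := mul_nonneg (hM g hg) (hN g hg).le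
    calc (0 : ℝ) ≤ _ := this
      _ = _ := by linear_combination -s * (M.submatrix id g).det * (N.submatrix g id).det * h3
  have hall : ∀ f ∈ (Finset.univ : Finset (Fin r → Fin n)),
      0 ≤ s * ((M.submatrix id f).det * (N.submatrix f id).det) := by
    intro f _
    by_cases hf : Function.Injective f
    · exact (hterm f hf).1
    · simp only [Function.Injective, not_forall] at hf
      obtain ⟨a, b, h1, h2⟩ := hf
      have : (N.submatrix f id).det = 0 := det_zero_of_row_eq h2 (by ext; simp [h1])
      simp [this]
  have hpos : 0 < ∑ f : Fin r → Fin n, s * ((M.submatrix id f).det * (N.submatrix f id).det) := by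
    refine Finset.sum_pos' hall
      ⟨f, Finset.mem_univ f, lt_of_le_of_ne (hall f (Finset.mem_univ f)) ?_⟩
    exact (mul_ne_zero hs (mul_ne_zero hMf (hterm f hf).2)).symm
  rw [← Finset.mul_sum, ← factorial_mul_det_mul, mul_left_comm] at hpos
  exact (mul_pos_iff_of_pos_left (by positivity)).1 hpos

/-- The matrix `C` with a unit row added at the top. -/
def unitCons (p : Fin n) (C : Matrix (Fin r) (Fin n) ℝ) : Matrix (Fin (r + 1)) (Fin n) ℝ :=
  Matrix.of (Fin.cons (Pi.single p 1) C)

lemma det_unitCons_of_notMem {p : Fin n} (C : Matrix (Fin r) (Fin n) ℝ) {g : Fin (r + 1) → Fin n}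
    (h : ∀ j, g j ≠ p) : ((unitCons p C).submatrix id g).det = 0 := by
  refine det_eq_zero_of_row_eq_zero 0 fun j => ?_
  change (Pi.single p 1 : Fin n → ℝ) (g j) = 0
  simp [h j]

lemma det_unitCons (C : Matrix (Fin r) (Fin n) ℝ) {g : Fin (r + 1) → Fin n}
    (hg : Function.Injective g) (j : Fin (r + 1)) :
    ((unitCons (g j) C).submatrix id g).det =
      (-1) ^ (j : ℕ) * (C.submatrix id fun i => g (j.succAbove i)).det := by
  rw [det_succ_row_zero, Finset.sum_eq_single j]
  · have : (unitCons (g j) C).submatrix id g 0 j = 1 := by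
      change (Pi.single (g j) 1 : Fin n → ℝ) (g j) = 1
      simp
    rw [this, mul_one]
    rfl
  · intro i _ hij
    have : (unitCons (g j) C).submatrix id g 0 i = 0 := by
      change (Pi.single (g j) 1 : Fin n → ℝ) (g i) = 0
      simp [hg.ne hij]
    rw [this]; ring
  · simp

lemma unitCons_pair_nonneg {p p' : Fin n} (hp : (p' : ℕ) = p + 1) {C : Matrix (Fin r) (Fin n) ℝ}
    {s : ℝ} (hC : ∀ g : Fin r → Fin n, StrictMono g → 0 ≤ s * (C.submatrix id g).det)
    (g : Fin (r + 1 + 1) → Fin n) (hg : StrictMono g) :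
    0 ≤ s * ((unitCons p (unitCons p' C)).submatrix id g).det := by
  by_cases h1 : ∃ j, g j = p
  · obtain ⟨j, rfl⟩ := h1
    have hg' : StrictMono fun i => g (j.succAbove i) := hg.comp (Fin.strictMono_succAbove j)
    rw [det_unitCons _ hg.injective]
    by_cases h2 : ∃ i, g (j.succAbove i) = p'
    · obtain ⟨i, rfl⟩ := h2
      rw [det_unitCons _ hg'.injective]
      have hij : (i : ℕ) = j := by
        by_contra hne
        by_cases hlt : i.castSucc < j
        · have h3 : g (j.succAbove i) < g j := hg (by
            rw [Fin.succAbove_of_castSucc_lt _ _ hlt]; exact hlt)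
          rw [Fin.lt_def] at h3; omega
        · have h3 : j.castSucc < i.succ.castSucc := by
            rw [Fin.lt_def] at hlt ⊢
            simp only [Fin.val_castSucc, Fin.val_succ] at hlt ⊢
            omega
          have h4 : (⟨j + 1, by have := i.2; rw [Fin.lt_def] at hlt; simp at hlt; omega⟩ :
              Fin (r + 1 + 1)) < j.succAbove i := by
            rw [Fin.succAbove_of_le_castSucc _ _ (not_lt.1 hlt), Fin.lt_def]
            rw [Fin.lt_def] at hlt
            simp only [Fin.val_castSucc, Fin.val_succ] at hlt ⊢
            omega
          have h5 := hg h4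
          have h6 := hg (show j < (⟨j + 1, by
            have := i.2; rw [Fin.lt_def] at hlt; simp at hlt; omega⟩ : Fin (r + 1 + 1)) by
              rw [Fin.lt_def]; simp)
          rw [Fin.lt_def] at h5 h6
          omega
      rw [hij, ← mul_assoc, ← mul_assoc, mul_assoc s, neg_one_pow_mul_self, mul_one]
      exact hC _ (hg'.comp (Fin.strictMono_succAbove i))
    · push Not at h2
      rw [det_unitCons_of_notMem _ h2]; simp
  · push Not at h1
    rw [det_unitCons_of_notMem _ h1]; simp

lemma unitCons_twist_nonneg {p p' : Fin n} (hp : (p : ℕ) + 1 = n) (hp' : (p' : ℕ) = 0)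
    {C : Matrix (Fin r) (Fin n) ℝ}
    (hC : ∀ g : Fin r → Fin n, StrictMono g → 0 ≤ (C.submatrix id g).det)
    (g : Fin (r + 1 + 1) → Fin n) (hg : StrictMono g) :
    0 ≤ (-1) ^ (r + 1) * ((unitCons p (unitCons p' C)).submatrix id g).det := by
  by_cases h1 : ∃ j, g j = p
  · obtain ⟨j, rfl⟩ := h1
    have hg' : StrictMono fun i => g (j.succAbove i) := hg.comp (Fin.strictMono_succAbove j)
    rw [det_unitCons _ hg.injective]
    have hj : (j : ℕ) = r + 1 := by
      by_contra hne
      have := hg (show j < Fin.last (r + 1) by rw [Fin.lt_def, Fin.val_last]; omega)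
      rw [Fin.lt_def] at this; omega
    by_cases h2 : ∃ i, g (j.succAbove i) = p'
    · obtain ⟨i, rfl⟩ := h2
      rw [det_unitCons _ hg'.injective]
      have hi : (i : ℕ) = 0 := by
        by_contra hne
        have : g (j.succAbove ⟨0, by omega⟩) < g (j.succAbove i) :=
          hg' (show (⟨0, by omega⟩ : Fin (r + 1)) < i by rw [Fin.lt_def]; simp only; omega)
        rw [Fin.lt_def] at this; omega
      rw [hj, hi, pow_zero, one_mul, ← mul_assoc, neg_one_pow_mul_self, one_mul]
      exact hC _ (hg'.comp (Fin.strictMono_succAbove i))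
    · push Not at h2
      rw [det_unitCons_of_notMem _ h2]; simp
  · push Not at h1
    rw [det_unitCons_of_notMem _ h1]; simp

lemma det_unitCons_cons {p : Fin n} (C : Matrix (Fin r) (Fin n) ℝ) {f : Fin r → Fin n}
    (hf : Function.Injective (Fin.cons p f : Fin (r + 1) → Fin n)) :
    ((unitCons p C).submatrix id (Fin.cons p f)).det = (C.submatrix id f).det := by
  have := det_unitCons C hf 0
  simpa using this

end Minors

section TotallyNonnegative

open Matrix

variable {n r : ℕ}

lemma strictMono_update_or {g : Fin r → Fin n} (hg : StrictMono g) (a : Fin r) {i : Fin n}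
    (hi : (i : ℕ) = g a + 1 ∨ (i : ℕ) + 1 = g a) :
    StrictMono (Function.update g a i) ∨ ∃ b, b ≠ a ∧ g b = i := by
  by_cases h : ∃ b, b ≠ a ∧ g b = i
  · exact Or.inr h
  refine Or.inl fun b c hbc => ?_
  push Not at h
  have hne : ∀ b, b ≠ a → (g b : ℕ) ≠ i := fun b hb => Fin.val_ne_of_ne (h b hb)
  by_cases hb : b = a
  · subst hb
    rw [Function.update_self, Function.update_of_ne hbc.ne', Fin.lt_def]
    have h1 := hne c hbc.ne'
    have h2 := Fin.lt_def.1 (hg hbc)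
    omega
  by_cases hc : c = a
  · subst hc
    rw [Function.update_self, Function.update_of_ne hb, Fin.lt_def]
    have h1 := hne b hb
    have h2 := Fin.lt_def.1 (hg hbc)
    omega
  · rw [Function.update_of_ne hb, Function.update_of_ne hc]
    exact hg hbc

lemma strictMono_induction_adjacent {P : (Fin r → Fin n) → Prop}
    (hP : ∀ (g : Fin r → Fin n) (a : Fin r) (i : Fin n), StrictMono g →
      ((i : ℕ) = g a + 1 ∨ (i : ℕ) + 1 = g a) → StrictMono (Function.update g a i) →
      P (Function.update g a i) → P g)
    {g₀ : Fin r → Fin n} (hg₀ : StrictMono g₀) (h₀ : P g₀) {g : Fin r → Fin n}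
    (hg : StrictMono g) : P g := by
  have hrn : r ≤ n := by simpa using Fintype.card_le_of_injective g hg.injective
  have key : ∀ (N : ℕ) (g : Fin r → Fin n), StrictMono g → ∑ a, (g a : ℕ) = N →
      (P g ↔ P (Fin.castLE hrn)) := by
    intro N
    induction N using Nat.strong_induction_on with
    | _ N ih =>
    intro g hg hN
    have hle : ∀ (m : ℕ) (hm : m < r), m ≤ g ⟨m, hm⟩ := by
      intro m
      induction m with
      | zero => intro _; omega
      | succ m ihm =>
        intro hm
        have h1 := ihm (by omega)
        have h2 := Fin.lt_def.1
          (hg (show (⟨m, by omega⟩ : Fin r) < ⟨m + 1, hm⟩ by simp [Fin.lt_def]))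
        omega
    by_cases hall : ∀ m (hm : m < r), (g ⟨m, hm⟩ : ℕ) = m
    · have : g = Fin.castLE hrn := by
        ext a; simpa using hall a a.2
      rw [this]
    · have hex : ∃ m, ∃ hm : m < r, (g ⟨m, hm⟩ : ℕ) ≠ m := by push Not at hall; exact hall
      obtain ⟨hm, hne⟩ := Nat.find_spec hex
      have hmin := fun j hj => Nat.find_min hex (m := j) hj
      set m := Nat.find hex
      set a : Fin r := ⟨m, hm⟩ with ha
      have hgt : m < g a := lt_of_le_of_ne (hle m hm) (Ne.symm hne)
      set i : Fin n := ⟨g a - 1, by have := (g a).2; omega⟩ with hi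
      have hia : (i : ℕ) + 1 = g a := by rw [hi]; simp only; omega
      have hmono : StrictMono (Function.update g a i) := by
        refine (strictMono_update_or hg a (Or.inr hia)).resolve_right ?_
        rintro ⟨b, hb, hbi⟩
        have h1 : b < a := by
          rcases lt_or_gt_of_ne hb with h | h
          · exact h
          · have := Fin.lt_def.1 (hg h)
            rw [hbi] at this; omega
        have h2 := hmin b (Fin.lt_def.1 h1)
        push Not at h2
        have h3 := h2 b.2
        simp only [Fin.eta] at h3
        have h4 := Fin.lt_def.1 h1
        rw [hbi] at h3
        simp only [ha] at h4
        omega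
      have hsum : ∑ b, (Function.update g a i b : ℕ) < N := by
        rw [← hN]
        refine Finset.sum_lt_sum (fun b _ => ?_) ⟨a, Finset.mem_univ a, ?_⟩
        · by_cases hb : b = a
          · subst hb; rw [Function.update_self]; omega
          · rw [Function.update_of_ne hb]
        · rw [Function.update_self]; omega
      rw [← ih _ hsum _ hmono rfl]
      refine ⟨fun h => ?_, hP g a i hg (Or.inr hia) hmono⟩
      refine hP (Function.update g a i) a (g a) hmono ?_ ?_ ?_
      · rw [Function.update_self]; left; exact hia.symm
      · simpa using hg
      · simpa using h
  exact (key _ g hg rfl).2 ((key _ g₀ hg₀ rfl).1 h₀)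

lemma det_updateRow_submatrix (A : Matrix (Fin n) (Fin r) ℝ) {g : Fin r → Fin n}
    (hg : Function.Injective g) (a : Fin r) (i : Fin n) (t : ℝ) :
    ((A.updateRow (g a) (A (g a) + t • A i)).submatrix g id).det =
      (A.submatrix g id).det + t * (A.submatrix (Function.update g a i) id).det := by
  have h1 : (A.updateRow (g a) (A (g a) + t • A i)).submatrix g id =
      (A.submatrix g id).updateRow a (A (g a) + t • A i) := by
    ext b c
    by_cases hb : b = a
    · subst hb; simp
    · simp [updateRow_ne hb, updateRow_ne (hg.ne hb)]
  have h2 : A.submatrix (Function.update g a i) id = (A.submatrix g id).updateRow a (A i) := by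
    ext b c
    by_cases hb : b = a
    · subst hb; simp
    · simp [updateRow_ne hb, Function.update_of_ne hb]
  rw [h1, h2, det_updateRow_add, det_updateRow_smul]
  congr 2
  ext b c
  by_cases hb : b = a
  · subst hb; simp
  · simp [updateRow_ne hb]

/-- A totally nonnegative matrix of full rank is a limit of positive matrices. -/
theorem mem_closure_isPositiveMatrix {A : Matrix (Fin n) (Fin r) ℝ}
    (hA : ∀ g : Fin r → Fin n, StrictMono g → 0 ≤ (A.submatrix g id).det)
    {g₀ : Fin r → Fin n} (hg₀ : StrictMono g₀) (h₀ : (A.submatrix g₀ id).det ≠ 0) :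
    A ∈ closure {B : Matrix (Fin n) (Fin r) ℝ | IsPositiveMatrix B} := by
  obtain ⟨N, hN⟩ : ∃ N, N = (Finset.univ.filter fun g : Fin r → Fin n =>
    StrictMono g ∧ (A.submatrix g id).det = 0).card := ⟨_, rfl⟩
  induction N using Nat.strong_induction_on generalizing A with
  | _ N ih =>
  by_cases hstep : ∃ (g : Fin r → Fin n) (a : Fin r) (i : Fin n), StrictMono g ∧
      ((i : ℕ) = g a + 1 ∨ (i : ℕ) + 1 = g a) ∧ StrictMono (Function.update g a i) ∧
      0 < (A.submatrix (Function.update g a i) id).det ∧ (A.submatrix g id).det = 0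
  · obtain ⟨g, a, i, hg, hi, hg', hpos, hzero⟩ := hstep
    set B : ℝ → Matrix (Fin n) (Fin r) ℝ := fun t => A.updateRow (g a) (A (g a) + t • A i) with hB
    have hmono : ∀ t, 0 < t → ∀ f : Fin r → Fin n, StrictMono f →
        (A.submatrix f id).det ≤ ((B t).submatrix f id).det := by
      intro t ht f hf
      by_cases hfa : ∃ b, f b = g a
      · obtain ⟨b, hb⟩ := hfa
        have h1 := det_updateRow_submatrix A hf.injective b i t
        rw [hb] at h1
        rw [hB]; simp only
        rw [h1]
        have h2 : 0 ≤ (A.submatrix (Function.update f b i) id).det := by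
          rcases strictMono_update_or hf b (i := i) (by rw [hb]; exact hi) with h | ⟨c, hc, hci⟩
          · exact hA _ h
          · refine (det_zero_of_row_eq hc ?_).ge
            ext j
            simp [Function.update_of_ne hc, hci]
        have := mul_nonneg ht.le h2
        linarith
      · push Not at hfa
        have : (B t).submatrix f id = A.submatrix f id := by
          ext b c
          simp [hB, updateRow_ne (hfa b)]
        rw [this]
    have hmem : ∀ t, 0 < t → B t ∈ closure {B : Matrix (Fin n) (Fin r) ℝ | IsPositiveMatrix B} := by
      intro t ht
      refine ih _ ?_ (fun f hf => (hA f hf).trans (hmono t ht f hf)) ?_ rfl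
      · rw [hN]
        refine Finset.card_lt_card ⟨fun f hf => ?_, fun hsub => ?_⟩
        · rw [Finset.mem_filter] at hf ⊢
          refine ⟨hf.1, hf.2.1, le_antisymm ?_ (hA f hf.2.1)⟩
          exact (hmono t ht f hf.2.1).trans hf.2.2.le
        · have h1 : g ∈ Finset.univ.filter fun g : Fin r → Fin n =>
              StrictMono g ∧ (A.submatrix g id).det = 0 :=
            Finset.mem_filter.2 ⟨Finset.mem_univ g, hg, hzero⟩
          have h2 := (Finset.mem_filter.1 (hsub h1)).2.2
          rw [hB] at h2
          simp only at h2
          rw [det_updateRow_submatrix A hg.injective, hzero, zero_add] at h2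
          exact (mul_pos ht hpos).ne' h2
      · have h1 := lt_of_le_of_ne (hA g₀ hg₀) h₀.symm
        exact (h1.trans_le (hmono t ht g₀ hg₀)).ne'
    have hlim : Filter.Tendsto B (nhdsWithin 0 (Set.Ioi 0)) (nhds A) := by
      have hc : Continuous B := by
        refine continuous_matrix fun b c => ?_
        by_cases hb : b = g a
        · subst hb
          simp only [hB, updateRow_self, Pi.add_apply, Pi.smul_apply, smul_eq_mul]
          fun_prop
        · simp only [hB, updateRow_ne hb]; fun_prop
      have h0 : B 0 = A := by
        ext b c
        by_cases hb : b = g a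
        · subst hb; simp [hB]
        · simp [hB, updateRow_ne hb]
      exact h0 ▸ (hc.tendsto 0).mono_left nhdsWithin_le_nhds
    have := mem_closure_of_tendsto hlim
      (Filter.eventually_of_mem self_mem_nhdsWithin fun t ht => hmem t ht)
    rwa [closure_closure] at this
  · push Not at hstep
    refine subset_closure fun g hg => lt_of_le_of_ne (hA g hg) (Ne.symm ?_)
    refine strictMono_induction_adjacent (P := fun g => (A.submatrix g id).det ≠ 0)
      (fun g a i hg hi hg' h => ?_) hg₀ h₀ hg
    exact hstep g a i hg hi hg' (lt_of_le_of_ne (hA _ hg') (Ne.symm h))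

lemma exists_strictMono_det_ne_zero {A : Matrix (Fin r) (Fin n) ℝ} (hA : A.rank = r) :
    ∃ g : Fin r → Fin n, StrictMono g ∧ (A.submatrix id g).det ≠ 0 := by
  have h1 : LinearIndependent ℝ (A * Aᵀ).row := by
    rw [linearIndependent_iff_card_eq_finrank_span, Fintype.card_fin, Set.finrank,
      ← rank_eq_finrank_span_row, rank_self_mul_transpose, hA]
  have h2 : (A * Aᵀ).det ≠ 0 :=
    ((Matrix.isUnit_iff_isUnit_det _).1 (linearIndependent_rows_iff_isUnit.1 h1)).ne_zero
  by_contra! h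
  refine h2 ((mul_eq_zero.1 ?_).resolve_left
    (Nat.cast_ne_zero.2 r.factorial_ne_zero : (r.factorial : ℝ) ≠ 0))
  rw [factorial_mul_det_mul]
  refine Finset.sum_eq_zero fun f _ => mul_eq_zero_of_left ?_ _
  by_cases hf : Function.Injective f
  · obtain ⟨g, σ, hg, rfl⟩ := exists_strictMono_comp_perm hf
    have h3 : A.submatrix id (g ∘ σ) = (A.submatrix id g).submatrix id σ := rfl
    rw [h3, det_permute', h g hg, mul_zero]
  · simp only [Function.Injective, not_forall] at hf
    obtain ⟨a, b, h1, h2⟩ := hf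
    exact det_zero_of_column_eq h2 (by simp [h1])

/-- The totally nonnegative matrices of full rank are limits of matrices with positive minors. -/
theorem IsTotallyNonnegRect.mem_closure {C : Matrix (Fin r) (Fin n) ℝ} (hC : IsTotallyNonnegRect C)
    (hr : C.rank = r) : C ∈ closure {C : Matrix (Fin r) (Fin n) ℝ | IsPositiveMatrix Cᵀ} := by
  obtain ⟨g, hg, h⟩ := exists_strictMono_det_ne_zero hr
  have hdet : ∀ g : Fin r → Fin n, (Cᵀ.submatrix g id).det = (C.submatrix id g).det := fun g => by
    rw [← det_transpose, transpose_submatrix, transpose_transpose]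
  have h1 := mem_closure_isPositiveMatrix (A := Cᵀ) (fun g hg => by rw [hdet]; exact hC g hg) hg
    (by rwa [hdet])
  have h2 := map_mem_closure (Continuous.matrix_transpose continuous_id) h1
    (t := {C : Matrix (Fin r) (Fin n) ℝ | IsPositiveMatrix Cᵀ}) (fun B hB => by
      simpa [Set.mem_ofPred_eq] using hB)
  simpa using h2

end TotallyNonnegative

section FlipCount

open Matrix

lemma exists_alternating (σ : ℕ → Bool) {K m : ℕ}
    (hK : K ≤ ∑ q ∈ Finset.range m, chi (σ q) (σ (q + 1))) :
    ∃ f : ℕ → ℕ, (∀ i j, i < j → j ≤ K → f i < f j) ∧ f K ≤ m ∧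
      ∀ j ≤ K, σ (f j) = xor (σ 0) j.bodd := by
  have key : ∀ m, ∃ f : ℕ → ℕ,
      (∀ i j, i < j → j ≤ ∑ q ∈ Finset.range m, chi (σ q) (σ (q + 1)) → f i < f j) ∧
      (∀ j, j ≤ ∑ q ∈ Finset.range m, chi (σ q) (σ (q + 1)) → f j ≤ m) ∧
      (∀ j, j ≤ ∑ q ∈ Finset.range m, chi (σ q) (σ (q + 1)) → σ (f j) = xor (σ 0) j.bodd) ∧
      σ m = xor (σ 0) (∑ q ∈ Finset.range m, chi (σ q) (σ (q + 1))).bodd := by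
    intro m
    induction m with
    | zero =>
      refine ⟨fun _ => 0, fun i j h1 h2 => ?_, fun _ _ => le_rfl, fun j hj => ?_, by simp⟩
      · simp at h2; omega
      · obtain rfl : j = 0 := by simpa using hj
        simp
    | succ m ih =>
      obtain ⟨f, h1, h2, h3, h4⟩ := ih
      rw [Finset.sum_range_succ]
      set c := ∑ q ∈ Finset.range m, chi (σ q) (σ (q + 1)) with hc
      by_cases hs : σ m = σ (m + 1)
      · rw [show chi (σ m) (σ (m + 1)) = 0 by rw [hs, chi_self], add_zero]
        exact ⟨f, h1, fun j hj => (h2 j hj).trans (Nat.le_succ m), h3, hs ▸ h4⟩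
      · have hchi : chi (σ m) (σ (m + 1)) = 1 := if_neg hs
        have hs' : σ (m + 1) = xor (σ 0) (c + 1).bodd := by
          rw [Nat.bodd_succ]
          revert hs h4
          cases σ m <;> cases σ (m + 1) <;> cases σ 0 <;> cases c.bodd <;> simp
        rw [hchi]
        refine ⟨fun j => if j ≤ c then f j else m + 1, fun i j hij hj => ?_, fun j hj => ?_,
          fun j hj => ?_, hs'⟩
        · by_cases hjc : j ≤ c
          · simp only [if_pos hjc, if_pos (hij.le.trans hjc)]
            exact h1 i j hij hjc
          · simp only [if_neg hjc, if_pos (show i ≤ c by omega)]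
            exact Nat.lt_succ_of_le (h2 i (by omega))
        · simp only
          split_ifs with hjc
          · exact (h2 j hjc).trans (Nat.le_succ m)
          · exact le_rfl
        · simp only
          split_ifs with hjc
          · exact h3 j hjc
          · obtain rfl : j = c + 1 := by omega
            exact hs'
  obtain ⟨f, h1, h2, h3, -⟩ := key m
  exact ⟨f, fun i j hij hj => h1 i j hij (hj.trans hK), h2 K hK, fun j hj => h3 j (hj.trans hK)⟩

/-- A vector in the column span of a positive matrix and in the kernel of a matrix with positive
minors, which vanishes at three final places, has the expected number of sign changes. -/
lemma IsPositiveMatrix.sum_chi_eq {n k : ℕ} (hk : 1 ≤ k) (hn : k + 4 ≤ n)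
    {Z : Matrix (Fin n) (Fin (k + 4)) ℝ} (hZ : IsPositiveMatrix Z) {A : Matrix (Fin n) (Fin k) ℝ}
    (hA : IsPositiveMatrix A) {c : Fin (k + 4) → ℝ} (hx : (Z *ᵥ c) ᵥ* A = 0) (hx0 : Z *ᵥ c ≠ 0)
    (hlast : ∀ q : Fin n, n < q + 4 → (Z *ᵥ c) q = 0) {σ : ℕ → Bool}
    (hσ : ∀ q : Fin n, (q : ℕ) + 4 ≤ n → Fill (σ q) ((Z *ᵥ c) q)) :
    ∑ q ∈ Finset.range (n - 4), chi (σ q) (σ (q + 1)) = k := by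
  obtain ⟨r, rfl⟩ : ∃ r, k = r + 1 := ⟨k - 1, by omega⟩
  refine le_antisymm ?_ ?_
  · by_contra! hlt
    have hn' : r + 6 ≤ n := by
      have h1 : ∑ q ∈ Finset.range (n - 4), chi (σ q) (σ (q + 1)) ≤ n - 4 := by
        refine (Finset.sum_le_card_nsmul _ _ 1 fun q _ => ?_).trans (by simp)
        unfold chi; split_ifs <;> simp
      omega
    obtain ⟨f, h1, h2, h3⟩ := exists_alternating σ (Nat.succ_le_of_lt hlt)
    have hfle : ∀ j, j ≤ r + 2 → f j ≤ n - 4 := fun j hj => by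
      rcases hj.lt_or_eq with h | rfl
      · exact (h1 _ _ h le_rfl).le.trans h2
      · exact h2
    set F : Fin (r + 1 + 4 + 1) → Fin n := fun j => if h : (j : ℕ) ≤ r + 2 then
      ⟨f j, by have := hfle j h; omega⟩ else ⟨n - (r + 6) + j, by have := j.2; omega⟩ with hF
    have hFmono : StrictMono F := by
      intro i j hij
      rw [Fin.lt_def] at hij
      by_cases hj : (j : ℕ) ≤ r + 2
      · simp only [hF, dif_pos hj, dif_pos (hij.le.trans hj), Fin.lt_def]
        exact h1 _ _ hij hj
      · by_cases hi : (i : ℕ) ≤ r + 2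
        · simp only [hF, dif_pos hi, dif_neg hj, Fin.lt_def]
          have := hfle i hi
          omega
        · simp only [hF, dif_neg hi, dif_neg hj, Fin.lt_def]
          omega
    have hc : c = 0 := by
      refine hZ.eq_zero_of_alternating hFmono (s := if σ 0 then 1 else -1)
        (by split_ifs <;> norm_num) fun j => ?_
      by_cases hj : (j : ℕ) ≤ r + 2
      · have h4 := h3 j hj
        have h5 : Fill (σ (f j)) ((Z *ᵥ c) (F j)) := by
          simp only [hF, dif_pos hj]
          have h6 := hfle j hj
          exact hσ ⟨f j, by omega⟩ (show f j + 4 ≤ n by omega)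
        rw [h4] at h5
        have h6 : ((-1 : ℝ)) ^ (j : ℕ) = if (j : ℕ).bodd then -1 else 1 := by
          generalize (j : ℕ) = m
          induction m with
          | zero => simp
          | succ m ih => rw [pow_succ, ih, Nat.bodd_succ]; cases m.bodd <;> simp
        rw [h6]
        obtain ⟨h7, h8⟩ := h5
        revert h7 h8
        cases σ 0 <;> cases (j : ℕ).bodd <;> simp
      · have : (Z *ᵥ c) (F j) = 0 := hlast _ (by
          simp only [hF, dif_neg hj]; omega)
        rw [this]; simp
    exact hx0 (by rw [hc, mulVec_zero])
  · by_contra! hlt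
    refine hx0 (hA.eq_zero_of_flips (by omega) hx (σ := fun q => σ (min q (n - 4)))
      (fun q => ?_) ?_)
    · by_cases hq : (q : ℕ) + 4 ≤ n
      · rw [min_eq_left (by omega)]; exact hσ q hq
      · rw [hlast q (by omega)]; exact fill_zero _
    · rw [← Finset.sum_range_add_sum_Ico _ (show n - 4 ≤ n - 1 by omega),
        Finset.sum_eq_zero (s := Finset.Ico _ _), add_zero]
      · refine (Finset.sum_congr rfl fun q hq => ?_).trans_le (Nat.lt_succ_iff.1 hlt)
        rw [Finset.mem_range] at hq
        rw [min_eq_left (by omega), min_eq_left (by omega)]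
      · intro q hq
        rw [Finset.mem_Ico] at hq
        rw [min_eq_right (by omega), min_eq_right (by omega), chi_self]

end FlipCount

section Configuration

open Matrix

variable {n k r : ℕ}

lemma unitCons_mul_zero {m : ℕ} (p : Fin n) (C : Matrix (Fin r) (Fin n) ℝ)
    (N : Matrix (Fin n) (Fin m) ℝ) (x : Fin m) : (unitCons p C * N) 0 x = N p x := by
  have : (unitCons p C) 0 = Pi.single p 1 := rfl
  rw [mul_apply_eq_vecMul, this, single_one_vecMul, row_apply]

/-- The first four and the last `k` elements of `Fin (k + 4)`. -/
def splitEquiv (k : ℕ) : Fin 4 ⊕ Fin k ≃ Fin (k + 4) :=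
  finSumFinEquiv.trans (finCongr (add_comm 4 k))

lemma splitEquiv_inr (i : Fin k) : splitEquiv k (Sum.inr i) = i.succ.succ.succ.succ := by
  ext; simp [splitEquiv]

/-- The matrix `C` with four unit rows added at the top. -/
def unitCons₄ (a b c d : Fin n) (C : Matrix (Fin k) (Fin n) ℝ) : Matrix (Fin (k + 4)) (Fin n) ℝ :=
  unitCons a (unitCons b (unitCons c (unitCons d C)))

lemma unitCons₄_mul_inr {m : ℕ} (a b c d : Fin n) (C : Matrix (Fin k) (Fin n) ℝ)
    (N : Matrix (Fin n) (Fin m) ℝ) (i : Fin k) (x : Fin m) :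
    (unitCons₄ a b c d C * N) (splitEquiv k (Sum.inr i)) x = (C * N) i x := by
  rw [splitEquiv_inr]; rfl

lemma unitCons₄_mul_inl {m : ℕ} (a b c d : Fin n) (C : Matrix (Fin k) (Fin n) ℝ)
    (N : Matrix (Fin n) (Fin m) ℝ) (j : Fin 4) :
    (unitCons₄ a b c d C * N) (splitEquiv k (Sum.inl j)) = ![N a, N b, N c, N d] j := by
  ext x
  fin_cases j
  · exact unitCons_mul_zero _ _ _ _
  · exact unitCons_mul_zero b (unitCons c (unitCons d C)) N x
  · exact unitCons_mul_zero c (unitCons d C) N x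
  · exact unitCons_mul_zero d C N x

/-- The configuration of vectors formed by the first four columns of `U`. -/
def conf (U : Matrix (Fin n) (Fin (k + 4)) ℝ) (p : ℕ) : Fin 4 → ℝ :=
  fun j => markerRow U p (splitEquiv k (Sum.inl j))

lemma conf_apply (U : Matrix (Fin n) (Fin (k + 4)) ℝ) {p : ℕ} {a : Fin n} (h : (a : ℕ) + 1 = p)
    (j : Fin 4) : conf U p j = U a (splitEquiv k (Sum.inl j)) := by
  subst h
  simp [conf, markerRow]

lemma det_unitCons₄_mul {C : Matrix (Fin k) (Fin n) ℝ} {U : Matrix (Fin n) (Fin (k + 4)) ℝ}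
    (h0 : ∀ i j, (C * U) i (splitEquiv k (Sum.inl j)) = 0)
    (h1 : ∀ i j, (C * U) i (splitEquiv k (Sum.inr j)) = (1 : Matrix (Fin k) (Fin k) ℝ) i j)
    {p q s t : ℕ} {a b c d : Fin n} (ha : (a : ℕ) + 1 = p) (hb : (b : ℕ) + 1 = q)
    (hc : (c : ℕ) + 1 = s) (hd : (d : ℕ) + 1 = t) :
    (unitCons₄ a b c d C * U).det = br (conf U p) (conf U q) (conf U s) (conf U t) := by
  rw [← det_submatrix_equiv_self (splitEquiv k), br]
  have : (unitCons₄ a b c d C * U).submatrix (splitEquiv k) (splitEquiv k) =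
      fromBlocks (Matrix.of ![conf U p, conf U q, conf U s, conf U t])
        (Matrix.of fun i j => (unitCons₄ a b c d C * U) (splitEquiv k (Sum.inl i))
          (splitEquiv k (Sum.inr j))) 0 1 := by
    ext (i | i) (j | j)
    · rw [submatrix_apply, unitCons₄_mul_inl, fromBlocks_apply₁₁]
      fin_cases i
      · exact (conf_apply U ha j).symm
      · exact (conf_apply U hb j).symm
      · exact (conf_apply U hc j).symm
      · exact (conf_apply U hd j).symm
    · rfl
    · rw [submatrix_apply, unitCons₄_mul_inr, h0]; rfl
    · rw [submatrix_apply, unitCons₄_mul_inr, h1]; rfl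
  rw [this, det_fromBlocks_zero₂₁, det_one, mul_one]

lemma det_unitCons₄_mul_pos {C : Matrix (Fin k) (Fin n) ℝ}
    (hC : ∀ g : Fin k → Fin n, StrictMono g → 0 < (C.submatrix id g).det) (hn : k + 4 ≤ n)
    {Z : Matrix (Fin n) (Fin (k + 4)) ℝ} (hZ : IsPositiveMatrix Z) {a b c d : Fin n}
    (hinj : a ≠ b ∧ a ≠ c ∧ a ≠ d ∧ b ≠ c ∧ b ≠ d ∧ c ≠ d) {s : ℝ} (hs : s ≠ 0)
    (h : ∀ g : Fin (k + 4) → Fin n, StrictMono g →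
      0 ≤ s * ((unitCons₄ a b c d C).submatrix id g).det) :
    0 < s * (unitCons₄ a b c d C * Z).det := by
  obtain ⟨hab, hac, had, hbc, hbd, hcd⟩ := hinj
  have hcard : k ≤ (({a, b, c, d} : Finset (Fin n))ᶜ).card := by
    rw [Finset.card_compl, Fintype.card_fin]
    have : ({a, b, c, d} : Finset (Fin n)).card ≤ 4 := Finset.card_le_four
    omega
  set f : Fin k → Fin n := fun i =>
    (({a, b, c, d} : Finset (Fin n))ᶜ).orderEmbOfFin rfl (Fin.castLE hcard i) with hf
  have hfmono : StrictMono f := fun i j hij => (OrderEmbedding.strictMono _) hij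
  have hfmem : ∀ i, f i ∉ ({a, b, c, d} : Finset (Fin n)) := fun i =>
    Finset.mem_compl.1 (Finset.orderEmbOfFin_mem _ _ _)
  simp only [Finset.mem_insert, Finset.mem_singleton, not_or] at hfmem
  have h1 : Function.Injective (Fin.cons d f : Fin (k + 1) → Fin n) :=
    Fin.cons_injective_iff.2 ⟨by rintro ⟨i, hi⟩; exact (hfmem i).2.2.2 hi, hfmono.injective⟩
  have h2 : Function.Injective (Fin.cons c (Fin.cons d f) : Fin (k + 2) → Fin n) := by
    refine Fin.cons_injective_iff.2 ⟨?_, h1⟩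
    rw [Fin.range_cons, Set.mem_insert_iff]
    rintro (h | ⟨i, hi⟩)
    · exact hcd h
    · exact (hfmem i).2.2.1 hi
  have h3 : Function.Injective (Fin.cons b (Fin.cons c (Fin.cons d f)) : Fin (k + 3) → Fin n) := by
    refine Fin.cons_injective_iff.2 ⟨?_, h2⟩
    rw [Fin.range_cons, Fin.range_cons, Set.mem_insert_iff, Set.mem_insert_iff]
    rintro (h | h | ⟨i, hi⟩)
    · exact hbc h
    · exact hbd h
    · exact (hfmem i).2.1 hi
  have h4 : Function.Injective
      (Fin.cons a (Fin.cons b (Fin.cons c (Fin.cons d f))) : Fin (k + 4) → Fin n) := by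
    refine Fin.cons_injective_iff.2 ⟨?_, h3⟩
    rw [Fin.range_cons, Fin.range_cons, Fin.range_cons, Set.mem_insert_iff, Set.mem_insert_iff,
      Set.mem_insert_iff]
    rintro (h | h | h | ⟨i, hi⟩)
    · exact hab h
    · exact hac h
    · exact had h
    · exact (hfmem i).1 hi
  refine det_mul_pos hZ h h4 hs ?_
  rw [unitCons₄, det_unitCons_cons _ h4, det_unitCons_cons _ h3, det_unitCons_cons _ h2,
    det_unitCons_cons _ h1]
  exact (hC f hfmono).ne'

lemma br_eq_dotProduct (a b c : Fin 4 → ℝ) : ∃ φ : Fin 4 → ℝ, ∀ x, br a b c x = x ⬝ᵥ φ := by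
  refine ⟨fun j => br a b c (Pi.single j 1), fun x => ?_⟩
  simp only [br_eq, dotProduct, Fin.sum_univ_four, Pi.single_apply]
  simp
  ring

/-- Near the configuration of a matrix `Z * B⁻¹` normalized with respect to `C` there are
configurations with a domino matrix in their kernel. -/
theorem exists_frame (hk : 1 ≤ k) (hn : k + 4 ≤ n) {Z : Matrix (Fin n) (Fin (k + 4)) ℝ}
    (hZ : IsPositiveMatrix Z) {C : Matrix (Fin k) (Fin n) ℝ} (hC : IsPositiveMatrix Cᵀ) :
    ∃ B : Matrix (Fin (k + 4)) (Fin (k + 4)) ℝ, IsUnit B.det ∧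
      (∀ i j, (C * (Z * B⁻¹)) i (splitEquiv k (Sum.inl j)) = 0) ∧
      (∀ i j, (C * (Z * B⁻¹)) i (splitEquiv k (Sum.inr j)) = (1 : Matrix (Fin k) (Fin k) ℝ) i j) ∧
      conf (Z * B⁻¹) ∈ closure {z | HasDomino n k z} := by
  have hC' : ∀ g : Fin k → Fin n, StrictMono g → 0 < (C.submatrix id g).det := fun g hg => by
    rw [← det_transpose, transpose_submatrix]; exact hC g hg
  have hpair : ∀ {a b c d : Fin n}, (b : ℕ) = a + 1 → (d : ℕ) = c + 1 → (b : ℕ) < c →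
      0 < (unitCons₄ a b c d C * Z).det := by
    intro a b c d hab hcd hbc
    rw [← one_mul (det _)]
    refine det_unitCons₄_mul_pos hC' hn hZ ?_ one_ne_zero fun g hg => ?_
    · refine ⟨?_, ?_, ?_, ?_, ?_, ?_⟩ <;> rw [Fin.ne_iff_vne] <;> omega
    · refine unitCons_pair_nonneg hab (fun g hg => ?_) g hg
      refine unitCons_pair_nonneg hcd (fun g hg => ?_) g hg
      rw [one_mul]; exact (hC' g hg).le
  have htwist : ∀ {a b c d : Fin n}, (b : ℕ) = a + 1 → (c : ℕ) + 1 = n → (d : ℕ) = 0 → (b : ℕ) < c →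
      (d : ℕ) < a → 0 < (-1) ^ (k + 1) * (unitCons₄ a b c d C * Z).det := by
    intro a b c d hab hc hd hbc hda
    refine det_unitCons₄_mul_pos hC' hn hZ ?_ (by simp) fun g hg => ?_
    · refine ⟨?_, ?_, ?_, ?_, ?_, ?_⟩ <;> rw [Fin.ne_iff_vne] <;> omega
    · refine unitCons_pair_nonneg hab (fun g hg => ?_) g hg
      exact unitCons_twist_nonneg hc hd (fun g hg => (hC' g hg).le) g hg
  set B := unitCons₄ ⟨0, by omega⟩ ⟨1, by omega⟩ ⟨2, by omega⟩ ⟨3, by omega⟩ C * Z with hB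
  have hdet : 0 < B.det := hpair rfl rfl (by simp)
  have hunit : IsUnit B.det := hdet.ne'.isUnit
  set U := Z * B⁻¹ with hU
  have hone : unitCons₄ ⟨0, by omega⟩ ⟨1, by omega⟩ ⟨2, by omega⟩ ⟨3, by omega⟩ C * U = 1 := by
    rw [hU, ← Matrix.mul_assoc, ← hB, mul_nonsing_inv _ hunit]
  have hCU : ∀ i x, (C * U) i x =
      (1 : Matrix (Fin (k + 4)) (Fin (k + 4)) ℝ) (splitEquiv k (Sum.inr i)) x := fun i x => by
    rw [← hone, unitCons₄_mul_inr]
  have h0 : ∀ i j, (C * U) i (splitEquiv k (Sum.inl j)) = 0 := fun i j => by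
    rw [hCU, one_apply_ne]; simp
  have h1 : ∀ i j, (C * U) i (splitEquiv k (Sum.inr j)) = (1 : Matrix (Fin k) (Fin k) ℝ) i j :=
    fun i j => by rw [hCU]; simp [one_apply]
  refine ⟨B, hunit, h0, h1, ?_⟩
  have hdetU : ∀ a b c d, (unitCons₄ a b c d C * U).det =
      (unitCons₄ a b c d C * Z).det * B.det⁻¹ := fun a b c d => by
    rw [hU, ← Matrix.mul_assoc, det_mul, det_nonsing_inv, Ring.inverse_eq_inv']
  have hp : ∀ p q, 1 ≤ p → p + 1 < q → q + 1 ≤ n →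
      0 < br (conf U p) (conf U (p + 1)) (conf U q) (conf U (q + 1)) := by
    intro p q hp hpq hq
    rw [← det_unitCons₄_mul h0 h1 (a := ⟨p - 1, by omega⟩) (b := ⟨p, by omega⟩)
      (c := ⟨q - 1, by omega⟩) (d := ⟨q, by omega⟩) (by simp; omega) rfl (by simp; omega) rfl,
      hdetU]
    exact mul_pos (hpair (by simp; omega) (by simp; omega) (by simp; omega)) (inv_pos.2 hdet)
  have ht : ∀ p, 2 ≤ p → p + 1 < n →
      0 < (-1) ^ (k + 1) * br (conf U p) (conf U (p + 1)) (conf U n) (conf U 1) := by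
    intro p hp hpn
    rw [← det_unitCons₄_mul h0 h1 (a := ⟨p - 1, by omega⟩) (b := ⟨p, by omega⟩)
      (c := ⟨n - 1, by omega⟩) (d := ⟨0, by omega⟩) (by simp; omega) rfl (by simp; omega) rfl,
      hdetU,
      ← mul_assoc]
    exact mul_pos (htwist (by simp; omega) (by simp; omega) rfl (by simp; omega) (by simp; omega))
      (inv_pos.2 hdet)
  obtain ⟨φ, hφ⟩ := br_eq_dotProduct (conf U (n - 2)) (conf U (n - 1)) (conf U n)
  set ψ : Fin (k + 4) → ℝ := Sum.elim φ 0 ∘ (splitEquiv k).symm with hψ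
  have hval : ∀ q : Fin n, (Z *ᵥ (B⁻¹ *ᵥ ψ)) q =
      br (conf U (n - 2)) (conf U (n - 1)) (conf U n) (conf U (q + 1)) := by
    intro q
    rw [hφ, mulVec_mulVec, ← hU]
    simp only [mulVec, dotProduct]
    rw [← (splitEquiv k).sum_comp, Fintype.sum_sum_type]
    simp [hψ, conf_apply U (a := q) rfl]
  have hker : (Z *ᵥ (B⁻¹ *ᵥ ψ)) ᵥ* Cᵀ = 0 := by
    rw [vecMul_transpose, mulVec_mulVec, mulVec_mulVec, Matrix.mul_assoc, ← hU]
    ext i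
    simp only [mulVec, dotProduct]
    rw [← (splitEquiv k).sum_comp, Fintype.sum_sum_type]
    simp [hψ, h0]
  have hne : Z *ᵥ (B⁻¹ *ᵥ ψ) ≠ 0 := by
    intro h
    have h2 := hval ⟨0, by omega⟩
    rw [h] at h2
    have h3 := ht (n - 2) (by omega) (by omega)
    rw [show n - 2 + 1 = n - 1 by omega] at h3
    simp only [Pi.zero_apply, zero_add] at h2
    rw [← h2, mul_zero] at h3
    exact lt_irrefl _ h3
  have hlast : ∀ q : Fin n, n < q + 4 → (Z *ᵥ (B⁻¹ *ᵥ ψ)) q = 0 := by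
    intro q hq
    rw [hval]
    have hq' : (q : ℕ) + 1 = n - 2 ∨ (q : ℕ) + 1 = n - 1 ∨ (q : ℕ) + 1 = n := by have := q.2; omega
    rcases hq' with h | h | h <;> rw [h] <;> simp
  have hfill : ∀ᶠ y : ℕ → Fin 4 → ℝ in nhds (conf U), ∀ q : Fin n,
      Fill (pos (br (y (n - 2)) (y (n - 1)) (y n) (y (q + 1)))) ((Z *ᵥ (B⁻¹ *ᵥ ψ)) q) := by
    rw [Filter.eventually_all]
    intro q
    rw [hval]
    by_cases hq : br (conf U (n - 2)) (conf U (n - 1)) (conf U n) (conf U (q + 1)) = 0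
    · rw [hq]; exact Filter.Eventually.of_forall fun _ => fill_zero _
    · filter_upwards [eventually_pos_eq (f := fun y : ℕ → Fin 4 → ℝ =>
        br (y (n - 2)) (y (n - 1)) (y n) (y (q + 1))) (Continuous.br (by fun_prop) (by fun_prop)
        (by fun_prop) (by fun_prop)) hq] with y hy
      rw [hy]
      rcases lt_or_gt_of_ne hq with h | h
      · rw [pos_of_neg h]; exact ⟨by simp, fun _ => h.le⟩
      · rw [pos_of_pos h]; exact ⟨fun _ => h.le, by simp⟩
  have hcls : conf U ∈ closure {z | Cls n k z} := by
    rw [mem_closure_iff_frequently]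
    have hgood := mem_closure_iff_frequently.1 (dense_good (conf U))
    refine (hgood.and_eventually ((eventually_br_pos hp ht).and hfill)).mono ?_
    rintro y ⟨hy, ⟨hyp, hyt⟩, hyf⟩
    refine ⟨hyp, hyt, fun q hq hqn => hy.br_ne _ _ _ _ (by omega) (by omega) (by omega) (by omega)
      (by omega) (by omega), ?_⟩
    rw [← hZ.sum_chi_eq hk hn hC hker hne hlast
      (σ := fun q => pos (br (y (n - 2)) (y (n - 1)) (y n) (y (q + 1)))) fun q _ => hyf q]
    rw [flips, Finset.sum_Ico_eq_sum_range]
    refine Finset.sum_congr (by congr 1) fun q _ => ?_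
    simp only [add_comm 1]
  have := closure_mono (fun z (hz : Cls n k z) => mem_closure_hasDomino n k z fun _ => hz) hcls
  rwa [closure_closure] at this

end Configuration

section Transfer

open Matrix

lemma SignPath.exists_signs {x : ℕ → ℝ} {a L : ℕ} {s t : Bool} {m : ℕ} (h : SignPath x a L s t m) :
    ∃ σ : ℕ → Bool, (∀ q < L, Fill (σ q) (x (a + q))) ∧ σ L = t ∧
      ∑ q ∈ Finset.range L, chi (σ q) (σ (q + 1)) ≤ m := by
  induction L generalizing t m with
  | zero => exact ⟨fun _ => t, by simp, rfl, by simp⟩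
  | succ L ih =>
    obtain ⟨u, hu, m', hm, h⟩ := h
    obtain ⟨σ, hσ, hL, hsum⟩ := ih h
    refine ⟨fun q => if q ≤ L then σ q else t, fun q hq => ?_, by simp, ?_⟩
    · simp only [if_pos (Nat.lt_succ_iff.1 hq)]
      rcases Nat.lt_succ_iff_lt_or_eq.1 hq with hq | rfl
      · exact hσ q hq
      · rwa [hL]
    · simp only [Finset.sum_range_succ, if_pos le_rfl, if_neg (Nat.not_succ_le_self L), hL]
      refine le_trans (Nat.add_le_add_right (le_of_eq_of_le (Finset.sum_congr rfl fun q hq => ?_)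
        hsum) _) hm
      have := Finset.mem_range.1 hq
      rw [if_pos (by omega), if_pos (by omega)]

/-- The vectors whose entries can be given compatible signs with at most `r` sign changes. -/
def flipCone (n r : ℕ) : Set (Fin n → ℝ) :=
  {x | ∃ σ : ℕ → Bool, (∀ q : Fin n, Fill (σ q) (x q)) ∧
    ∑ q ∈ Finset.range (n - 1), chi (σ q) (σ (q + 1)) ≤ r}

lemma CycLE.mem_flipCone {x : ℕ → ℝ} {n k r : ℕ} (hn : 1 ≤ n) (h : CycLE x n k) (hr : k ≤ r + 1) :
    (fun q : Fin n => x (q + 1)) ∈ flipCone n r := by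
  obtain ⟨u, hu, m, hm, h⟩ := h
  obtain ⟨σ, hσ, hL, hsum⟩ := h.exists_signs
  refine ⟨σ, fun q => ?_, by omega⟩
  rcases Nat.lt_or_ge (q : ℕ) (n - 1) with hq | hq
  · simpa only [add_comm] using hσ q hq
  · have hq' : (q : ℕ) = n - 1 := by omega
    simpa only [hq', hL, Nat.sub_add_cancel hn] using hu

lemma isClosed_fill (s : Bool) : IsClosed {y : ℝ | Fill s y} := by
  cases s
  · simpa [Fill] using isClosed_le (continuous_id (X := ℝ)) continuous_const
  · simpa [Fill] using isClosed_le continuous_const (continuous_id (X := ℝ))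

lemma isClosed_flipCone (n r : ℕ) : IsClosed (flipCone n r) := by
  have h : flipCone n r = ⋃ τ ∈ {τ : Fin n → Bool | ∃ σ : ℕ → Bool, (∀ q : Fin n, σ q = τ q) ∧
      ∑ q ∈ Finset.range (n - 1), chi (σ q) (σ (q + 1)) ≤ r},
      {x : Fin n → ℝ | ∀ q, Fill (τ q) (x q)} := by
    ext x
    simp only [flipCone, Set.mem_ofPred_eq, Set.mem_iUnion, exists_prop]
    constructor
    · rintro ⟨σ, h1, h2⟩
      exact ⟨fun q => σ q, ⟨σ, fun _ => rfl, h2⟩, h1⟩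
    · rintro ⟨τ, ⟨σ, h1, h2⟩, h3⟩
      exact ⟨σ, fun q => h1 q ▸ h3 q, h2⟩
  rw [h]
  refine (Set.toFinite _).isClosed_biUnion fun τ _ => ?_
  simp only [Set.ofPred_forall]
  exact isClosed_iInter fun q => (isClosed_fill (τ q)).preimage (f := fun x : Fin n → ℝ => x q)
    (continuous_apply q)

lemma smul_mem_flipCone {n r : ℕ} {x : Fin n → ℝ} (hx : x ∈ flipCone n r) {t : ℝ} (ht : 0 ≤ t) :
    t • x ∈ flipCone n r := by
  obtain ⟨σ, h1, h2⟩ := hx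
  exact ⟨σ, fun q => ⟨fun h => mul_nonneg ht ((h1 q).1 h),
    fun h => mul_nonpos_of_nonneg_of_nonpos ht ((h1 q).2 h)⟩, h2⟩

/-- A linear map with no nonzero kernel vector in a closed cone is bounded below on the cone. -/
lemma exists_le_norm_of_isClosed {E F : Type*} [NormedAddCommGroup E] [NormedSpace ℝ E]
    [FiniteDimensional ℝ E] [NormedAddCommGroup F] [NormedSpace ℝ F] {K : Set E} (hK : IsClosed K)
    (hs : ∀ x ∈ K, ∀ t : ℝ, 0 ≤ t → t • x ∈ K) (f : E →ₗ[ℝ] F) (hf : ∀ x ∈ K, f x = 0 → x = 0) :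
    ∃ c > 0, ∀ x ∈ K, c * ‖x‖ ≤ ‖f x‖ := by
  have : ProperSpace E := FiniteDimensional.proper ℝ E
  have hcomp : IsCompact (Metric.sphere (0 : E) 1 ∩ K) := (isCompact_sphere 0 1).inter_right hK
  have hcont : Continuous f := f.continuous_of_finiteDimensional
  have hunit : ∀ x ∈ K, x ≠ 0 → ‖x‖⁻¹ • x ∈ Metric.sphere (0 : E) 1 ∩ K := fun x hx hx0 =>
    ⟨by simp [norm_smul, hx0], hs x hx _ (by positivity)⟩
  rcases (Metric.sphere (0 : E) 1 ∩ K).eq_empty_or_nonempty with he | hne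
  · refine ⟨1, one_pos, fun x hx => ?_⟩
    by_cases hx0 : x = 0
    · simp [hx0]
    · exact absurd (hunit x hx hx0) (by simp [he])
  · obtain ⟨y, hy, hmin⟩ := hcomp.exists_isMinOn hne hcont.norm.continuousOn
    refine ⟨‖f y‖, norm_pos_iff.2 fun h => ?_, fun x hx => ?_⟩
    · have h1 : ‖y‖ = 1 := by simpa using hy.1
      rw [hf y hy.2 h, norm_zero] at h1
      exact zero_ne_one h1
    · by_cases hx0 : x = 0
      · simp [hx0]
      · have h : ‖f y‖ ≤ ‖f (‖x‖⁻¹ • x)‖ := hmin (hunit x hx hx0)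
        rw [map_smul, norm_smul, norm_inv, norm_norm, inv_mul_eq_div,
          le_div_iff₀ (norm_pos_iff.2 hx0)] at h
        exact h

variable {n k : ℕ}

lemma ChordDiagram.dominoMatrix_apply (D : ChordDiagram n k) (v : DominoVars k) (l : Fin k)
    (a : Fin n) : D.dominoMatrix v.α v.β v.γ v.δ v.ε l a =
      D.row v (fun p => (Pi.single p 1 : ℕ → ℝ)) l (a + 1) := by
  simp only [dominoMatrix, row, of_apply, Pi.add_apply, Pi.smul_apply, Pi.single_apply,
    smul_eq_mul, mul_ite, mul_one, mul_zero, Finset.sum_apply]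
  congr 1
  · congr 1
    by_cases h : D.IsTop l <;> simp [h, Pi.single_apply]
  · refine Finset.sum_congr rfl fun m _ => ?_
    by_cases h : D.IsParent m l <;> simp [h, Pi.single_apply, mul_add]

lemma ChordDiagram.vecMul_dominoMatrix (D : ChordDiagram n k) (v : DominoVars k) (c : Fin k → ℝ) :
    c ᵥ* D.dominoMatrix v.α v.β v.γ v.δ v.ε = fun a : Fin n => D.coeff v c (a + 1) := by
  ext a
  simp [vecMul, dotProduct, coeff, dominoMatrix_apply]

lemma ChordDiagram.sum_coeff_mul (D : ChordDiagram n k) (v : DominoVars k) {ι : Type*}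
    {z : ℕ → ι → ℝ} (hz : ∀ l, D.row v z l = 0) (c : Fin k → ℝ) (j : ι) :
    ∑ a : Fin n, D.coeff v c (a + 1) * z (a + 1) j = 0 := by
  have h := congrFun (D.sum_row v c z) j
  simp only [hz, smul_zero, Finset.sum_const_zero, Pi.zero_apply, Finset.sum_apply, Pi.smul_apply,
    smul_eq_mul] at h
  rw [Fin.sum_univ_eq_sum_range (fun a => D.coeff v c (a + 1) * z (a + 1) j), h,
    ← Finset.Ico_succ_right_eq_Icc, Finset.sum_Ico_eq_sum_range]
  simp [add_comm]

lemma IsPositiveMatrix.exists_domino_near (hk : 1 ≤ k) (hn : k + 4 ≤ n)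
    {Z : Matrix (Fin n) (Fin (k + 4)) ℝ} (hZ : IsPositiveMatrix Z) {C : Matrix (Fin k) (Fin n) ℝ}
    (hC : IsPositiveMatrix Cᵀ) {ε : ℝ} (hε : 0 < ε) :
    ∃ (D : ChordDiagram n k) (v : DominoVars k), D.SignRules v.α v.β v.γ v.δ v.ε ∧
      ∃ M : Matrix (Fin k) (Fin k) ℝ, IsUnit M ∧ ∀ r a,
        |(M * (D.dominoMatrix v.α v.β v.γ v.δ v.ε * Z)) r a - (C * Z) r a| < ε := by
  obtain ⟨B, hB, h0, h1, hcl⟩ := exists_frame hk hn hZ hC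
  set U := Z * B⁻¹ with hU
  have hUB : U * B = Z := by rw [hU, Matrix.mul_assoc, nonsing_inv_mul _ hB, Matrix.mul_one]
  obtain ⟨c₀, hc₀, hbound⟩ := exists_le_norm_of_isClosed (isClosed_flipCone n (k + 3))
    (fun x hx t ht => smul_mem_flipCone hx ht) U.vecMulLinear fun x ⟨σ, h2, h3⟩ hx => by
      refine hZ.eq_zero_of_flips (by omega) ?_ h2 h3
      rw [← hUB, ← vecMul_vecMul]
      rw [vecMulLinear_apply] at hx
      rw [hx, zero_vecMul]
  have hnpos : (0 : ℝ) < n := by exact_mod_cast (by omega : 0 < n)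
  set S : ℝ := ∑ i, ∑ j, |B i j| with hS
  have hSnn : 0 ≤ S := by positivity
  obtain ⟨η, hη, hη1, hη2⟩ : ∃ η > 0, n * η < c₀ ∧ n * η / c₀ * S < ε := by
    refine ⟨min (c₀ / (2 * n)) (ε * c₀ / (n * (S + 1) * 2)), by positivity, ?_, ?_⟩
    · calc n * min (c₀ / (2 * n)) (ε * c₀ / (n * (S + 1) * 2))
        _ ≤ n * (c₀ / (2 * n)) := by gcongr; exact min_le_left _ _
        _ = c₀ / 2 := by field_simp
        _ < c₀ := half_lt_self hc₀
    · calc n * min (c₀ / (2 * n)) (ε * c₀ / (n * (S + 1) * 2)) / c₀ * S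
        _ ≤ n * (ε * c₀ / (n * (S + 1) * 2)) / c₀ * S := by gcongr; exact min_le_right _ _
        _ = ε * (S / ((S + 1) * 2)) := by field_simp
        _ < ε * 1 := by
          gcongr
          rw [div_lt_one (by positivity)]
          linarith
        _ = ε := mul_one ε
  obtain ⟨z, hz, D, v, hsign, hrow, hcyc, hinj⟩ : ∃ z : ℕ → Fin 4 → ℝ,
      (∀ (a : Fin n) (j : Fin 4), |z (a + 1) j - conf U (a + 1) j| < η) ∧ HasDomino n k z := by
    have hev : ∀ᶠ z : ℕ → Fin 4 → ℝ in nhds (conf U),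
        ∀ (a : Fin n) (j : Fin 4), |z (a + 1) j - conf U (a + 1) j| < η := by
      refine Filter.eventually_all.2 fun a => Filter.eventually_all.2 fun j => ?_
      have hcont : Continuous fun z : ℕ → Fin 4 → ℝ => |z (a + 1) j - conf U (a + 1) j| := by
        fun_prop
      exact (hcont.tendsto _).eventually_lt_const (by simpa using hη)
    obtain ⟨z, h2, h3⟩ := ((mem_closure_iff_frequently.1 hcl).and_eventually hev).exists
    exact ⟨z, h3, h2⟩
  refine ⟨D, v, hsign, ?_⟩
  set C' := D.dominoMatrix v.α v.β v.γ v.δ v.ε with hC'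
  set P : Matrix (Fin k) (Fin k) ℝ := (C' * U).submatrix id (splitEquiv k ∘ Sum.inr) with hP
  have hmem : ∀ c, c ᵥ* C' ∈ flipCone n (k + 3) := fun c => by
    rw [hC', D.vecMul_dominoMatrix]
    exact (hcyc hk c).mem_flipCone (by omega) (by omega)
  have hinl : ∀ c j, |(c ᵥ* C' ᵥ* U) (splitEquiv k (Sum.inl j))| ≤ n * η * ‖c ᵥ* C'‖ := by
    intro c j
    have h2 : (c ᵥ* C' ᵥ* U) (splitEquiv k (Sum.inl j)) =
        ∑ a, (c ᵥ* C') a * (conf U (a + 1) j - z (a + 1) j) := by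
      have h3 := D.sum_coeff_mul v hrow c j
      rw [← sub_zero ((c ᵥ* C' ᵥ* U) (splitEquiv k (Sum.inl j))), ← h3, vecMul, dotProduct,
        ← Finset.sum_sub_distrib]
      refine Finset.sum_congr rfl fun a _ => ?_
      rw [conf_apply U (a := a) rfl, hC', D.vecMul_dominoMatrix, mul_sub]
    rw [h2]
    refine (Finset.abs_sum_le_sum_abs _ _).trans ((Finset.sum_le_card_nsmul _ _ (‖c ᵥ* C'‖ * η)
      fun a _ => ?_).trans_eq ?_)
    · rw [abs_mul]
      exact mul_le_mul (norm_le_pi_norm (c ᵥ* C') a) (by rw [abs_sub_comm]; exact (hz a j).le)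
        (abs_nonneg _) (norm_nonneg _)
    · rw [Finset.card_univ, Fintype.card_fin, nsmul_eq_mul]; ring
  have hinr : ∀ c i, (c ᵥ* C' ᵥ* U) (splitEquiv k (Sum.inr i)) = (c ᵥ* P) i := fun c i => by
    rw [vecMul_vecMul]; rfl
  have hlow : ∀ c, c₀ * ‖c ᵥ* C'‖ ≤ ‖c ᵥ* P‖ := by
    intro c
    by_cases hx : ‖c ᵥ* C'‖ = 0
    · rw [hx, mul_zero]; exact norm_nonneg _
    have hpos : 0 < ‖c ᵥ* C'‖ := lt_of_le_of_ne (norm_nonneg _) (Ne.symm hx)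
    by_contra! hlt
    refine absurd (hbound _ (hmem c)) (not_le.2 ?_)
    rw [vecMulLinear_apply, pi_norm_lt_iff (by positivity)]
    intro i
    obtain ⟨i, rfl⟩ := (splitEquiv k).surjective i
    rcases i with j | i
    · exact (hinl c j).trans_lt (by gcongr)
    · rw [hinr]; exact (norm_le_pi_norm (c ᵥ* P) i).trans_lt hlt
  have hPunit : IsUnit P := by
    rw [← vecMul_injective_iff_isUnit]
    refine (injective_iff_map_eq_zero P.vecMulLinear).2 fun c hc => hinj c fun p hp hpn => ?_
    have h2 := hlow c
    rw [vecMulLinear_apply] at hc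
    rw [hc, norm_zero] at h2
    have h3 : c ᵥ* C' = 0 := norm_le_zero_iff.1 (nonpos_of_mul_nonpos_right h2 hc₀)
    rw [hC', D.vecMul_dominoMatrix] at h3
    have := congrFun h3 ⟨p - 1, by omega⟩
    simpa [Nat.sub_add_cancel hp] using this
  have hPdet : IsUnit P.det := (isUnit_iff_isUnit_det _).1 hPunit
  refine ⟨P⁻¹, (isUnit_nonsing_inv_iff).2 hPunit, fun r a => ?_⟩
  have hrP : P⁻¹ r ᵥ* P = (1 : Matrix (Fin k) (Fin k) ℝ) r := by
    rw [← mul_apply_eq_vecMul, nonsing_inv_mul _ hPdet]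
  have hx : ‖P⁻¹ r ᵥ* C'‖ ≤ 1 / c₀ := by
    rw [le_div_iff₀ hc₀, mul_comm]
    refine (hlow _).trans ?_
    rw [hrP, pi_norm_le_iff_of_nonneg zero_le_one]
    intro i
    rw [one_apply]
    split_ifs <;> simp
  have hentry : ∀ i, |(P⁻¹ r ᵥ* C' ᵥ* U - (C * U) r) i| ≤ n * η / c₀ := by
    intro i
    obtain ⟨i, rfl⟩ := (splitEquiv k).surjective i
    rcases i with j | i
    · rw [Pi.sub_apply, h0, sub_zero]
      calc _ ≤ n * η * ‖P⁻¹ r ᵥ* C'‖ := hinl _ j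
        _ ≤ n * η * (1 / c₀) := by gcongr
        _ = n * η / c₀ := by ring
    · rw [Pi.sub_apply, hinr, hrP, h1, sub_self, abs_zero]
      positivity
  have hsplit : (P⁻¹ * (C' * Z)) r a - (C * Z) r a =
      ∑ i, (P⁻¹ r ᵥ* C' ᵥ* U - (C * U) r) i * B i a := by
    have h2 : P⁻¹ * (C' * Z) = P⁻¹ * C' * U * B := by
      rw [Matrix.mul_assoc _ U, hUB, Matrix.mul_assoc]
    have h3 : C * Z = C * U * B := by rw [Matrix.mul_assoc, hUB]
    rw [h2, h3, Matrix.mul_apply, Matrix.mul_apply, ← Finset.sum_sub_distrib]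
    refine Finset.sum_congr rfl fun i _ => ?_
    rw [Pi.sub_apply, sub_mul, mul_apply_eq_vecMul, mul_apply_eq_vecMul]
  rw [hsplit]
  refine lt_of_le_of_lt ?_ hη2
  calc |∑ i, (P⁻¹ r ᵥ* C' ᵥ* U - (C * U) r) i * B i a|
    _ ≤ ∑ i, n * η / c₀ * |B i a| := by
      refine (Finset.abs_sum_le_sum_abs _ _).trans (Finset.sum_le_sum fun i _ => ?_)
      rw [abs_mul]
      gcongr
      exact hentry i
    _ ≤ n * η / c₀ * S := by
      rw [← Finset.mul_sum]
      gcongr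
      exact Finset.sum_le_sum fun i _ => Finset.single_le_sum (f := fun j => |B i j|)
        (fun _ _ => abs_nonneg _) (Finset.mem_univ a)

end Transfer

/-- **Surjectivity / density.** Let `Z` be positive and `C₀` totally
nonnegative of rank `k`.  For every `ε₀ > 0` there are a chord diagram `D`, a domino
matrix `C` of `D` satisfying the sign rules, and an invertible `k × k` matrix `M`, such
that every entry of `M * (C * Z) - C₀ * Z` has absolute value less than `ε₀`; i.e. the
union of the images of the BCFW cells is dense in the amplituhedron `A_{n,k,4}(Z)`. -/
theorem bcfw_images_dense_in_amplituhedron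
    (n k : ℕ) (hk : 1 ≤ k) (hn : k + 4 ≤ n)
    (Z : Matrix (Fin n) (Fin (k + 4)) ℝ) (hZ : IsPositiveMatrix Z)
    (C₀ : Matrix (Fin k) (Fin n) ℝ) (hC₀ : IsTotallyNonnegRect C₀) (hrank : C₀.rank = k)
    (ε₀ : ℝ) (hε₀ : 0 < ε₀) :
    ∃ (D : ChordDiagram n k) (α β γ δ ε : Fin k → ℝ),
      D.SignRules α β γ δ ε ∧
      ∃ M : Matrix (Fin k) (Fin k) ℝ, IsUnit M ∧
        ∀ (r : Fin k) (a : Fin (k + 4)),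
          |(M * (D.dominoMatrix α β γ δ ε * Z)) r a - (C₀ * Z) r a| < ε₀ := by
  obtain ⟨C, hC, hnear⟩ : ∃ C : Matrix (Fin k) (Fin n) ℝ, IsPositiveMatrix C.transpose ∧
      ∀ r a, |(C * Z) r a - (C₀ * Z) r a| < ε₀ / 2 := by
    have hev : ∀ᶠ C in nhds C₀, ∀ r a, |(C * Z) r a - (C₀ * Z) r a| < ε₀ / 2 := by
      refine Filter.eventually_all.2 fun r => Filter.eventually_all.2 fun a => ?_
      have hcont : Continuous fun C : Matrix (Fin k) (Fin n) ℝ =>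
          |(C * Z) r a - (C₀ * Z) r a| := by
        have : Continuous fun C : Matrix (Fin k) (Fin n) ℝ => (C * Z) r a :=
          (continuous_id.matrix_mul continuous_const).matrix_elem r a
        fun_prop
      exact (hcont.tendsto _).eventually_lt_const (by simpa using hε₀)
    exact ((mem_closure_iff_frequently.1 (hC₀.mem_closure hrank)).and_eventually hev).exists
  obtain ⟨D, v, hsign, M, hM, hMC⟩ := hZ.exists_domino_near hk hn hC (half_pos hε₀)
  refine ⟨D, v.α, v.β, v.γ, v.δ, v.ε, hsign, M, hM, fun r a => ?_⟩
  calc _ ≤ _ := abs_sub_le _ ((C * Z) r a) _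
    _ < ε₀ / 2 + ε₀ / 2 := add_lt_add (hMC r a) (hnear r a)
    _ = ε₀ := add_halves ε₀

end
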